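/- Let m, n > 6 be integers with m = n + p(n−4) + q(n−2) for some integers p ≥ 1 and q ≥ 0. Let M̄ = (M_v) be a vector over the vertices of C_m and N̄ = (N_w) a vector over the vertices of C_n, with all entries in {2,3,4,…} ∪ {∞}; set M⁺ = max_v M_v and N⁻ = min_w N_w. If (i) N⁻ = ∞, or (ii) M⁺ < N⁻, or (iii) M⁺ = N⁻ < ∞ and q = 0, then there exists a quasiisometric embedding A_{C_m}(M̄) → A_{C_n}(N̄) with respect to the word metrics. Moreover, if q = 0 and all entries of N̄ are equal to a single finite N, all entries of M̄ are equal to a single finite M, and N = kM for some positive integer k, then there exists an injective group homomorphism A_{C_m}(M̄) → A_{C_n}(N̄) that is a quasiisometric embedding. -/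

import Mathlib

open scoped symmDiff

/-- The commutation relations defining the right-angled Artin group of a simple graph. -/
def raagRels {V : Type*} (Γ : SimpleGraph V) : Set (FreeGroup V) :=
  {r | ∃ v w, Γ.Adj v w ∧
    r = FreeGroup.of v * FreeGroup.of w * (FreeGroup.of v)⁻¹ * (FreeGroup.of w)⁻¹}

/-- The right-angled Artin group of a simple graph. -/
abbrev RAAG {V : Type*} (Γ : SimpleGraph V) : Type _ :=
  PresentedGroup (raagRels Γ)

/-- The standard generating set of a right-angled Artin group. -/
def raagGen {V : Type*} (Γ : SimpleGraph V) : Set (RAAG Γ) :=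
  Set.range (fun v : V => (PresentedGroup.of v : RAAG Γ))

/-- The word length of a group element with respect to a set `S`: the least length of a
word in elements of `S` and their inverses representing the element. -/
noncomputable def wordLength {G : Type*} [Group G] (S : Set G) (g : G) : ℕ :=
  sInf {k | ∃ w : List G, w.length = k ∧ (∀ x ∈ w, x ∈ S ∨ x⁻¹ ∈ S) ∧ w.prod = g}

/-- The word metric associated with a generating set `S`. -/
noncomputable def wordDist {G : Type*} [Group G] (S : Set G) (g h : G) : ℝ :=
  (wordLength S (g⁻¹ * h) : ℝ)

/-- `f` is a quasiisometric embedding with respect to distance functions `dX`, `dY`. -/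
def IsQIEWith {X Y : Type*} (dX : X → X → ℝ) (dY : Y → Y → ℝ) (f : X → Y) : Prop :=
  ∃ K A : ℝ, 1 ≤ K ∧ 0 ≤ A ∧ ∀ x x' : X,
    (1 / K) * dX x x' - A ≤ dY (f x) (f x') ∧ dY (f x) (f x') ≤ K * dX x x' + A

/-- The cycle graph on `n` vertices, with vertex set `ZMod n`. -/
def cycleGraph (n : ℕ) : SimpleGraph (ZMod n) :=
  SimpleGraph.fromRel (fun v w => w = v + 1)

/-- The relations of the graph product of cyclic groups `Z/N_vZ` over `Γ`
(`N v = ⊤` encodes the infinite cyclic group `ℤ`). -/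
def graphProdRels {V : Type*} (Γ : SimpleGraph V) (N : V → ℕ∞) : Set (FreeGroup V) :=
  raagRels Γ ∪ {r | ∃ (v : V) (k : ℕ), N v = (k : ℕ∞) ∧ r = (FreeGroup.of v) ^ k}

/-- The graph product over `Γ` of the cyclic groups `Z/N_vZ`, i.e. the quotient of the
right-angled Artin group `A_Γ` by the relations `s_v ^ N_v = 1` for `N_v` finite. -/
abbrev GraphProd {V : Type*} (Γ : SimpleGraph V) (N : V → ℕ∞) : Type _ :=
  PresentedGroup (graphProdRels Γ N)

/-- The standard generating set of a graph product of cyclic groups. -/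
def graphProdGen {V : Type*} (Γ : SimpleGraph V) (N : V → ℕ∞) : Set (GraphProd Γ N) :=
  Set.range (fun v : V => (PresentedGroup.of v : GraphProd Γ N))

namespace GraphProdQIE

section WordLength

variable {G : Type*} [Group G] {S : Set G}

theorem wordLength_prod_le (w : List G) (hw : ∀ x ∈ w, x ∈ S ∨ x⁻¹ ∈ S) :
    wordLength S w.prod ≤ w.length :=
  Nat.sInf_le ⟨w, rfl, hw, rfl⟩

theorem exists_word (hS : Subgroup.closure S = ⊤) (g : G) :
    ∃ w : List G, w.length = wordLength S g ∧ (∀ x ∈ w, x ∈ S ∨ x⁻¹ ∈ S) ∧ w.prod = g := by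
  have hne : {k | ∃ w : List G, w.length = k ∧ (∀ x ∈ w, x ∈ S ∨ x⁻¹ ∈ S) ∧
      w.prod = g}.Nonempty := by
    have hg : g ∈ Subgroup.closure S := hS ▸ Subgroup.mem_top g
    rw [← Subgroup.mem_toSubmonoid, Subgroup.closure_toSubmonoid] at hg
    obtain ⟨w, hw, hp⟩ := Submonoid.exists_list_of_mem_closure hg
    exact ⟨w.length, w, rfl, hw, hp⟩
  exact Nat.sInf_mem hne

theorem wordLength_one : wordLength S (1 : G) = 0 :=
  Nat.le_zero.1 (wordLength_prod_le (S := S) [] (by simp))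

theorem wordLength_mul_le (hS : Subgroup.closure S = ⊤) (g h : G) :
    wordLength S (g * h) ≤ wordLength S g + wordLength S h := by
  obtain ⟨w, hw, hw', rfl⟩ := exists_word hS g
  obtain ⟨u, hu, hu', rfl⟩ := exists_word hS h
  rw [← hw, ← hu, ← List.prod_append, ← List.length_append]
  refine wordLength_prod_le _ fun x hx => ?_
  rcases List.mem_append.1 hx with h | h
  exacts [hw' x h, hu' x h]

theorem wordLength_inv_le (hS : Subgroup.closure S = ⊤) (g : G) :
    wordLength S g⁻¹ ≤ wordLength S g := by
  obtain ⟨w, hw, hw', rfl⟩ := exists_word hS g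
  rw [← hw, List.prod_inv_reverse]
  refine (wordLength_prod_le _ fun x hx => ?_).trans (by simp)
  simp only [List.mem_reverse, List.mem_map] at hx
  obtain ⟨y, hy, rfl⟩ := hx
  simpa [or_comm] using hw' y hy

theorem wordLength_inv (hS : Subgroup.closure S = ⊤) (g : G) :
    wordLength S g⁻¹ = wordLength S g :=
  (wordLength_inv_le hS g).antisymm (by simpa using wordLength_inv_le hS g⁻¹)

theorem wordLength_le_one {g : G} (hg : g ∈ S) : wordLength S g ≤ 1 := by
  simpa using wordLength_prod_le (S := S) [g] (by simp [hg])

theorem wordLength_lipschitz {H : Type*} [Group H] {T : Set H}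
    (hS : Subgroup.closure S = ⊤) (hT : Subgroup.closure T = ⊤) (f : G → H) (C : ℕ)
    (hf : ∀ g, ∀ s ∈ S, wordLength T ((f g)⁻¹ * f (g * s)) ≤ C) (g h : G) :
    wordLength T ((f g)⁻¹ * f h) ≤ C * wordLength S (g⁻¹ * h) := by
  obtain ⟨w, hw, hw', hp⟩ := exists_word hS (g⁻¹ * h)
  rw [← hw]
  obtain rfl : h = g * w.prod := by rw [hp]; group
  clear hp hw
  induction w generalizing g with
  | nil => simp [wordLength_one]
  | cons x w ih =>
    have h1 := ih (g * x) fun y hy => hw' y (List.mem_cons_of_mem _ hy)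
    have h2 : wordLength T ((f g)⁻¹ * f (g * x)) ≤ C := by
      rcases hw' x List.mem_cons_self with hx | hx
      · exact hf g x hx
      · have := hf (g * x) _ hx
        rw [mul_inv_cancel_right, ← wordLength_inv hT] at this
        simpa using this
    have h3 := wordLength_mul_le hT ((f g)⁻¹ * f (g * x)) ((f (g * x))⁻¹ * f (g * x * w.prod))
    have h4 : (f g)⁻¹ * f (g * x) * ((f (g * x))⁻¹ * f (g * x * w.prod)) =
        (f g)⁻¹ * f (g * (x :: w).prod) := by
      rw [List.prod_cons, ← mul_assoc g]; group
    rw [h4] at h3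
    rw [List.length_cons, mul_add]
    omega

theorem isQIEWith_of_retraction {H : Type*} [Group H] {T : Set H}
    {F : G → H} {R : H → G} {C D : ℕ}
    (hF : ∀ g h, wordLength T ((F g)⁻¹ * F h) ≤ C * wordLength S (g⁻¹ * h))
    (hR : ∀ g h, wordLength S ((R g)⁻¹ * R h) ≤ D * wordLength T (g⁻¹ * h))
    (hRF : ∀ g, R (F g) = g) : IsQIEWith (wordDist S) (wordDist T) F := by
  have hK : (1 : ℝ) ≤ C + D + 1 := by
    have : (0 : ℝ) ≤ C + D := by positivity
    linarith
  refine ⟨C + D + 1, 0, hK, le_rfl, fun x x' => ⟨?_, ?_⟩⟩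
  · have h := hR (F x) (F x')
    rw [hRF, hRF] at h
    have h' : (wordLength S (x⁻¹ * x') : ℝ) ≤ D * wordLength T ((F x)⁻¹ * F x') := by
      exact_mod_cast h
    rw [sub_zero, one_div, inv_mul_le_iff₀ (by linarith), wordDist, wordDist]
    refine h'.trans (mul_le_mul_of_nonneg_right ?_ (by positivity))
    have : (0 : ℝ) ≤ C := by positivity
    linarith
  · have h' : (wordLength T ((F x)⁻¹ * F x') : ℝ) ≤ C * wordLength S (x⁻¹ * x') := by
      exact_mod_cast hF x x'
    rw [add_zero, wordDist, wordDist]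
    refine h'.trans (mul_le_mul_of_nonneg_right ?_ (by positivity))
    have : (0 : ℝ) ≤ D := by positivity
    linarith

theorem IsQIEWith.comp {X Y Z : Type*} {dX : X → X → ℝ} {dY : Y → Y → ℝ} {dZ : Z → Z → ℝ}
    {f : X → Y} {g : Y → Z} (hg : IsQIEWith dY dZ g) (hf : IsQIEWith dX dY f) :
    IsQIEWith dX dZ (fun x => g (f x)) := by
  obtain ⟨K, A, hK, hA, h⟩ := hf
  obtain ⟨L, B, hL, hB, h'⟩ := hg
  refine ⟨L * K, L * A + B, by nlinarith, by positivity, fun x x' => ⟨?_, ?_⟩⟩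
  · have h1 := (h x x').1
    have h2 := (h' (f x) (f x')).1
    have h3 : 1 / L * (1 / K * dX x x' - A) ≤ 1 / L * dY (f x) (f x') :=
      mul_le_mul_of_nonneg_left h1 (by positivity)
    have h4 : 1 / L * A ≤ L * A := by
      refine mul_le_mul_of_nonneg_right ?_ hA
      rw [div_le_iff₀ (by linarith)]
      nlinarith
    have h5 : 1 / (L * K) * dX x x' = 1 / L * (1 / K * dX x x') := by
      field_simp
    rw [h5]
    linarith
  · have h1 := (h x x').2
    have h2 := (h' (f x) (f x')).2
    have h3 : L * dY (f x) (f x') ≤ L * (K * dX x x' + A) :=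
      mul_le_mul_of_nonneg_left h1 (by linarith)
    linarith

end WordLength
end GraphProdQIE

namespace GraphProdQIE

/-- The order of a cyclic group `ZMod k`, as an extended natural number. -/
def cycOrd (k : ℕ) : ℕ∞ := if k = 0 then ⊤ else k

/-- The graph product of the cyclic groups `ZMod (K v)`. -/
abbrev GP {V : Type*} (Γ : SimpleGraph V) (K : V → ℕ) : Type _ :=
  GraphProd Γ (fun v => cycOrd (K v))

section Basic

variable {V : Type*} {Γ : SimpleGraph V} {K : V → ℕ}

theorem closure_graphProdGen (N : V → ℕ∞) : Subgroup.closure (graphProdGen Γ N) = ⊤ :=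
  PresentedGroup.closure_range_of _

/-- The word norm on a graph product of cyclic groups. -/
noncomputable def nrm (g : GP Γ K) : ℕ := wordLength (graphProdGen Γ _) g

@[simp] theorem nrm_one : nrm (1 : GP Γ K) = 0 := wordLength_one

theorem nrm_mul_le (g h : GP Γ K) : nrm (g * h) ≤ nrm g + nrm h :=
  wordLength_mul_le (closure_graphProdGen _) g h

@[simp] theorem nrm_inv (g : GP Γ K) : nrm g⁻¹ = nrm g :=
  wordLength_inv (closure_graphProdGen _) g

theorem nrm_triangle (a b c : GP Γ K) : nrm (a⁻¹ * c) ≤ nrm (a⁻¹ * b) + nrm (b⁻¹ * c) := by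
  have := nrm_mul_le (a⁻¹ * b) (b⁻¹ * c)
  rwa [mul_assoc, mul_inv_cancel_left] at this

theorem nrm_comm (a b : GP Γ K) : nrm (a⁻¹ * b) = nrm (b⁻¹ * a) := by
  rw [← nrm_inv]; simp

/-- The standard generator of a graph product. -/
abbrev gen (Γ : SimpleGraph V) (K : V → ℕ) (v : V) : GP Γ K := PresentedGroup.of v

theorem nrm_gen_le (v : V) : nrm (gen Γ K v) ≤ 1 := wordLength_le_one ⟨v, rfl⟩

theorem nrm_zpow_le (g : GP Γ K) (i : ℤ) : nrm (g ^ i) ≤ i.natAbs * nrm g := by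
  have h : ∀ k : ℕ, nrm (g ^ k) ≤ k * nrm g := by
    intro k
    induction k with
    | zero => simp
    | succ k ih =>
      rw [pow_succ]
      have := nrm_mul_le (g ^ k) g
      rw [add_mul]
      omega
  rcases Int.natAbs_eq i with hi | hi
  · conv_lhs => rw [hi, zpow_natCast]
    exact h i.natAbs
  · conv_lhs => rw [hi, zpow_neg, nrm_inv, zpow_natCast]
    exact h i.natAbs

theorem gen_pow (v : V) : gen Γ K v ^ K v = 1 := by
  by_cases h : K v = 0
  · simp [h]
  · have : (FreeGroup.of v) ^ K v ∈ graphProdRels Γ (fun v => cycOrd (K v)) :=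
      Or.inr ⟨v, K v, by simp [cycOrd, h], rfl⟩
    have h1 := PresentedGroup.one_of_mem this
    rwa [map_pow] at h1

theorem gen_comm {v w : V} (h : Γ.Adj v w) : Commute (gen Γ K v) (gen Γ K w) := by
  have : FreeGroup.of v * FreeGroup.of w * (FreeGroup.of v)⁻¹ * (FreeGroup.of w)⁻¹ ∈
      graphProdRels Γ (fun v => cycOrd (K v)) := Or.inl ⟨v, w, h, rfl⟩
  have h1 := PresentedGroup.one_of_mem this
  simp only [map_mul, map_inv] at h1
  exact mul_inv_eq_iff_eq_mul.1 (mul_inv_eq_one.1 h1)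

/-- The power `s_v ^ z` of a generator, for `z` in `ZMod (K v)`. -/
noncomputable def pw (v : V) (z : ZMod (K v)) : GP Γ K := gen Γ K v ^ (z.cast : ℤ)

theorem pw_intCast (v : V) (i : ℤ) : (pw v (i : ZMod (K v)) : GP Γ K) = gen Γ K v ^ i := by
  have h : (((i : ZMod (K v)).cast : ℤ) : ZMod (K v)) = i := ZMod.intCast_zmod_cast _
  obtain ⟨c, hc⟩ := (ZMod.intCast_eq_intCast_iff_dvd_sub _ _ _).1 h
  have : i = ((i : ZMod (K v)).cast : ℤ) + K v * c := by linarith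
  rw [pw]
  conv_rhs => rw [this, zpow_add, zpow_mul, zpow_natCast, gen_pow, one_zpow, mul_one]

@[simp] theorem pw_zero (v : V) : (pw v 0 : GP Γ K) = 1 := by
  simpa using pw_intCast (Γ := Γ) (K := K) v 0

theorem pw_one (v : V) : (pw v 1 : GP Γ K) = gen Γ K v := by
  simpa using pw_intCast (Γ := Γ) (K := K) v 1

theorem pw_add (v : V) (y z : ZMod (K v)) : (pw v (y + z) : GP Γ K) = pw v y * pw v z := by
  obtain ⟨a, rfl⟩ := ZMod.intCast_surjective y
  obtain ⟨b, rfl⟩ := ZMod.intCast_surjective z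
  rw [← Int.cast_add, pw_intCast, pw_intCast, pw_intCast, zpow_add]

theorem pw_neg (v : V) (z : ZMod (K v)) : (pw v (-z) : GP Γ K) = (pw v z)⁻¹ := by
  rw [eq_inv_iff_mul_eq_one, ← pw_add]; simp

theorem pw_comm {v w : V} (h : Γ.Adj v w) (y : ZMod (K v)) (z : ZMod (K w)) :
    Commute (pw v y : GP Γ K) (pw w z) :=
  ((gen_comm h).zpow_left _).zpow_right _

theorem nrm_pw_intCast_le (v : V) (i : ℤ) : nrm (pw v (i : ZMod (K v)) : GP Γ K) ≤ i.natAbs := by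
  rw [pw_intCast]
  refine (nrm_zpow_le _ _).trans ?_
  simpa using Nat.mul_le_mul_left i.natAbs (nrm_gen_le v)

theorem nrm_pw_le (v : V) (h : K v ≠ 0) (z : ZMod (K v)) : nrm (pw v z : GP Γ K) ≤ K v := by
  have : NeZero (K v) := ⟨h⟩
  have := nrm_pw_intCast_le (Γ := Γ) (K := K) v (z.val : ℤ)
  rw [Int.cast_natCast, ZMod.natCast_zmod_val, Int.natAbs_natCast] at this
  exact this.trans z.val_lt.le

theorem gp_induction {P : GP Γ K → Prop} (one : P 1)
    (mul : ∀ g v z, P g → P (g * pw v z)) (g : GP Γ K) : P g := by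
  have hg : g ∈ Subgroup.closure (graphProdGen Γ fun v => cycOrd (K v)) :=
    closure_graphProdGen (Γ := Γ) (fun v => cycOrd (K v)) ▸ Subgroup.mem_top g
  induction hg using Subgroup.closure_induction_right with
  | one => exact one
  | mul_right x _ y hy h =>
    obtain ⟨v, rfl⟩ := hy
    have := mul x v 1 h
    rwa [pw_one] at this
  | mul_inv_cancel x _ y hy h =>
    obtain ⟨v, rfl⟩ := hy
    have := mul x v (-1) h
    rwa [pw_neg, pw_one] at this

/-- A right action of a graph product of cyclic groups, given by commuting actions of its
vertex groups. -/
structure RightAct (Γ : SimpleGraph V) (K : V → ℕ) (X : Type*) where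
  /-- The action of the vertex group at `v`. -/
  a : ∀ v, ZMod (K v) → X → X
  a_zero : ∀ v x, a v 0 x = x
  a_add : ∀ v y z x, a v (y + z) x = a v z (a v y x)
  a_comm : ∀ v w, Γ.Adj v w → ∀ y z x, a v y (a w z x) = a w z (a v y x)

namespace RightAct

variable {X : Type*} (A : RightAct Γ K X)

/-- The permutation by which a generator acts. -/
def perm (v : V) (z : ZMod (K v)) : Equiv.Perm X where
  toFun := A.a v z
  invFun := A.a v (-z)
  left_inv x := by rw [← A.a_add]; simp [A.a_zero]
  right_inv x := by rw [← A.a_add]; simp [A.a_zero]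

theorem perm_pow (v : V) (k : ℕ) : A.perm v 1 ^ k = A.perm v k := by
  induction k with
  | zero => ext x; simp [perm, A.a_zero]
  | succ k ih =>
    rw [pow_succ', ih]
    ext x
    simp [perm, A.a_add]

theorem lift_rels : ∀ r ∈ graphProdRels Γ (fun v => cycOrd (K v)),
    FreeGroup.lift (fun v => MulOpposite.op (A.perm v 1)) r = 1 := by
  rintro r (⟨v, w, h, rfl⟩ | ⟨v, k, h, rfl⟩)
  · simp only [map_mul, map_inv, FreeGroup.lift_apply_of]
    rw [mul_inv_eq_one, mul_inv_eq_iff_eq_mul, ← MulOpposite.op_mul, ← MulOpposite.op_mul]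
    congr 1
    ext x
    exact A.a_comm w v h.symm 1 1 x
  · have hk : k = K v := by
      simp only [cycOrd] at h
      split_ifs at h with h0
      · exact absurd h.symm (ENat.natCast_ne_top k)
      · exact_mod_cast h.symm
    subst hk
    simp only [map_pow, FreeGroup.lift_apply_of]
    rw [← MulOpposite.op_pow, perm_pow]
    apply MulOpposite.unop_injective
    ext x
    simp [perm, A.a_zero]

/-- The action of a group element. -/
def run (g : GP Γ K) (x : X) : X :=
  (PresentedGroup.toGroup A.lift_rels g).unop x

@[simp] theorem run_one (x : X) : A.run 1 x = x := by simp [run]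

theorem run_mul (g h : GP Γ K) (x : X) : A.run (g * h) x = A.run h (A.run g x) := by
  simp [run]

theorem run_gen (v : V) (x : X) : A.run (gen Γ K v) x = A.a v 1 x := by
  simp only [run, PresentedGroup.toGroup.of]
  rfl

theorem run_pw (v : V) (z : ZMod (K v)) (x : X) : A.run (pw v z) x = A.a v z x := by
  have h : ∀ k : ℕ, ∀ x, A.run (gen Γ K v ^ k) x = A.a v k x := by
    intro k
    induction k with
    | zero => intro x; simp [A.a_zero]
    | succ k ih => intro x; rw [pow_succ, run_mul, ih, run_gen, Nat.cast_succ, A.a_add]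
  obtain ⟨i, rfl⟩ := ZMod.intCast_surjective z
  rw [pw_intCast]
  rcases Int.natAbs_eq i with hi | hi
  · rw [hi, zpow_natCast, h]; simp
  · rw [hi, zpow_neg, zpow_natCast]
    have h1 : A.run (gen Γ K v ^ i.natAbs * (gen Γ K v ^ i.natAbs)⁻¹)
        (A.a v ((-(i.natAbs : ℤ) : ℤ) : ZMod (K v)) x) =
        A.a v ((-(i.natAbs : ℤ) : ℤ) : ZMod (K v)) x := by simp
    rw [run_mul, h, ← A.a_add] at h1
    simpa [A.a_zero] using h1

theorem run_mul_pw (g : GP Γ K) (v : V) (z : ZMod (K v)) (x : X) :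
    A.run (g * pw v z) x = A.a v z (A.run g x) := by rw [run_mul, run_pw]

theorem run_inv_eq {g : GP Γ K} {x y : X} (h : A.run g x = y) : A.run g⁻¹ y = x := by
  rw [← h, ← run_mul]; simp

theorem lipschitz {V' : Type*} {Γ' : SimpleGraph V'} {K' : V' → ℕ} (f : X → GP Γ' K') (C : ℕ)
    (hf : ∀ x v, nrm ((f x)⁻¹ * f (A.a v 1 x)) ≤ C) (x : X) (g h : GP Γ K) :
    nrm ((f (A.run g x))⁻¹ * f (A.run h x)) ≤ C * nrm (g⁻¹ * h) := by
  refine wordLength_lipschitz (closure_graphProdGen _) (closure_graphProdGen _)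
    (fun g => f (A.run g x)) C ?_ g h
  rintro g _ ⟨v, rfl⟩
  have := hf (A.run g x) v
  rwa [← run_gen, ← run_mul] at this

end RightAct

end Basic

end GraphProdQIE

namespace GraphProdQIE

section Vertexwise

variable {V : Type*} {Γ : SimpleGraph V} {K K' : V → ℕ}

/-- The action of `GP Γ K` on `GP Γ K'` twisted by maps between the vertex groups; the second
component records the current exponents. -/
noncomputable def twist [DecidableEq V] (Γ : SimpleGraph V) (φ : ∀ v, ZMod (K v) → ZMod (K' v)) :
    RightAct Γ K (GP Γ K' × ∀ v, ZMod (K v)) where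
  a v z x := (x.1 * pw v (φ v (x.2 v + z) - φ v (x.2 v)), Function.update x.2 v (x.2 v + z))
  a_zero v x := by simp
  a_add v y z x := by
    ext1
    · simp only [Function.update_self]
      rw [mul_assoc, ← pw_add, ← add_assoc]
      congr 2
      ring
    · simp [add_assoc]
  a_comm v w h y z x := by
    have hne := h.ne
    ext1
    · simp only [Function.update_of_ne hne, Function.update_of_ne hne.symm]
      rw [mul_assoc, mul_assoc, (pw_comm h _ _).eq]
    · simp only [Function.update_of_ne hne, Function.update_of_ne hne.symm]
      exact Function.update_comm hne.symm _ _ _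

theorem twist_retract [DecidableEq V]
    {φ : ∀ v, ZMod (K v) → ZMod (K' v)} {ψ : ∀ v, ZMod (K' v) → ZMod (K v)}
    (h0 : ∀ v, φ v 0 = 0) (hφ : ∀ v e, ψ v (φ v e) = e) (g : GP Γ K) :
    (twist Γ ψ).run ((twist Γ φ).run g (1, 0)).1 (1, 0) =
      (g, fun v => φ v (((twist Γ φ).run g (1, 0)).2 v)) := by
  induction g using gp_induction with
  | one => simp only [RightAct.run_one, Pi.zero_apply, h0]; rfl
  | mul g v z ih =>
    rw [RightAct.run_mul_pw]
    simp only [twist, RightAct.run_mul_pw] at ih ⊢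
    rw [ih]
    simp only [add_sub_cancel, hφ, add_sub_cancel_left, Prod.mk.injEq, true_and]
    funext w
    by_cases hw : w = v
    · subst hw; simp
    · simp [Function.update_of_ne hw]

theorem twist_lipschitz [DecidableEq V] (φ : ∀ v, ZMod (K v) → ZMod (K' v)) (C : ℕ)
    (hC : ∀ v e, nrm (pw v (φ v (e + 1) - φ v e) : GP Γ K') ≤ C) (g h : GP Γ K) :
    nrm (((twist Γ φ).run g (1, 0)).1⁻¹ * ((twist Γ φ).run h (1, 0)).1) ≤ C * nrm (g⁻¹ * h) := by
  refine (twist Γ φ).lipschitz (fun x => x.1) C (fun x v => ?_) _ g h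
  simpa [twist] using hC v (x.2 v)

theorem isQIEWith_of_nrm {V' : Type*} {Γ' : SimpleGraph V'} {L : V' → ℕ}
    {F : GP Γ K → GP Γ' L} {R : GP Γ' L → GP Γ K} {C D : ℕ}
    (hF : ∀ g h, nrm ((F g)⁻¹ * F h) ≤ C * nrm (g⁻¹ * h))
    (hR : ∀ g h, nrm ((R g)⁻¹ * R h) ≤ D * nrm (g⁻¹ * h))
    (hRF : ∀ g, R (F g) = g) :
    IsQIEWith (wordDist (graphProdGen Γ _)) (wordDist (graphProdGen Γ' _)) F :=
  isQIEWith_of_retraction hF hR hRF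

theorem twist_isQIEWith [DecidableEq V]
    {φ : ∀ v, ZMod (K v) → ZMod (K' v)} {ψ : ∀ v, ZMod (K' v) → ZMod (K v)}
    (h0 : ∀ v, φ v 0 = 0) (hφ : ∀ v e, ψ v (φ v e) = e) (C D : ℕ)
    (hC : ∀ v e, nrm (pw v (φ v (e + 1) - φ v e) : GP Γ K') ≤ C)
    (hD : ∀ v e, nrm (pw v (ψ v (e + 1) - ψ v e) : GP Γ K) ≤ D) :
    IsQIEWith (wordDist (graphProdGen Γ _)) (wordDist (graphProdGen Γ _))
      (fun g : GP Γ K => ((twist Γ φ).run g (1, 0)).1) :=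
  isQIEWith_of_nrm (R := fun g => ((twist Γ ψ).run g (1, 0)).1)
    (twist_lipschitz φ C hC) (twist_lipschitz ψ D hD) (fun g => by rw [twist_retract h0 hφ])

/-- The inclusion of exponents from `ZMod a` into `ZMod b`. -/
def expUp (a b : ℕ) (e : ZMod a) : ZMod b := ((e.cast : ℤ) : ZMod b)

theorem expUp_zero (a b : ℕ) : expUp a b 0 = 0 := by simp [expUp]

theorem expUp_expUp {a b : ℕ} (h : a = 0 → b = 0) (h' : b ≠ 0 → a ≤ b) (e : ZMod a) :
    expUp b a (expUp a b e) = e := by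
  unfold expUp
  rcases Nat.eq_zero_or_pos a with rfl | ha
  · obtain rfl := h rfl
    simp
  · have : NeZero a := ⟨ha.ne'⟩
    have he : ((e.cast : ℤ)) = (e.val : ℤ) := by
      rw [ZMod.cast_eq_val]
    rcases Nat.eq_zero_or_pos b with rfl | hb
    · exact ZMod.intCast_zmod_cast e
    · have : NeZero b := ⟨hb.ne'⟩
      rw [he, Int.cast_natCast, ZMod.cast_eq_val,
        ZMod.val_natCast_of_lt (e.val_lt.trans_le (h' hb.ne'))]
      simp

theorem exists_bound_incr [Finite V] (f : ∀ v, ZMod (K v) → ZMod (K' v))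
    (h : ∀ v, K' v = 0 → K v ≠ 0 ∨ ∀ e, f v (e + 1) - f v e = 1) :
    ∃ C, ∀ v e, nrm (pw v (f v (e + 1) - f v e) : GP Γ K') ≤ C := by
  have h1 : ∀ v, ∃ C, ∀ e, nrm (pw v (f v (e + 1) - f v e) : GP Γ K') ≤ C := by
    intro v
    by_cases h0 : K' v = 0
    · rcases h v h0 with h2 | h2
      · have : NeZero (K v) := ⟨h2⟩
        obtain ⟨C, hC⟩ := (Set.finite_range
          fun e => nrm (pw v (f v (e + 1) - f v e) : GP Γ K')).bddAbove
        exact ⟨C, fun e => hC ⟨e, rfl⟩⟩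
      · exact ⟨1, fun e => by rw [h2, pw_one]; exact nrm_gen_le v⟩
    · exact ⟨K' v, fun e => nrm_pw_le v h0 _⟩
  choose C hC using h1
  obtain ⟨B, hB⟩ := (Set.finite_range C).bddAbove
  exact ⟨B, fun v e => (hC v e).trans (hB ⟨v, rfl⟩)⟩

/-- Enlarging the vertex groups gives a quasiisometric embedding. -/
theorem exists_isQIEWith_of_le [DecidableEq V] [Finite V] (Γ : SimpleGraph V)
    (h : ∀ v, K v = 0 → K' v = 0) (h' : ∀ v, K' v ≠ 0 → K v ≤ K' v) :
    ∃ F : GP Γ K → GP Γ K', IsQIEWith (wordDist (graphProdGen Γ _))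
      (wordDist (graphProdGen Γ _)) F := by
  have hid : ∀ a b : ℕ, a = 0 → b = 0 → ∀ e : ZMod a, expUp a b (e + 1) - expUp a b e = 1 := by
    rintro a b rfl rfl e
    simp [expUp]
  obtain ⟨C, hC⟩ := exists_bound_incr (Γ := Γ) (fun v => expUp (K v) (K' v)) (fun v h0 => by
    by_cases h1 : K v = 0
    · exact Or.inr (hid _ _ h1 h0)
    · exact Or.inl h1)
  obtain ⟨D, hD⟩ := exists_bound_incr (Γ := Γ) (fun v => expUp (K' v) (K v)) (fun v h0 =>
    Or.inr (hid _ _ (h v h0) h0))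
  exact ⟨_, twist_isQIEWith (fun v => expUp_zero _ _)
    (fun v e => expUp_expUp (h v) (h' v) e) C D hC hD⟩

end Vertexwise

end GraphProdQIE

namespace GraphProdQIE

section Cycle

theorem adj_iff {r : ℕ} (hr : 2 ≤ r) (v w : ZMod r) :
    (cycleGraph r).Adj v w ↔ w = v + 1 ∨ v = w + 1 := by
  have : Fact (1 < r) := ⟨hr⟩
  rw [cycleGraph, SimpleGraph.fromRel_adj]
  constructor
  · exact fun h => h.2
  · intro h
    refine ⟨?_, h⟩
    rintro rfl
    rcases h with h | h <;> exact one_ne_zero (left_eq_add.1 h)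

/-- An affine parametrization `l ↦ ± l + c` of `ZMod r` by the integers. -/
structure Aff (r : ℕ) where
  /-- The orientation. -/
  s : ℤˣ
  /-- The base point. -/
  c : ZMod r

namespace Aff

variable {r : ℕ}

/-- The point with coordinate `l`. -/
def pt (A : Aff r) (l : ℤ) : ZMod r := (((A.s : ℤ) * l : ℤ) : ZMod r) + A.c

instance : CoeFun (Aff r) (fun _ => ℤ → ZMod r) := ⟨pt⟩

/-- The parametrization `l ↦ A (l + b)`. -/
def shift (A : Aff r) (b : ℤ) : Aff r := ⟨A.s, A b⟩

/-- The parametrization `l ↦ A (b - l)`. -/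
def refl (A : Aff r) (b : ℤ) : Aff r := ⟨-A.s, A b⟩

theorem shift_apply (A : Aff r) (b l : ℤ) : A.shift b l = A (l + b) := by
  simp only [shift, pt]; push_cast; ring

theorem refl_apply (A : Aff r) (b l : ℤ) : A.refl b l = A (b - l) := by
  simp only [refl, pt, Units.val_neg]; push_cast; ring

theorem apply_eq_iff (A : Aff r) (a b : ℤ) : A a = A b ↔ (r : ℤ) ∣ b - a := by
  rw [← ZMod.intCast_eq_intCast_iff_dvd_sub, pt, pt, add_left_inj]
  rcases Int.units_eq_one_or A.s with h | h <;> simp [h]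

theorem apply_add (A : Aff r) (a : ℤ) : A (a + r) = A a := by
  rw [apply_eq_iff]; simp

theorem apply_inj (A : Aff r) {a b : ℕ} (ha : a < r) (hb : b < r) : A a = A b ↔ a = b := by
  rw [apply_eq_iff]
  constructor
  · rintro ⟨c, hc⟩
    have h1 : c < 1 := by by_contra h; nlinarith
    have h2 : -1 < c := by by_contra h; nlinarith
    have : c = 0 := by omega
    subst this
    omega
  · rintro rfl; simp

theorem adj_succ (A : Aff r) (hr : 2 ≤ r) (a : ℤ) : (cycleGraph r).Adj (A a) (A (a + 1)) := by
  rw [adj_iff hr]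
  rcases Int.units_eq_one_or A.s with h | h
  · left; simp [pt, h]; ring
  · right; simp [pt, h]; ring

theorem adj_apply (A : Aff r) (hr : 2 ≤ r) {a b : ℕ} (ha : a < r) (hb : b < r)
    (h : (cycleGraph r).Adj (A a) (A b)) :
    a = b + 1 ∨ b = a + 1 ∨ (a = 0 ∧ b + 1 = r) ∨ (b = 0 ∧ a + 1 = r) := by
  have key : A b = A (a + 1) ∨ A a = A (b + 1) := by
    rw [adj_iff hr] at h
    rcases Int.units_eq_one_or A.s with hs | hs <;> rcases h with h | h <;>
      simp only [pt, hs, Units.val_one, Units.val_neg, one_mul, neg_mul] at h ⊢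
    · left; push_cast at *; linear_combination h
    · right; push_cast at *; linear_combination h
    · right; push_cast at *; linear_combination -h
    · left; push_cast at *; linear_combination -h
  have aux : ∀ a b : ℕ, a < r → b < r → A b = A (a + 1) → b = a + 1 ∨ (b = 0 ∧ a + 1 = r) := by
    intro a b ha hb h
    rcases Nat.lt_or_ge (a + 1) r with h1 | h1
    · left
      rw [← Nat.cast_succ] at h
      exact (apply_inj A hb h1).1 h
    · right
      have h2 : a + 1 = r := by omega
      refine ⟨?_, h2⟩
      have h3 : A b = A (0 : ℕ) := by
        rw [h, ← A.apply_add (0 : ℕ)]; congr 1; push_cast; omega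
      exact (apply_inj A hb (by omega)).1 h3
  rcases key with h | h
  · rcases aux a b ha hb h with h | h
    · exact Or.inr (Or.inl h)
    · exact Or.inr (Or.inr (Or.inr h))
  · rcases aux b a hb ha h with h | h
    · exact Or.inl h
    · exact Or.inr (Or.inr (Or.inl h))

/-- The coordinate of a point in an affine parametrization. -/
def inv (A : Aff r) (t : ZMod r) : ℕ := (((A.s : ℤ) : ZMod r) * (t - A.c)).val

theorem inv_lt [NeZero r] (A : Aff r) (t : ZMod r) : A.inv t < r := ZMod.val_lt _

theorem apply_inv [NeZero r] (A : Aff r) (t : ZMod r) : A (A.inv t) = t := by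
  simp only [inv, pt]
  push_cast
  rw [ZMod.natCast_zmod_val]
  rcases Int.units_eq_one_or A.s with h | h <;> simp [h]

theorem inv_apply [NeZero r] (A : Aff r) {l : ℕ} (hl : l < r) : A.inv (A l) = l :=
  (A.apply_inj (A.inv_lt _) hl).1 (A.apply_inv _)

end Aff

end Cycle

/-- The numerical data of the embedding. The integers `n` and `m` of the theorem are `a + 7` and
`a + 7 + p (a + 3) + q (a + 5)`, and the vertex groups are `ZMod M` and `ZMod N`. -/
structure Data where
  /-- `n - 7` -/
  a : ℕ
  /-- The number of `n - 4` steps. -/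
  p : ℕ
  /-- The number of `n - 2` steps. -/
  q : ℕ
  /-- The order of the vertex groups over the `m`-cycle. -/
  M : ℕ
  /-- The order of the vertex groups over the `n`-cycle. -/
  N : ℕ
  hp : 1 ≤ p
  hN : N ≠ 1
  /-- The embedding of vertex groups. -/
  φ : ZMod M → ZMod N
  /-- The retraction of vertex groups. -/
  ψ : ZMod N → ZMod M
  ψφ : ∀ e, ψ (φ e) = e
  φ0 : φ 0 = 0
  φ_ne_one : q ≠ 0 → ∀ e, φ e ≠ 1
  ψ_one : q ≠ 0 → ψ 1 = 0
  φψ : q ≠ 0 → ∀ s, s ≠ 1 → φ (ψ s) = s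

namespace Data

variable (D : Data)

/-- The length of the small cycle. -/
abbrev n : ℕ := D.a + 7

/-- The length of the large cycle. -/
abbrev m : ℕ := D.a + 7 + D.p * (D.a + 3) + D.q * (D.a + 5)

/-- The number of steps. -/
abbrev k : ℕ := D.p + D.q

instance : NeZero D.m := ⟨by simp only [m]; omega⟩
instance : NeZero D.n := ⟨by simp only [n]; omega⟩

/-- The offset of the labels of the `j`-th small cycle. -/
def β (j : ℕ) : ℕ :=
  2 * D.k + if j ≤ D.p then D.q * (D.a + 3) + (D.p - j) * (D.a + 1) else (D.k - j) * (D.a + 3)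

theorem β_k : D.β D.k = 2 * D.k := by
  unfold β k
  split_ifs with h
  · have : D.q = 0 := by omega
    simp [this]
  · simp

theorem n_eq : D.n = D.a + 7 := rfl

theorem m_eq : D.m = D.β 0 + D.n := by
  simp only [β, m, n, k]
  simp
  ring

theorem β_p {j : ℕ} (h : j < D.p) : D.β j = D.β (j + 1) + (D.a + 1) := by
  obtain ⟨c, hc⟩ := Nat.exists_eq_add_of_lt h
  have h1 : D.p - j = c + 1 := by omega
  have h2 : D.p - (j + 1) = c := by omega
  simp only [β, if_pos h.le, if_pos (Nat.succ_le_of_lt h), h1, h2]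
  ring

theorem β_q {j : ℕ} (h : D.p ≤ j) (h' : j < D.k) : D.β j = D.β (j + 1) + (D.a + 3) := by
  obtain ⟨c, hc⟩ := Nat.exists_eq_add_of_lt h'
  have h1 : D.k - j = c + 1 := by omega
  have h2 : D.k - (j + 1) = c := by omega
  have h3 : ¬ j + 1 ≤ D.p := by omega
  simp only [β, if_neg h3, h1, h2]
  split_ifs with h4
  · have h5 : j = D.p := by omega
    have h6 : D.q = c + 1 := by simp only [k] at hc; omega
    rw [h5, h6]; simp; ring
  · ring

theorem β_lt {i j : ℕ} (h : i < j) (hj : j ≤ D.k) : D.β j + (D.a + 1) ≤ D.β i := by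
  induction j, h using Nat.le_induction with
  | base =>
    rcases Nat.lt_or_ge i D.p with h1 | h1
    · rw [D.β_p h1]
    · have h2 := D.β_q h1 hj
      simp only [Nat.succ_eq_add_one] at *
      omega
  | succ j h ih =>
    have := ih (by omega)
    rcases Nat.lt_or_ge j D.p with h1 | h1
    · have := D.β_p h1; omega
    · have := D.β_q h1 hj; omega

theorem β_le {i j : ℕ} (h : i ≤ j) (hj : j ≤ D.k) : D.β j ≤ D.β i := by
  rcases h.eq_or_lt with rfl | h
  · rfl
  · have := D.β_lt h hj; omega

theorem β_lt_q {i j : ℕ} (hi : D.p ≤ i) (h : i < j) (hj : j ≤ D.k) :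
    D.β j + (D.a + 3) ≤ D.β i := by
  have := D.β_q hi (h.trans_le hj)
  have := D.β_le (i := i + 1) h hj
  omega

/-- The label of the `l`-th side of the `j`-th small cycle. -/
def lab (j l : ℕ) : ℕ := if l ≤ 2 then 2 * j + l else D.β j + l

theorem lab_lt {j l : ℕ} (hj : j ≤ D.k) (hl : l < D.n) : D.lab j l < D.m := by
  have h1 := D.m_eq
  have h2 := D.β_le (Nat.zero_le j) hj
  have h3 := D.β_le hj le_rfl
  rw [D.β_k] at h3
  unfold lab
  split_ifs <;> omega

/-- A chord is a pair of a step and a side (`false` for the first side, `true` for the second). -/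
abbrev Chord := ℕ × Bool

/-- The chords that occur. -/
def IsChord (c : Chord) : Prop := D.p < c.1 ∧ c.1 ≤ D.k

/-- The label of a chord. -/
def clab (c : Chord) : ℕ := if c.2 then D.β (c.1 - 1) + 3 else 2 * c.1

theorem clab_bounds {c : Chord} (hc : D.IsChord c) :
    4 ≤ D.clab c ∧ D.clab c ≤ D.β 0 + 2 ∧ D.clab c < D.m := by
  obtain ⟨h1, h2⟩ := hc
  have hp := D.hp
  have h3 := D.β_lt (i := 0) (j := c.1 - 1) (by omega) (by omega)
  have h4 := D.β_lt (i := 0) (j := D.k) (by omega) le_rfl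
  have h5 := D.β_le (i := c.1 - 1) (j := D.k) (by omega) le_rfl
  rw [D.β_k] at h4 h5
  have := D.m_eq
  have := D.n_eq
  unfold clab
  split_ifs <;> omega

/-- Distinct chord labels are at distance at least two. -/
theorem clab_sep {c d : Chord} (hc : D.IsChord c) (hd : D.IsChord d) (hcd : c ≠ d) :
    D.clab c + 2 ≤ D.clab d ∨ D.clab d + 2 ≤ D.clab c := by
  obtain ⟨i, x⟩ := c
  obtain ⟨j, y⟩ := d
  obtain ⟨h1, h2⟩ := hc
  obtain ⟨h3, h4⟩ := hd
  simp only at h1 h2 h3 h4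
  have hi := D.β_lt_q (i := i - 1) (j := D.k) (by omega) (by omega) le_rfl
  have hj := D.β_lt_q (i := j - 1) (j := D.k) (by omega) (by omega) le_rfl
  rw [D.β_k] at hi hj
  unfold clab
  rcases lt_trichotomy i j with h | h | h
  · have := D.β_lt_q (i := i - 1) (j := j - 1) (by omega) (by omega) (by omega)
    cases x <;> cases y <;> simp <;> omega
  · subst h
    cases x <;> cases y <;> simp at hcd ⊢ <;> omega
  · have := D.β_lt_q (i := j - 1) (j := i - 1) (by omega) (by omega) (by omega)
    cases x <;> cases y <;> simp <;> omega

/-- A pair of parametrizations of the two cycles. -/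
structure Frame where
  /-- The parametrization of the large cycle. -/
  ρ : Aff D.m
  /-- The parametrization of the small cycle. -/
  δ : Aff D.n

variable {D}

namespace Frame

variable (F : Frame D)

/-- The parametrization of the sides of the `j`-th small cycle by types. -/
def tyA (j : ℕ) : Aff D.n := if Even j then F.δ else F.δ.refl 2

/-- The type of a side of the `j`-th small cycle. -/
def ty (j : ℕ) (l : ℤ) : ZMod D.n := F.tyA j l

/-- The coordinate of a type in the `j`-th small cycle. -/
def loc (j : ℕ) (t : ZMod D.n) : ℕ := (F.tyA j).inv t

theorem loc_lt (j : ℕ) (t : ZMod D.n) : F.loc j t < D.n := Aff.inv_lt _ _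

theorem ty_loc (j : ℕ) (t : ZMod D.n) : F.ty j (F.loc j t) = t := Aff.apply_inv _ _

theorem loc_ty (j : ℕ) {l : ℕ} (hl : l < D.n) : F.loc j (F.ty j l) = l := Aff.inv_apply _ hl

theorem ty_succ (j : ℕ) (l : ℤ) : F.ty (j + 1) l = F.ty j (2 - l) := by
  unfold ty tyA
  by_cases h : Even j
  · simp only [h, if_true, Nat.even_add_one, not_true, if_false, Aff.refl_apply]
  · simp only [h, if_false, Nat.even_add_one, not_false_iff, if_true, Aff.refl_apply]
    congr 1; ring

/-- The frame beyond a chord. -/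
def nxt (c : Chord) : Frame D :=
  if c.2 then ⟨F.ρ.refl (D.clab c + 2), (F.tyA (c.1 - 1)).refl 5⟩
  else ⟨F.ρ.shift (D.clab c - 2), F.tyA (c.1 - 1)⟩

theorem nxt_ty_zero (c : Chord) (l : ℤ) :
    (F.nxt c).ty 0 l = F.ty (c.1 - 1) (if c.2 then 5 - l else l) := by
  obtain ⟨i, x⟩ := c
  cases x
  · simp [nxt, ty, tyA]
  · simp only [nxt, ty, if_true]
    rw [← Aff.refl_apply]
    simp [tyA]

theorem nxt_ρ (c : Chord) (l : ℤ) :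
    (F.nxt c).ρ l = F.ρ (if c.2 then D.clab c + 2 - l else D.clab c + l - 2) := by
  obtain ⟨i, x⟩ := c
  cases x
  · simp only [nxt, Aff.shift_apply, Bool.false_eq_true, if_false]
    congr 1; ring
  · simp only [nxt, Aff.refl_apply, if_true]

theorem nxt_ρ_two (c : Chord) : (F.nxt c).ρ 2 = F.ρ (D.clab c) := by
  rw [nxt_ρ]; split_ifs <;> congr 1 <;> ring

open Classical in
/-- The chord of a frame at a given vertex of the large cycle. -/
noncomputable def chord (v : ZMod D.m) : Option Chord :=
  if h : ∃ c, D.IsChord c ∧ F.ρ (D.clab c) = v then some h.choose else none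

theorem chord_eq_some {v : ZMod D.m} {c : Chord} :
    F.chord v = some c ↔ D.IsChord c ∧ F.ρ (D.clab c) = v := by
  unfold chord
  split_ifs with h
  · have hs := h.choose_spec
    rw [Option.some_inj]
    constructor
    · intro h1; rwa [h1] at hs
    · rintro ⟨h1, h2⟩
      by_contra h3
      have h4 := D.clab_sep hs.1 h1 h3
      have h5 := (F.ρ.apply_inj (D.clab_bounds hs.1).2.2 (D.clab_bounds h1).2.2).1 (hs.2.trans h2.symm)
      omega
  · simp only [false_iff]
    exact fun h1 => h ⟨c, h1⟩

/-- The labels of the active vertices. -/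
def IsActLabel (D : Data) (l : ℕ) : Prop :=
  l = 2 ∨ l = D.β 0 + 4 ∨ ∃ c, D.IsChord c ∧ l = D.clab c

/-- The active vertices of a frame. -/
def Act (v : ZMod D.m) : Prop := ∃ l, IsActLabel D l ∧ F.ρ l = v

theorem IsActLabel.lt {l : ℕ} (h : IsActLabel D l) : 2 ≤ l ∧ l + 3 ≤ D.m := by
  have := D.m_eq
  have := D.n_eq
  rcases h with h | h | ⟨c, hc, h⟩
  · omega
  · omega
  · have := D.clab_bounds hc; omega

theorem not_act_of_adj {v w : ZMod D.m} (h : (cycleGraph D.m).Adj v w) (hv : F.Act v) :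
    ¬ F.Act w := by
  rintro ⟨b, hb, rfl⟩
  obtain ⟨a, ha, rfl⟩ := hv
  have h1 := ha.lt
  have h2 := hb.lt
  have h3 := Aff.adj_apply F.ρ (by omega) (by omega) (by omega) h
  have h4 : a = b + 1 ∨ b = a + 1 := by omega
  rcases ha with ha | ha | ⟨c, hc, ha⟩ <;> rcases hb with hb | hb | ⟨d, hd, hb⟩
  · omega
  · omega
  · have := D.clab_bounds hd; omega
  · omega
  · omega
  · have := D.clab_bounds hd; omega
  · have := D.clab_bounds hc; omega
  · have := D.clab_bounds hc; omega
  · by_cases hcd : c = d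
    · subst hcd; omega
    · have := D.clab_sep hc hd hcd; omega

theorem act_of_chord {v : ZMod D.m} {c : Chord} (h : F.chord v = some c) : F.Act v := by
  rw [chord_eq_some] at h
  exact ⟨_, Or.inr (Or.inr ⟨c, h.1, rfl⟩), h.2⟩

theorem act_two : F.Act (F.ρ 2) := ⟨2, Or.inl rfl, rfl⟩

theorem chord_two : F.chord (F.ρ 2) = none := by
  rw [Option.eq_none_iff_forall_ne_some]
  intro c hc
  rw [chord_eq_some] at hc
  have h1 := D.clab_bounds hc.1
  have := (F.ρ.apply_inj (a := D.clab c) (b := 2) h1.2.2 (by omega)).1 (by exact_mod_cast hc.2)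
  omega

end Frame

end Data

end GraphProdQIE

namespace GraphProdQIE

namespace Data

variable {D : Data}

/-- The group over the large cycle. -/
abbrev S (D : Data) : Type := GP (cycleGraph D.m) (fun _ => D.M)

/-- The group over the small cycle. -/
abbrev G (D : Data) : Type := GP (cycleGraph D.n) (fun _ => D.N)

/-- Stacks of syllables. -/
abbrev Stk (D : Data) : Type := List (ZMod D.m × ZMod D.M)

/-- The frame reached after a stack of syllables. -/
noncomputable def frame : Stk D → Frame D
  | [] => ⟨⟨1, 0⟩, ⟨1, 0⟩⟩
  | x :: l => match (frame l).chord x.1 with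
    | some c => (frame l).nxt c
    | none => frame l

/-- A stack without its top syllable, if that syllable is at `v`. -/
def base (v : ZMod D.m) : Stk D → Stk D
  | [] => []
  | x :: l => if x.1 = v then l else x :: l

/-- The exponent of the top syllable, if that syllable is at `v`. -/
def expo (v : ZMod D.m) : Stk D → ZMod D.M
  | [] => 0
  | x :: _ => if x.1 = v then x.2 else 0

open Classical in
/-- Push a syllable, omitting it if it is trivial. -/
noncomputable def push (v : ZMod D.m) (e : ZMod D.M) (l : Stk D) : Stk D :=
  if e = 0 then l else (v, e) :: l

/-- Reduced stacks of active syllables. -/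
def Good : Stk D → Prop
  | [] => True
  | x :: l => Good l ∧ x.2 ≠ 0 ∧ (frame l).Act x.1 ∧ base x.1 l = l

open Classical in
/-- The effect of a generator on a stack. -/
noncomputable def step (v : ZMod D.m) (z : ZMod D.M) (L : Stk D) : Stk D :=
  if (frame L).Act v then push v (expo v L + z) (base v L) else L

theorem frame_cons_some {v : ZMod D.m} {e : ZMod D.M} {l : Stk D} {c : Chord}
    (h : (frame l).chord v = some c) : frame ((v, e) :: l) = (frame l).nxt c := by
  simp [frame, h]

theorem frame_cons_none {v : ZMod D.m} {e : ZMod D.M} {l : Stk D}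
    (h : (frame l).chord v = none) : frame ((v, e) :: l) = frame l := by
  simp [frame, h]

theorem act_cons {v : ZMod D.m} {e : ZMod D.M} {l : Stk D} (h : (frame l).Act v) :
    (frame ((v, e) :: l)).Act v := by
  rcases hc : (frame l).chord v with _ | c
  · rwa [frame_cons_none hc]
  · rw [frame_cons_some hc]
    have h1 := ((frame l).chord_eq_some.1 hc).2
    rw [← h1, ← Frame.nxt_ρ_two]
    exact Frame.act_two _

theorem act_push {v : ZMod D.m} {e : ZMod D.M} {l : Stk D} (h : (frame l).Act v) :
    (frame (push v e l)).Act v := by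
  unfold push
  split_ifs
  exacts [h, act_cons h]

theorem push_expo_base {L : Stk D} (hL : Good L) (v : ZMod D.m) :
    push v (expo v L) (base v L) = L := by
  cases L with
  | nil => simp [push, expo, base]
  | cons x l =>
    obtain ⟨w, e⟩ := x
    by_cases h : w = v
    · subst h; simp [push, expo, base, hL.2.1]
    · simp [push, expo, base, h]

theorem good_base {L : Stk D} (hL : Good L) (v : ZMod D.m) : Good (base v L) := by
  cases L with
  | nil => exact hL
  | cons x l =>
    simp only [base]
    split_ifs
    exacts [hL.1, hL]

theorem base_base {L : Stk D} (hL : Good L) (v : ZMod D.m) : base v (base v L) = base v L := by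
  cases L with
  | nil => rfl
  | cons x l =>
    by_cases h : x.1 = v
    · subst h; simpa [base] using hL.2.2.2
    · simp [base, h]

theorem act_base {L : Stk D} (hL : Good L) (v : ZMod D.m) :
    (frame (base v L)).Act v ↔ (frame L).Act v := by
  cases L with
  | nil => rfl
  | cons x l =>
    by_cases h : x.1 = v
    · subst h
      simp only [base, if_true]
      exact iff_of_true hL.2.2.1 (act_cons hL.2.2.1)
    · simp [base, h]

theorem base_push {v : ZMod D.m} {e : ZMod D.M} {l : Stk D} (h : base v l = l) :
    base v (push v e l) = l := by
  unfold push
  split_ifs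
  · exact h
  · simp [base]

theorem expo_push {v : ZMod D.m} {e : ZMod D.M} {l : Stk D} (h : base v l = l) :
    expo v (push v e l) = e := by
  unfold push
  split_ifs with h0
  · cases l with
    | nil => simp [expo, h0]
    | cons x l =>
      have : x.1 ≠ v := by
        intro h1
        simp only [base, h1, if_true] at h
        exact absurd (congrArg List.length h) (by simp)
      simp [expo, this, h0]
  · simp [expo]

theorem good_push {v : ZMod D.m} {e : ZMod D.M} {l : Stk D} (hl : Good l)
    (h : base v l = l) (ha : (frame l).Act v) : Good (push v e l) := by
  unfold push
  split_ifs with h0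
  exacts [hl, ⟨hl, h0, ha, h⟩]

theorem good_step {L : Stk D} (hL : Good L) (v : ZMod D.m) (z : ZMod D.M) : Good (step v z L) := by
  unfold step
  split_ifs with h
  · exact good_push (good_base hL v) (base_base hL v) ((act_base hL v).2 h)
  · exact hL

theorem act_step {L : Stk D} (hL : Good L) (v : ZMod D.m) (z : ZMod D.M) :
    (frame (step v z L)).Act v ↔ (frame L).Act v := by
  unfold step
  split_ifs with h
  · exact iff_of_true (act_push ((act_base hL v).2 h)) h
  · rfl

theorem base_step {L : Stk D} (hL : Good L) (v : ZMod D.m) (z : ZMod D.M) :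
    base v (step v z L) = base v L := by
  unfold step
  split_ifs with h
  · exact base_push (base_base hL v)
  · rfl

theorem expo_step {L : Stk D} (hL : Good L) {v : ZMod D.m} (z : ZMod D.M)
    (h : (frame L).Act v) : expo v (step v z L) = expo v L + z := by
  rw [step, if_pos h, expo_push (base_base hL v)]

theorem step_of_not_act {L : Stk D} {v : ZMod D.m} (z : ZMod D.M)
    (h : ¬ (frame L).Act v) : step v z L = L := if_neg h

/-- The action on reduced stacks. -/
noncomputable def stkAct (D : Data) :
    RightAct (cycleGraph D.m) (fun _ => D.M) {L : Stk D // Good L} where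
  a v z L := ⟨step v z L.1, good_step L.2 v z⟩
  a_zero v L := by
    ext1
    simp only [step, add_zero, push_expo_base L.2, ite_self]
  a_add v y z L := by
    ext1
    by_cases h : (frame L.1).Act v
    · simp only
      rw [step, if_pos h, step.eq_def v z (step v y L.1), if_pos ((act_step L.2 v y).2 h), base_step L.2,
        expo_step L.2 _ h, add_assoc]
    · simp only [step_of_not_act _ h]
  a_comm v w hvw y z L := by
    ext1
    simp only
    by_cases hv : (frame L.1).Act v
    · rw [step_of_not_act z (Frame.not_act_of_adj _ hvw hv),
        step_of_not_act z (Frame.not_act_of_adj _ hvw ((act_step L.2 v y).2 hv))]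
    · rw [step_of_not_act y hv]
      by_cases hw : (frame L.1).Act w
      · rw [step_of_not_act y
          (Frame.not_act_of_adj _ hvw.symm ((act_step L.2 w z).2 hw))]
      · rw [step_of_not_act z hw, step_of_not_act y hv]

/-- The stack of a group element. -/
noncomputable def st (h : S D) : Stk D := ((stkAct D).run h ⟨[], trivial⟩).1

theorem good_st (h : S D) : Good (st h) := ((stkAct D).run h ⟨[], trivial⟩).2

theorem st_mul_pw (h : S D) (v : ZMod D.m) (z : ZMod D.M) : st (h * pw v z) = step v z (st h) := by
  rw [st, RightAct.run_mul_pw]; rfl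

/-- The frame at a group element. -/
noncomputable def fr (h : S D) : Frame D := frame (st h)

/-- The chord crossed by the `v`-coset of a group element, with the exponent of the element. -/
noncomputable def k1 (h : S D) (v : ZMod D.m) : Option (Chord × ZMod D.M) :=
  ((frame (base v (st h))).chord v).map (fun c => (c, expo v (st h)))

section

variable {h : S D} {v w : ZMod D.m} {c : Chord} {e : ZMod D.M}

theorem k1_eq_some :
    k1 h v = some (c, e) ↔ (frame (base v (st h))).chord v = some c ∧ expo v (st h) = e := by
  rw [k1]
  rcases (frame (base v (st h))).chord v with _ | d <;>
    simp only [Option.map_none, Option.map_some, reduceCtorEq, false_and, Option.some_inj,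
      Prod.mk.injEq]

theorem act_of_k1 {x : Chord × ZMod D.M} (hk : k1 h v = some x) : (fr h).Act v := by
  obtain ⟨c, e⟩ := x
  exact (act_base (good_st h) v).1 (Frame.act_of_chord _ (k1_eq_some.1 hk).1)

theorem k1_mul (hk : k1 h v = some (c, e)) (z : ZMod D.M) :
    k1 (h * pw v z) v = some (c, e + z) := by
  have ha := act_of_k1 hk
  rw [k1_eq_some] at hk ⊢
  rw [st_mul_pw, base_step (good_st h), expo_step (good_st h) z ha, hk.2]
  exact ⟨hk.1, rfl⟩

theorem k1_mul_of_none (hk : k1 h v = none) (z : ZMod D.M) : k1 (h * pw v z) v = none := by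
  simp only [k1, Option.map_eq_none_iff] at hk ⊢
  rw [st_mul_pw, base_step (good_st h), hk]

theorem frame_push_of_none {l : Stk D} (hc : (frame l).chord v = none) :
    frame (push v e l) = frame l := by
  unfold push
  split_ifs
  exacts [rfl, frame_cons_none hc]

theorem fr_mul_of_none (hk : k1 h v = none) (z : ZMod D.M) : fr (h * pw v z) = fr h := by
  have h1 := k1_mul_of_none hk z
  simp only [k1, Option.map_eq_none_iff] at hk h1
  have h2 : fr h = frame (base v (st h)) := by
    rw [fr]
    conv_lhs => rw [← push_expo_base (good_st h) v]
    exact frame_push_of_none hk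
  have h3 : fr (h * pw v z) = frame (base v (st (h * pw v z))) := by
    rw [fr]
    conv_lhs => rw [← push_expo_base (good_st _) v]
    exact frame_push_of_none h1
  rw [h2, h3, st_mul_pw, base_step (good_st h)]

theorem base_eq_of_expo {L : Stk D} (hL : Good L) (h0 : expo v L = 0) : base v L = L := by
  have := push_expo_base hL v
  rwa [h0, push, if_pos rfl] at this

theorem chord_of_k1 (hk : k1 h v = some (c, 0)) : (fr h).chord v = some c := by
  rw [k1_eq_some] at hk
  rw [fr, ← hk.1, base_eq_of_expo (good_st h) hk.2]

theorem k1_of_chord (hc : (fr h).chord v = some c) : k1 h v = some (c, 0) := by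
  rw [k1_eq_some]
  have hL := good_st h
  unfold fr at hc
  generalize st h = L at *
  cases L with
  | nil => exact ⟨hc, rfl⟩
  | cons x l =>
    by_cases hx : x.1 = v
    · exfalso
      subst hx
      rcases hl : (frame l).chord x.1 with _ | d
      · have : frame (x :: l) = frame l := frame_cons_none hl
        rw [this, hl] at hc
        cases hc
      · have : frame (x :: l) = (frame l).nxt d := frame_cons_some hl
        rw [this, ← ((frame l).chord_eq_some.1 hl).2, ← Frame.nxt_ρ_two, Frame.chord_two] at hc
        cases hc
    · simp [base, expo, hx, hc]

theorem fr_of_k1 (hk : k1 h v = some (c, e)) (he : e ≠ 0) :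
    fr h = (fr (h * pw v (-e))).nxt c := by
  have h1 := k1_mul hk (-e)
  rw [add_neg_cancel] at h1
  have ha := act_of_k1 hk
  rw [k1_eq_some] at hk h1
  have h2 := base_eq_of_expo (good_st _) h1.2
  rw [st_mul_pw, base_step (good_st h)] at h2
  rw [fr, fr, st_mul_pw, ← h2]
  conv_lhs => rw [← push_expo_base (good_st h) v, hk.2, push, if_neg he]
  exact frame_cons_some hk.1

theorem fr_mul_of_chord (hc : (fr h).chord v = some c) (he : e ≠ 0) :
    fr (h * pw v e) = (fr h).nxt c := by
  have h1 := k1_mul (k1_of_chord hc) e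
  rw [zero_add] at h1
  rw [fr_of_k1 h1 he, mul_assoc, ← pw_add]
  simp

theorem eq_of_k1 (hk : k1 h v = some (c, e)) (he : e ≠ 0) : v = (fr h).ρ 2 := by
  have h1 := k1_mul hk (-e)
  rw [add_neg_cancel] at h1
  have h2 := chord_of_k1 h1
  rw [fr_of_k1 hk he, Frame.nxt_ρ_two, ((fr _).chord_eq_some.1 h2).2]

theorem k1_ne_zero (hk : k1 h ((fr h).ρ 2) = some (c, e)) : e ≠ 0 := by
  rintro rfl
  have := chord_of_k1 hk
  rw [Frame.chord_two] at this
  cases this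

theorem st_mul_of_adj (hvw : (cycleGraph D.m).Adj v w) (ha : (fr h).Act v) (z : ZMod D.M) :
    st (h * pw w z) = st h := by
  rw [st_mul_pw, step_of_not_act]
  exact Frame.not_act_of_adj _ hvw ha

theorem act_mul (ha : (fr h).Act v) (z : ZMod D.M) : (fr (h * pw v z)).Act v := by
  rw [fr, st_mul_pw]
  exact (act_step (good_st h) v z).2 ha

theorem fr_congr {h' : S D} (hs : st h' = st h) : fr h' = fr h := by rw [fr, fr, hs]

theorem k1_congr {h' : S D} (hs : st h' = st h) (v : ZMod D.m) : k1 h' v = k1 h v := by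
  rw [k1, k1, hs]

theorem k1_eq_none_of_not_act (ha : ¬ (fr h).Act v) : k1 h v = none := by
  rcases hk : k1 h v with _ | x
  · rfl
  · exact absurd (act_of_k1 hk) ha

end

end Data

end GraphProdQIE

namespace GraphProdQIE

namespace Data

variable {D : Data}

theorem ψ_zero : D.ψ 0 = 0 := by
  have := D.ψφ 0
  rwa [D.φ0] at this

theorem φ_ne_zero {e : ZMod D.M} (he : e ≠ 0) : D.φ e ≠ 0 := by
  intro h
  have := D.ψφ e
  rw [h, ψ_zero] at this
  exact he this.symm

instance : Nontrivial (ZMod D.N) := ZMod.nontrivial_iff.2 D.hN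

/-- The chord on the other side of the same step. -/
abbrev swap (c : Chord) : Chord := (c.1, !c.2)

@[simp] theorem swap_swap (c : Chord) : swap (swap c) = c := by simp [swap]

theorem q_ne_zero {c : Chord} (hc : D.IsChord c) : D.q ≠ 0 := by
  obtain ⟨h1, h2⟩ := hc
  simp only [k] at h2
  omega

/-- The chambers of the complex on which the small group acts. -/
inductive Cell (D : Data) : Type
  | gon (h : S D) (j : ℕ)
  | pd (h : S D) (i : ℕ) (s : ZMod D.N)
  | dum (b : S D) (i : ℕ) (u v : ZMod D.N)

open Cell

/-- The residues that label the two principal chambers of a panel. -/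
abbrev IsBit (s : ZMod D.N) : Prop := s = 0 ∨ s = 1

/-- The index of a principal chamber. -/
def bit (s : ZMod D.N) : ℕ := if s = 0 then 0 else 1

@[simp] theorem bit_zero : bit (0 : ZMod D.N) = 0 := by simp [bit]

@[simp] theorem bit_one : bit (1 : ZMod D.N) = 1 := by simp [bit]

/-- The vertex of a chord. -/
noncomputable def cl (b : S D) (c : Chord) : ZMod D.m := (fr b).ρ (D.clab c)

open Classical in
/-- The chamber with coordinates `u`, `v` in the block of a chord. -/
noncomputable def cork (b : S D) (c : Chord) (u v : ZMod D.N) : Cell D :=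
  if IsBit u then
    if IsBit v then
      if u = v then gon b (c.1 - 1 + bit u)
      else if c.2 then dum b c.1 v u else dum b c.1 u v
    else gon (b * pw (cl b (swap c)) (D.ψ v)) (bit u)
  else
    if IsBit v then gon (b * pw (cl b c) (D.ψ u)) (bit v)
    else if c.2 then dum b c.1 v u else dum b c.1 u v

theorem cork_swap (b : S D) (c : Chord) (u v : ZMod D.N) :
    cork b (swap c) u v = cork b c v u := by
  obtain ⟨i, x⟩ := c
  unfold cork
  by_cases h : u = v
  · subst h
    by_cases hu : IsBit u <;> cases x <;> simp [hu]
  · by_cases hu : IsBit u <;> by_cases hv : IsBit v <;> cases x <;> simp [hu, hv, h, Ne.symm h]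

open Classical in
/-- The chamber with coordinate `s` in the `i`-th panel. -/
noncomputable def PD (h : S D) (i : ℕ) (s : ZMod D.N) : Cell D :=
  if s = 0 then gon h (i - 1)
  else if s = 1 then gon h i
  else if i = 1 then
    match k1 h ((fr h).ρ 2) with
    | some (c, e) => cork (h * pw ((fr h).ρ 2) (-e)) c (D.φ e) s
    | none => pd h i s
  else pd h i s

/-- The kinds of orbits of the vertex groups. -/
inductive Ln (D : Data) : Type
  | triv
  | rot (c : ZMod D.N → Cell D) (s : ZMod D.N)
  | flat (v : ZMod D.m) (c : S D → Cell D) (h : S D)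

/-- The orbit through a principal chamber in the direction of its `l`-th side. -/
noncomputable def gonLine (h : S D) (j l : ℕ) : Ln D :=
  if l = 3 ∧ j < D.p then .rot (PD h (j + 1)) 0
  else if l + 1 = D.n ∧ 1 ≤ j ∧ j ≤ D.p then .rot (PD h j) 1
  else if l = 2 ∧ D.p ≤ j ∧ j < D.k then .rot (fun u => cork h (j + 1, false) u 0) 0
  else if l = 3 ∧ D.p ≤ j ∧ j < D.k then .rot (fun u => cork h (j + 1, true) u 0) 0
  else if l = 0 ∧ D.p < j then .rot (fun u => cork h (j, false) u 1) 1
  else if l + 1 = D.n ∧ D.p < j then .rot (fun u => cork h (j, true) u 1) 1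
  else
    let v := (fr h).ρ (D.lab j l)
    match k1 h v with
    | some (c, e) => .rot (fun u => cork (h * pw v (-e)) c u j) (D.φ e)
    | none => .flat v (fun h => gon h j) h

open Classical in
/-- The orbit through an exceptional chamber of a block in the direction outside of the block. -/
noncomputable def dumFlat (b : S D) (c : Chord) (u v : ZMod D.N) : Ln D :=
  if IsBit v then .flat (((fr b).nxt c).ρ (2 * bit v + 1)) (fun b => cork b c u v) b
  else
    let h := b * pw (cl b (swap c)) (D.ψ v)
    .flat ((fr h).ρ (D.β 0 + 4)) (fun h => PD h 1 u) h

open Classical in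
/-- The orbit through a chamber in the direction of a type. -/
noncomputable def line (x : Cell D) (t : ZMod D.n) : Ln D :=
  match x with
  | gon h j => if j ≤ D.k then gonLine h j ((fr h).loc j t) else .triv
  | pd h i s =>
    if PD h i s = pd h i s ∧ 1 ≤ i ∧ i ≤ D.p then
      if (fr h).loc (i - 1) t = 3 then .rot (PD h i) s
      else if (fr h).loc (i - 1) t = 2 then .flat ((fr h).ρ (2 * i)) (fun h => PD h i s) h
      else if (fr h).loc (i - 1) t = 4 then
        .flat ((fr h).ρ (D.β (i - 1) + 4)) (fun h => PD h i s) h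
      else .triv
    else .triv
  | dum b i u v =>
    if cork b (i, false) u v = dum b i u v ∧ D.IsChord (i, false) then
      if (fr b).loc (i - 1) t = 1 then dumFlat b (i, false) u v
      else if (fr b).loc (i - 1) t = 2 then .rot (fun u => cork b (i, false) u v) u
      else if (fr b).loc (i - 1) t = 3 then .rot (fun v => cork b (i, true) v u) v
      else if (fr b).loc (i - 1) t = 4 then dumFlat b (i, true) v u
      else .triv
    else .triv

/-- A chamber together with a choice of exponents. -/
abbrev Pt (D : Data) : Type := Cell D × (ZMod D.n → ZMod D.N)

/-- The action of the vertex groups of the small group. -/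
noncomputable def act (t : ZMod D.n) (z : ZMod D.N) (x : Pt D) : Pt D :=
  match line x.1 t with
  | .triv => x
  | .rot c s => (c (s + z), x.2)
  | .flat v c h => (c (h * pw v (D.ψ (x.2 t + z) - D.ψ (x.2 t))), Function.update x.2 t (x.2 t + z))

/-- The vertex group at `t` fixes a chamber. -/
def Triv (t : ZMod D.n) (x : Cell D) : Prop := ∀ z τ, act t z (x, τ) = (x, τ)

/-- The vertex group at `t` permutes a family of chambers by translation. -/
def Rot (t : ZMod D.n) (c : ZMod D.N → Cell D) : Prop :=
  ∀ s z τ, act t z (c s, τ) = (c (s + z), τ)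

/-- The vertex group at `t` acts through right multiplication by powers of the generator `v`. -/
def Flat (t : ZMod D.n) (v : ZMod D.m) (c : S D → Cell D) (h : S D) : Prop :=
  ∀ d z τ, act t z (c (h * pw v d), τ) =
    (c (h * pw v d * pw v (D.ψ (τ t + z) - D.ψ (τ t))), Function.update τ t (τ t + z))

theorem Triv.of_line {t : ZMod D.n} {x : Cell D} (h : line x t = .triv) : Triv t x := by
  intro z τ; simp only [act, h]

theorem Rot.of_line {t : ZMod D.n} {c : ZMod D.N → Cell D} (h : ∀ s, line (c s) t = .rot c s) :
    Rot t c := by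
  intro s z τ; simp only [act, h]

theorem Flat.of_line {t : ZMod D.n} {v : ZMod D.m} {c : S D → Cell D} {h : S D}
    (hl : ∀ d, line (c (h * pw v d)) t = .flat v c (h * pw v d)) : Flat t v c h := by
  intro d z τ; simp only [act, hl]

/-- The two vertex groups at `t` and `t'` commute on a chamber. -/
def Comm (t t' : ZMod D.n) (x : Cell D) : Prop :=
  ∀ z z' τ, act t z (act t' z' (x, τ)) = act t' z' (act t z (x, τ))

section Comm

variable {t t' : ZMod D.n}

theorem Comm.symm {x : Cell D} (h : Comm t t' x) : Comm t' t x := fun z z' τ => (h z' z τ).symm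

theorem comm_rot_rot {c : ZMod D.N → ZMod D.N → Cell D} (h : ∀ b, Rot t (fun a => c a b))
    (h' : ∀ a, Rot t' (c a)) (a b : ZMod D.N) : Comm t t' (c a b) := by
  intro z z' τ
  rw [h' a b, h b a, h' (a + z) b]
  exact h (b + z') a z τ

theorem comm_rot_flat {c : ZMod D.N → S D → Cell D} {h : S D} {v : ZMod D.m}
    (hr : ∀ d, Rot t (fun a => c a (h * pw v d))) (hf : ∀ a, Flat t' v (c a) h) (a : ZMod D.N) :
    Comm t t' (c a h) := by
  intro z z' τ
  have hf0 := fun a => hf a 0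
  have hr0 := hr 0 a z τ
  simp only [pw_zero, mul_one] at hf0 hr0
  rw [hf0, hr _ a, hr0, hf0]

theorem comm_flat_flat (htt : t ≠ t') {c : S D → Cell D} {h : S D} {v w : ZMod D.m}
    (hvw : (cycleGraph D.m).Adj v w) (hv : ∀ d, Flat t v c (h * pw w d))
    (hw : ∀ d, Flat t' w c (h * pw v d)) : Comm t t' (c h) := by
  intro z z' τ
  have hv0 := fun d z τ => hv d 0 z τ
  have hw0 := fun d z τ => hw d 0 z τ
  simp only [pw_zero, mul_one] at hv0 hw0
  have hv1 := hv0 0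
  have hw1 := hw0 0
  simp only [pw_zero, mul_one] at hv1 hw1
  rw [hw1, hv0, hv1, hw0]
  simp only [Function.update_of_ne htt, Function.update_of_ne htt.symm]
  rw [Function.update_comm htt, mul_assoc, mul_assoc, (pw_comm hvw _ _).eq]

theorem comm_triv_flat {c : S D → Cell D} {h : S D} {v : ZMod D.m}
    (ht : ∀ d, Triv t (c (h * pw v d))) (hf : Flat t' v c h) : Comm t t' (c h) := by
  intro z z' τ
  have hf0 := fun z τ => hf 0 z τ
  have ht0 := fun z τ => ht 0 z τ
  simp only [pw_zero, mul_one] at hf0 ht0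
  rw [hf0, ht, ht0, hf0]

theorem comm_triv_triv {x : Cell D} (h : Triv t x) (h' : Triv t' x) : Comm t t' x := by
  intro z z' τ
  rw [h', h, h']

end Comm

end Data

end GraphProdQIE

namespace GraphProdQIE

namespace Data

variable {D : Data}

open Cell

theorem IsChord.swap {c : Chord} (hc : D.IsChord c) : D.IsChord (swap c) := hc

namespace Frame

theorem ty_add_n (F : Frame D) (j : ℕ) (l : ℤ) : F.ty j (l + D.n) = F.ty j l := Aff.apply_add _ _

theorem nxt_swap_ty (F : Frame D) (c : Chord) (l : ℤ) :
    (F.nxt (swap c)).ty 0 l = (F.nxt c).ty 0 (5 - l) := by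
  rw [nxt_ty_zero, nxt_ty_zero]
  obtain ⟨i, x⟩ := c
  cases x <;> simp

theorem ty_one (F : Frame D) (l : ℤ) : F.ty 1 l = F.ty 0 (2 - l) := F.ty_succ 0 l

theorem ty_pred (F : Frame D) {i : ℕ} (hi : 1 ≤ i) (l : ℤ) : F.ty (i - 1) l = F.ty i (2 - l) := by
  obtain ⟨i, rfl⟩ := Nat.exists_eq_add_of_le' hi
  rw [ty_succ, Nat.add_sub_cancel]
  congr 1; ring

end Frame

theorem not_isBit_φ {e : ZMod D.M} (hq : D.q ≠ 0) (he : e ≠ 0) : ¬ IsBit (D.φ e) := by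
  rintro (h | h)
  exacts [φ_ne_zero he h, D.φ_ne_one hq e h]

theorem ψ_ne_zero {s : ZMod D.N} (hq : D.q ≠ 0) (hs : ¬ IsBit s) : D.ψ s ≠ 0 := by
  intro h
  have := D.φψ hq s (fun h1 => hs (Or.inr h1))
  rw [h, D.φ0] at this
  exact hs (Or.inl this.symm)

theorem φψ_of_not_isBit {s : ZMod D.N} (hq : D.q ≠ 0) (hs : ¬ IsBit s) : D.φ (D.ψ s) = s :=
  D.φψ hq s (fun h1 => hs (Or.inr h1))

/-- The sides of the principal chambers that lie on the boundary of the large polygon. -/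
def IsLab (D : Data) (j l : ℕ) : Prop :=
  (l = 3 → D.k ≤ j) ∧ (l + 1 = D.n → j = 0) ∧ (l = 2 → j < D.p ∨ D.k ≤ j) ∧ (l = 0 → j ≤ D.p)

theorem lab_ne_clab {j l : ℕ} (hj : j ≤ D.k) (hl : l < D.n) (h : IsLab D j l) {c : Chord}
    (hc : D.IsChord c) : D.lab j l ≠ D.clab c := by
  obtain ⟨i, x⟩ := c
  obtain ⟨h1, h2⟩ := hc
  obtain ⟨a3, an, a2, a0⟩ := h
  simp only at h1 h2
  have hn := D.n_eq
  have hi := D.β_lt_q (i := i - 1) (j := D.k) (by omega) (by omega) le_rfl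
  have hjk := D.β_le hj le_rfl
  rw [D.β_k] at hi hjk
  unfold lab clab
  cases x
  · simp only [Bool.false_eq_true, if_false]
    split_ifs <;> omega
  · simp only [if_true]
    split_ifs
    · omega
    · rcases lt_trichotomy j (i - 1) with h | h | h
      · have := D.β_lt h (by omega)
        omega
      · subst h; omega
      · have := D.β_lt_q (by omega) h hj
        omega

theorem lab_eq_two {j l : ℕ} (h : D.lab j l = 2) (hI : IsLab D j l) :
    j = 0 ∧ l = 2 ∨ j = 1 ∧ l = 0 := by
  have := hI.2.1
  have := D.n_eq
  have := hI.2.2.1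
  have := D.hp
  unfold lab at h
  split_ifs at h <;> omega

theorem k1_eq_none {h : S D} {l : ℕ} (hl : l < D.m) (h2 : l ≠ 2)
    (hc : ∀ c, D.IsChord c → l ≠ D.clab c) : k1 h ((fr h).ρ l) = none := by
  rcases hk : k1 h ((fr h).ρ l) with _ | ⟨c, e⟩
  · rfl
  · exfalso
    by_cases he : e = 0
    · subst he
      have h1 := (Frame.chord_eq_some _).1 (chord_of_k1 hk)
      exact hc c h1.1 ((Aff.apply_inj _ hl (D.clab_bounds h1.1).2.2).1 h1.2.symm)
    · have h1 := eq_of_k1 hk he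
      have h3 : D.m = D.β 0 + D.n := D.m_eq
      have := D.n_eq
      exact h2 ((Aff.apply_inj _ (b := 2) hl (by omega)).1 (by exact_mod_cast h1))

theorem k1_lab {h : S D} {j l : ℕ} (hj : j ≤ D.k) (hl : l < D.n) (hI : IsLab D j l)
    {c : Chord} {e : ZMod D.M} (hk : k1 h ((fr h).ρ (D.lab j l)) = some (c, e)) :
    D.lab j l = 2 := by
  by_contra h2
  rw [k1_eq_none (D.lab_lt hj hl) h2 fun c hc => lab_ne_clab hj hl hI hc] at hk
  cases hk

theorem line_gon (h : S D) {j l : ℕ} (hj : j ≤ D.k) (hl : l < D.n) :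
    line (gon h j) ((fr h).ty j l) = gonLine h j l := by
  simp only [line, if_pos hj, Frame.loc_ty _ _ hl]

theorem gonLine_panel_zero (h : S D) {j : ℕ} (hj : j < D.p) :
    gonLine h j 3 = .rot (PD h (j + 1)) 0 := by simp [gonLine, hj]

theorem gonLine_panel_one (h : S D) {j l : ℕ} (hl : l + 1 = D.n) (h1 : 1 ≤ j) (hj : j ≤ D.p) :
    gonLine h j l = .rot (PD h j) 1 := by
  have := D.n_eq
  rw [gonLine, if_neg (by omega), if_pos ⟨hl, h1, hj⟩]

theorem gonLine_block_zero (h : S D) {c : Chord} (hc : D.IsChord c) {l : ℕ}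
    (hl : l = if c.2 then 3 else 2) :
    gonLine h (c.1 - 1) l = .rot (fun u => cork h c u 0) 0 := by
  obtain ⟨i, x⟩ := c
  obtain ⟨h1, h2⟩ := hc
  have := D.n_eq
  simp only at h1 h2 hl ⊢
  have h3 : i - 1 + 1 = i := by omega
  subst hl
  cases x
  · rw [gonLine, if_neg (by simp), if_neg (by simp), if_pos ⟨by simp, by omega, by omega⟩, h3]
  · rw [gonLine, if_neg (by omega), if_neg (by simp), if_neg (by simp),
      if_pos ⟨by simp, by omega, by omega⟩, h3]

theorem gonLine_block_one (h : S D) {c : Chord} (hc : D.IsChord c) {l : ℕ}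
    (hl : l = if c.2 then D.n - 1 else 0) :
    gonLine h c.1 l = .rot (fun u => cork h c u 1) 1 := by
  obtain ⟨i, x⟩ := c
  obtain ⟨h1, h2⟩ := hc
  have := D.n_eq
  simp only at h1 h2 hl ⊢
  subst hl
  cases x
  · rw [gonLine, if_neg (by simp), if_neg (by simp), if_neg (by simp), if_neg (by simp),
      if_pos ⟨by simp, by omega⟩]
  · rw [gonLine, if_neg (by simp), if_neg (by omega), if_neg (by simp), if_neg (by simp),
      if_neg (by simp), if_pos ⟨by simp, by omega⟩]

theorem gonLine_lab_none (h : S D) {j l : ℕ} (hj : j ≤ D.k) (hI : IsLab D j l)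
    (hk : k1 h ((fr h).ρ (D.lab j l)) = none) :
    gonLine h j l = .flat ((fr h).ρ (D.lab j l)) (fun h => gon h j) h := by
  obtain ⟨a3, an, a2, a0⟩ := hI
  have := D.hp
  have : D.k = D.p + D.q := rfl
  rw [gonLine, if_neg (by omega), if_neg (by omega), if_neg (by omega), if_neg (by omega),
    if_neg (by omega), if_neg (by omega)]
  simp only [hk]

theorem gonLine_lab_some (h : S D) {j l : ℕ} (hj : j ≤ D.k) (hI : IsLab D j l) {c : Chord}
    {e : ZMod D.M} (hk : k1 h ((fr h).ρ (D.lab j l)) = some (c, e)) :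
    gonLine h j l =
      .rot (fun u => cork (h * pw ((fr h).ρ (D.lab j l)) (-e)) c u j) (D.φ e) := by
  obtain ⟨a3, an, a2, a0⟩ := hI
  have := D.hp
  have : D.k = D.p + D.q := rfl
  rw [gonLine, if_neg (by omega), if_neg (by omega), if_neg (by omega), if_neg (by omega),
    if_neg (by omega), if_neg (by omega)]
  simp only [hk]

@[simp] theorem PD_zero (h : S D) (i : ℕ) : PD h i 0 = gon h (i - 1) := by simp [PD]

@[simp] theorem PD_one (h : S D) (i : ℕ) : PD h i 1 = gon h i := by simp [PD]

theorem PD_of_ne_one (h : S D) {i : ℕ} (hi : i ≠ 1) {s : ZMod D.N} (hs : ¬ IsBit s) :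
    PD h i s = pd h i s := by
  have h1 : s ≠ 0 := fun h => hs (Or.inl h)
  have h2 : s ≠ 1 := fun h => hs (Or.inr h)
  simp [PD, h1, h2, hi]

theorem PD_of_none {h : S D} (hk : k1 h ((fr h).ρ 2) = none) (i : ℕ) {s : ZMod D.N}
    (hs : ¬ IsBit s) : PD h i s = pd h i s := by
  have h1 : s ≠ 0 := fun h => hs (Or.inl h)
  have h2 : s ≠ 1 := fun h => hs (Or.inr h)
  simp [PD, h1, h2, hk]

theorem cork_bit_same (b : S D) (c : Chord) {u : ZMod D.N} (hu : IsBit u) :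
    cork b c u u = gon b (c.1 - 1 + bit u) := by simp [cork, hu]

theorem cork_snd_bit (b : S D) (c : Chord) {u v : ZMod D.N} (hu : ¬ IsBit u) (hv : IsBit v) :
    cork b c u v = gon (b * pw (cl b c) (D.ψ u)) (bit v) := by simp [cork, hu, hv]

theorem fr_cross {b : S D} {c : Chord} (hc : D.IsChord c) {e : ZMod D.M} (he : e ≠ 0) :
    fr (b * pw (cl b c) e) = (fr b).nxt c :=
  fr_mul_of_chord ((Frame.chord_eq_some _).2 ⟨hc, rfl⟩) he

theorem k1_cross (b : S D) {c : Chord} (hc : D.IsChord c) {e : ZMod D.M} (he : e ≠ 0) :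
    k1 (b * pw (cl b c) e) ((fr (b * pw (cl b c) e)).ρ 2) = some (c, e) := by
  rw [fr_cross hc he, Frame.nxt_ρ_two]
  have := k1_mul (k1_of_chord ((Frame.chord_eq_some (fr b)).2 ⟨hc, rfl⟩)) e
  rwa [zero_add] at this

theorem PD_cross (b : S D) {c : Chord} (hc : D.IsChord c) {e : ZMod D.M} (he : e ≠ 0) :
    PD (b * pw (cl b c) e) 1 = cork b c (D.φ e) := by
  funext s
  have hφ := not_isBit_φ (q_ne_zero hc) he
  by_cases h0 : s = 0
  · subst h0
    rw [PD_zero, cork_snd_bit _ _ hφ (Or.inl rfl), D.ψφ, bit_zero]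
  by_cases h1 : s = 1
  · subst h1
    rw [PD_one, cork_snd_bit _ _ hφ (Or.inr rfl), D.ψφ, bit_one]
  rw [PD, if_neg h0, if_neg h1, if_pos rfl]
  simp only [k1_cross b hc he]
  rw [fr_cross hc he, Frame.nxt_ρ_two]
  congr 1
  rw [mul_assoc]
  change b * (pw (cl b c) e * pw (cl b c) (-e)) = b
  rw [← pw_add]
  simp

/-- An element past a chord, written in terms of the block of the chord. -/
theorem exists_cross {h : S D} {c : Chord} {e : ZMod D.M}
    (hk : k1 h ((fr h).ρ 2) = some (c, e)) :
    e ≠ 0 ∧ D.IsChord c ∧ h = h * pw ((fr h).ρ 2) (-e) *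
      pw (cl (h * pw ((fr h).ρ 2) (-e)) c) e := by
  have h1 := k1_mul hk (-e)
  rw [add_neg_cancel] at h1
  have h2 := (Frame.chord_eq_some _).1 (chord_of_k1 h1)
  refine ⟨k1_ne_zero hk, h2.1, ?_⟩
  rw [cl, h2.2, mul_assoc, ← pw_add]
  simp

/-- The principal chambers of a block that are not cut by the large polygon. -/
def IsDum (u v : ZMod D.N) : Prop := (IsBit u ↔ IsBit v) ∧ (IsBit u → u ≠ v)

theorem IsDum.symm {u v : ZMod D.N} (h : IsDum u v) : IsDum v u :=
  ⟨h.1.symm, fun hv => (h.2 (h.1.2 hv)).symm⟩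

theorem cork_false_eq_dum_iff {b : S D} {i : ℕ} {u v : ZMod D.N} :
    cork b (i, false) u v = dum b i u v ↔ IsDum u v := by
  unfold cork IsDum
  by_cases hu : IsBit u <;> by_cases hv : IsBit v <;> by_cases h : u = v <;> simp [hu, hv, h]

theorem line_dum_aux (b : S D) {i : ℕ} (hc : D.IsChord (i, false)) {u v : ZMod D.N}
    (hd : IsDum u v) {l : ℕ} (hl : l < D.n) :
    line (cork b (i, false) u v) ((fr b).ty (i - 1) l) =
      if l = 1 then dumFlat b (i, false) u v
      else if l = 2 then .rot (fun u => cork b (i, false) u v) u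
      else if l = 3 then .rot (fun v => cork b (i, true) v u) v
      else if l = 4 then dumFlat b (i, true) v u
      else .triv := by
  have h1 := (cork_false_eq_dum_iff (b := b) (i := i)).2 hd
  rw [h1]
  simp only [line, h1, hc, and_self, if_true, Frame.loc_ty _ _ hl]

theorem line_dum (b : S D) {c : Chord} (hc : D.IsChord c) {u v : ZMod D.N} (hd : IsDum u v) :
    line (cork b c u v) (((fr b).nxt c).ty 0 1) = dumFlat b c u v ∧
    line (cork b c u v) (((fr b).nxt c).ty 0 2) = .rot (fun u => cork b c u v) u ∧
    (∀ l : ℕ, l < D.n → l = 0 ∨ 5 ≤ l → line (cork b c u v) (((fr b).nxt c).ty 0 l) = .triv) := by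
  have hn := D.n_eq
  obtain ⟨i, x⟩ := c
  cases x
  · simp only [Frame.nxt_ty_zero, Bool.false_eq_true, if_false]
    refine ⟨?_, ?_, fun l hl h => ?_⟩
    · exact line_dum_aux b hc hd (l := 1) (by omega)
    · exact line_dum_aux b hc hd (l := 2) (by omega)
    · rw [line_dum_aux b hc hd hl, if_neg (by omega), if_neg (by omega), if_neg (by omega),
        if_neg (by omega)]
  · have h1 : cork b (i, true) u v = cork b (i, false) v u := cork_swap b (i, false) u v
    simp only [Frame.nxt_ty_zero, if_true, h1]
    have hc' : D.IsChord (i, false) := hc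
    refine ⟨?_, ?_, fun l hl h => ?_⟩
    · exact line_dum_aux b hc' hd.symm (l := 4) (by omega)
    · exact line_dum_aux b hc' hd.symm (l := 3) (by omega)
    · rcases Nat.lt_or_ge l 6 with h6 | h6
      · have h2 := line_dum_aux b hc' hd.symm (l := 5 - l) (by omega)
        rw [if_neg (by omega), if_neg (by omega), if_neg (by omega), if_neg (by omega)] at h2
        rw [← h2]
        congr 2
        omega
      · have h2 := line_dum_aux b hc' hd.symm (l := D.n + 5 - l) (by omega)
        rw [if_neg (by omega), if_neg (by omega), if_neg (by omega), if_neg (by omega)] at h2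
        rw [← h2, ← Frame.ty_add_n]
        congr 2
        omega

end Data

end GraphProdQIE

namespace GraphProdQIE

namespace Data

variable {D : Data}

open Cell

namespace Frame

theorem ty_neg (F : Frame D) (j : ℕ) {l : ℤ} {l' : ℕ} (h : (l' : ℤ) = l + D.n) :
    F.ty j l = F.ty j l' := by
  rw [h, ty_add_n]

theorem nxt_ty_block_zero (F : Frame D) (c : Chord) :
    (F.nxt c).ty 0 2 = F.ty (c.1 - 1) ((if c.2 then 3 else 2 : ℕ) : ℤ) := by
  obtain ⟨i, x⟩ := c
  cases x <;> simp [nxt_ty_zero]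

theorem nxt_ty_block_one (F : Frame D) {c : Chord} (hc : D.IsChord c) :
    (F.nxt c).ty 0 2 = F.ty c.1 ((if c.2 then D.n - 1 else 0 : ℕ) : ℤ) := by
  have hn := D.n_eq
  have h1 : 1 ≤ c.1 := by have := hc.1; omega
  obtain ⟨i, x⟩ := c
  rw [nxt_ty_zero, ty_pred _ h1]
  cases x
  · simp
  · simp only [if_true]
    exact ty_neg _ _ (by omega)

end Frame

theorem p_le_k : D.p ≤ D.k := Nat.le_add_right _ _

theorem isLab_zero_two : IsLab D 0 2 := by
  have := D.hp
  have := D.n_eq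
  exact ⟨by omega, by omega, by omega, by omega⟩

theorem isLab_one_zero : IsLab D 1 0 := by
  have := D.hp
  have := D.n_eq
  exact ⟨by omega, by omega, by omega, by omega⟩

theorem isLab_one (j : ℕ) : IsLab D j 1 := by
  have := D.n_eq
  exact ⟨by omega, by omega, by omega, by omega⟩

theorem isLab_mid (j : ℕ) {l : ℕ} (h : 4 ≤ l) (h' : l + 2 ≤ D.n) : IsLab D j l :=
  ⟨by omega, by omega, by omega, by omega⟩

theorem one_le_k : 1 ≤ D.k := D.hp.trans p_le_k

theorem rot_PD (h : S D) {i : ℕ} (h1 : 1 ≤ i) (hi : i ≤ D.p) :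
    Rot ((fr h).ty (i - 1) 3) (PD h i) := by
  have hn := D.n_eq
  have hk := p_le_k (D := D)
  refine Rot.of_line fun s => ?_
  by_cases hs : IsBit s
  · rcases hs with rfl | rfl
    · have := line_gon h (j := i - 1) (l := 3) (by omega) (by omega)
      rw [gonLine_panel_zero h (by omega), Nat.sub_add_cancel h1] at this
      rw [PD_zero]
      exact this
    · have := line_gon h (j := i) (l := D.n - 1) (by omega) (by omega)
      rw [gonLine_panel_one h (by omega) h1 hi] at this
      rw [PD_one, Frame.ty_pred _ h1, Frame.ty_neg (l' := D.n - 1) _ _ (by omega)]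
      exact this
  · by_cases hk : i = 1 ∧ ∃ x, k1 h ((fr h).ρ 2) = some x
    · obtain ⟨rfl, ⟨c, e⟩, hk⟩ := hk
      obtain ⟨he, hc, hb⟩ := exists_cross hk
      generalize h * pw ((fr h).ρ 2) (-e) = b at hb
      subst hb
      have hq := q_ne_zero hc
      have h2 := (line_dum b hc.swap (u := s) (v := D.φ e)
        ⟨iff_of_false hs (not_isBit_φ hq he), fun h => absurd h hs⟩).2.1
      simp only [cork_swap] at h2
      rw [PD_cross b hc he, fr_cross hc he]
      rw [Frame.nxt_swap_ty] at h2
      exact h2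
    · have h2 : PD h i s = pd h i s := by
        by_cases hi1 : i = 1
        · refine PD_of_none ?_ i hs
          by_contra h3
          exact hk ⟨hi1, Option.ne_none_iff_exists'.1 h3⟩
        · exact PD_of_ne_one h hi1 hs
      have h3 : (fr h).loc (i - 1) ((fr h).ty (i - 1) 3) = 3 :=
        Frame.loc_ty _ _ (l := 3) (by omega)
      rw [h2]
      simp only [line, h2, h1, hi, and_self, if_true, h3]

/-- The block of a chord, seen from the other side of the opposite chord. -/
theorem cork_eq_PD (b : S D) {c : Chord} (hc : D.IsChord c) {v : ZMod D.N} (hv : ¬ IsBit v) :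
    (fun u => cork b c u v) = PD (b * pw (cl b (swap c)) (D.ψ v)) 1 := by
  have hq := q_ne_zero hc
  rw [PD_cross b hc.swap (ψ_ne_zero hq hv), φψ_of_not_isBit hq hv]
  funext u
  rw [cork_swap]

theorem fr_cross_swap_ty {b : S D} {c : Chord} (hc : D.IsChord c) {e : ZMod D.M} (he : e ≠ 0)
    (l : ℤ) : (fr (b * pw (cl b (swap c)) e)).ty 0 l = ((fr b).nxt c).ty 0 (5 - l) := by
  rw [fr_cross hc.swap he, Frame.nxt_swap_ty]

theorem rot_cork (b : S D) {c : Chord} (hc : D.IsChord c) (v : ZMod D.N) :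
    Rot (((fr b).nxt c).ty 0 2) (fun u => cork b c u v) := by
  have hn := D.n_eq
  have hq := q_ne_zero hc
  have hp := D.hp
  have hk := one_le_k (D := D)
  by_cases hv : IsBit v
  swap
  · have h1 := rot_PD (b * pw (cl b (swap c)) (D.ψ v)) le_rfl D.hp
    rw [← cork_eq_PD b hc hv] at h1
    have h2 := fr_cross_swap_ty (b := b) hc (ψ_ne_zero hq hv) 3
    rw [show (5 - 3 : ℤ) = 2 by norm_num] at h2
    rw [← h2]
    exact h1
  refine Rot.of_line fun u => ?_
  by_cases hu : IsBit u
  · by_cases huv : u = v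
    · subst huv
      simp only [cork_bit_same b c hu]
      obtain ⟨h1, h2⟩ := id hc
      rcases hu with rfl | rfl
      · rw [bit_zero, add_zero, Frame.nxt_ty_block_zero,
          line_gon b (l := if c.2 then 3 else 2) (by omega) (by split_ifs <;> omega),
          gonLine_block_zero b hc rfl]
      · rw [bit_one, Nat.sub_add_cancel (by omega), Frame.nxt_ty_block_one _ hc,
          line_gon b (l := if c.2 then D.n - 1 else 0) h2 (by split_ifs <;> omega), gonLine_block_one b hc rfl]
    · exact (line_dum b hc ⟨iff_of_true hu hv, fun _ => huv⟩).2.1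
  · simp only [cork_snd_bit b c hu hv]
    have he := ψ_ne_zero hq hu
    have hk1 := k1_cross b hc he
    set h := b * pw (cl b c) (D.ψ u) with hh
    have hfr : fr h = (fr b).nxt c := fr_cross hc he
    have hb : h * pw ((fr h).ρ 2) (-D.ψ u) = b := by
      rw [hfr, Frame.nxt_ρ_two, hh, mul_assoc]
      change b * (pw (cl b c) _ * pw (cl b c) _) = b
      rw [← pw_add]; simp
    rw [← hfr]
    rcases hv with rfl | rfl
    · have h1 := line_gon h (j := 0) (l := 2) (by omega) (by omega)
      have h3 : D.lab 0 2 = 2 := rfl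
      rw [gonLine_lab_some h (by omega) isLab_zero_two (by rw [h3]; exact hk1)] at h1
      rw [h3, show ((2 : ℕ) : ℤ) = 2 from rfl, hb, φψ_of_not_isBit hq hu] at h1
      simpa using h1
    · have h1 := line_gon h (j := 1) (l := 0) (by omega) (by omega)
      have h3 : D.lab 1 0 = 2 := rfl
      rw [gonLine_lab_some h (by omega) isLab_one_zero (by rw [h3]; exact hk1)] at h1
      rw [h3, show ((2 : ℕ) : ℤ) = 2 from rfl, hb, φψ_of_not_isBit hq hu, Frame.ty_one] at h1
      simpa using h1

end Data

end GraphProdQIE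

namespace GraphProdQIE

namespace Data

variable {D : Data}

open Cell

theorem Flat.transfer {t : ZMod D.n} {v : ZMod D.m} {c c' : S D → Cell D} {h h' : S D}
    (hf : Flat t v c' h') (hc : ∀ d, c (h * pw v d) = c' (h' * pw v d)) : Flat t v c h := by
  intro d z τ
  rw [hc, hf d z τ, mul_assoc, mul_assoc, ← pw_add, hc]

theorem Flat.of_fr {h : S D} (t : Frame D → ZMod D.n) (x : Frame D → ZMod D.m)
    {c : S D → Cell D} (hk : k1 h (x (fr h)) = none)
    (H : ∀ h, k1 h (x (fr h)) = none → line (c h) (t (fr h)) = .flat (x (fr h)) c h) :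
    Flat (t (fr h)) (x (fr h)) c h := by
  refine Flat.of_line fun d => ?_
  have hf := fr_mul_of_none hk d
  have hk' := k1_mul_of_none hk d
  have := H (h * pw (x (fr h)) d) (by rwa [hf])
  rwa [hf] at this

theorem flat_gon {h : S D} {j l : ℕ} (hj : j ≤ D.k) (hl : l < D.n) (hI : IsLab D j l)
    (hk : k1 h ((fr h).ρ (D.lab j l)) = none) :
    Flat ((fr h).ty j l) ((fr h).ρ (D.lab j l)) (fun h => gon h j) h := by
  refine Flat.of_fr (fun F => F.ty j l) (fun F => F.ρ (D.lab j l)) hk fun h hk => ?_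
  rw [line_gon _ hj hl, gonLine_lab_none _ hj hI hk]

theorem isLab_two {i : ℕ} (h1 : 1 ≤ i) (hi : i ≤ D.p) : IsLab D (i - 1) 2 := by
  have := D.n_eq
  exact ⟨by omega, by omega, by omega, by omega⟩

theorem isLab_zero {i : ℕ} (hi : i ≤ D.p) : IsLab D i 0 := by
  have := D.n_eq
  exact ⟨by omega, by omega, by omega, by omega⟩

theorem lab_pred_two {i : ℕ} (h1 : 1 ≤ i) : D.lab (i - 1) 2 = 2 * i := by
  simp only [lab, le_refl, if_true]; omega

theorem line_pd {h : S D} {i : ℕ} {s : ZMod D.N} (h1 : 1 ≤ i) (hi : i ≤ D.p)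
    (hs : PD h i s = pd h i s) {l : ℕ} (hl : l < D.n) :
    line (PD h i s) ((fr h).ty (i - 1) l) =
      if l = 3 then .rot (PD h i) s
      else if l = 2 then .flat ((fr h).ρ (2 * i)) (fun h => PD h i s) h
      else if l = 4 then .flat ((fr h).ρ (D.β (i - 1) + 4)) (fun h => PD h i s) h
      else .triv := by
  rw [hs]
  simp only [line, hs, h1, hi, and_self, if_true, Frame.loc_ty _ _ hl]

theorem k1_two {h : S D} {i : ℕ} (h1 : 1 ≤ i) (hi : i ≤ D.p) {c : Chord} {e : ZMod D.M}
    (hk : k1 h ((fr h).ρ (2 * i)) = some (c, e)) : i = 1 := by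
  have hkk := p_le_k (D := D)
  have hn := D.n_eq
  have := k1_lab (h := h) (j := i - 1) (l := 2) (by omega) (by omega) (isLab_two h1 hi)
    (c := c) (e := e) (by rw [lab_pred_two h1]; exact_mod_cast hk)
  rw [lab_pred_two h1] at this
  omega

theorem PD_eq_pd {h : S D} {i : ℕ} (hk : k1 h ((fr h).ρ (2 * i)) = none)
    {s : ZMod D.N} (hs : ¬ IsBit s) : PD h i s = pd h i s := by
  by_cases hi : i = 1
  · subst hi
    exact PD_of_none (by simpa using hk) 1 hs
  · exact PD_of_ne_one h hi hs

theorem PD_ne_pd {h : S D} {x : Chord × ZMod D.M} (hk : k1 h ((fr h).ρ 2) = some x)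
    (s : ZMod D.N) : PD h 1 s ≠ pd h 1 s := by
  obtain ⟨c, e⟩ := x
  obtain ⟨he, hc, hb⟩ := exists_cross hk
  generalize h * pw ((fr h).ρ 2) (-e) = b at hb
  subst hb
  rw [PD_cross b hc he]
  unfold cork
  split_ifs <;> simp

theorem k1_none_of_pd {h : S D} {i : ℕ} (h1 : 1 ≤ i) (hi : i ≤ D.p) {s : ZMod D.N}
    (hs : PD h i s = pd h i s) : k1 h ((fr h).ρ (2 * i)) = none := by
  rcases hk : k1 h ((fr h).ρ (2 * i)) with _ | ⟨c, e⟩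
  · rfl
  · obtain rfl := k1_two h1 hi hk
    exact absurd hs (PD_ne_pd (by simpa using hk) s)

theorem flat_PD_two {h : S D} {i : ℕ} (h1 : 1 ≤ i) (hi : i ≤ D.p)
    (hk : k1 h ((fr h).ρ (2 * i)) = none) (s : ZMod D.N) :
    Flat ((fr h).ty (i - 1) 2) ((fr h).ρ (2 * i)) (fun h => PD h i s) h := by
  have hkk := p_le_k (D := D)
  have hn := D.n_eq
  by_cases hs : IsBit s
  · have hk0 : k1 h ((fr h).ρ ((2 * i : ℕ) : ℤ)) = none := by exact_mod_cast hk
    rcases hs with rfl | rfl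
    · have := flat_gon (h := h) (j := i - 1) (l := 2) (by omega) (by omega) (isLab_two h1 hi)
        (by rw [lab_pred_two h1]; exact hk0)
      rw [lab_pred_two h1] at this
      simp only [PD_zero]
      exact_mod_cast this
    · have := flat_gon (h := h) (j := i) (l := 0) (by omega) (by omega) (isLab_zero hi) hk0
      simp only [PD_one]
      rw [Frame.ty_pred _ h1]
      simpa [lab] using this
  · refine Flat.of_fr (fun F => F.ty (i - 1) 2) (fun F => F.ρ (2 * i)) hk fun h hk => ?_
    have := line_pd h1 hi (PD_eq_pd hk hs) (l := 2) (by omega)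
    simpa using this

theorem lab_four (i : ℕ) : D.lab i 4 = D.β i + 4 := rfl

theorem k1_four (h : S D) {i : ℕ} (hi : i ≤ D.k) :
    k1 h ((fr h).ρ (D.β i + 4)) = none := by
  have hn := D.n_eq
  rcases hk : k1 h ((fr h).ρ (D.β i + 4)) with _ | ⟨c, e⟩
  · rfl
  · have := k1_lab (h := h) (j := i) (l := 4) hi (by omega) (isLab_mid _ (by omega) (by omega))
      (c := c) (e := e) (by rw [lab_four]; exact_mod_cast hk)
    rw [lab_four] at this
    omega

/-- The side of the `i`-th small cycle parallel to the last panel side, seen from both chambers. -/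
theorem lab_succ_n_sub_two {i : ℕ} (h1 : 1 ≤ i) (hi : i ≤ D.p) :
    D.lab i (D.n - 2) = D.β (i - 1) + 4 := by
  have := D.β_p (j := i - 1) (by omega)
  have hn := D.n_eq
  rw [Nat.sub_add_cancel h1] at this
  simp only [lab]
  rw [if_neg (by omega)]
  omega

theorem flat_PD_four (h : S D) {i : ℕ} (h1 : 1 ≤ i) (hi : i ≤ D.p) (s : ZMod D.N) :
    Flat ((fr h).ty (i - 1) 4) ((fr h).ρ (D.β (i - 1) + 4)) (fun h => PD h i s) h := by
  have hkk := p_le_k (D := D)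
  have hn := D.n_eq
  have hk := k1_four h (i := i - 1) (by omega)
  by_cases hs : IsBit s
  · have hk0 : k1 h ((fr h).ρ ((D.β (i - 1) + 4 : ℕ) : ℤ)) = none := by exact_mod_cast hk
    rcases hs with rfl | rfl
    · have := flat_gon (h := h) (j := i - 1) (l := 4) (by omega) (by omega)
        (isLab_mid _ (by omega) (by omega)) (by rw [lab_four]; exact hk0)
      rw [lab_four] at this
      simp only [PD_zero]
      exact_mod_cast this
    · have := flat_gon (h := h) (j := i) (l := D.n - 2) (by omega) (by omega)
        (isLab_mid _ (by omega) (by omega))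
        (by rw [lab_succ_n_sub_two h1 hi]; exact_mod_cast hk0)
      rw [lab_succ_n_sub_two h1 hi] at this
      simp only [PD_one]
      rw [Frame.ty_pred _ h1, Frame.ty_neg (l' := D.n - 2) _ _ (by omega)]
      exact_mod_cast this
  · refine Flat.of_fr (fun F => F.ty (i - 1) 4) (fun F => F.ρ (D.β (i - 1) + 4)) hk
      fun h' hk' => ?_
    by_cases hx : PD h' i s = pd h' i s
    · exact line_pd h1 hi hx (l := 4) (by omega)
    · have hx2 : ∃ c e, k1 h' ((fr h').ρ (2 * i)) = some (c, e) := by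
        rcases hk2 : k1 h' ((fr h').ρ (2 * i)) with _ | ⟨c, e⟩
        · exact absurd (PD_eq_pd hk2 hs) hx
        · exact ⟨c, e, rfl⟩
      obtain ⟨c, e, hk2⟩ := hx2
      obtain rfl := k1_two h1 hi hk2
      simp only [Nat.cast_one, mul_one] at hk2
      obtain ⟨he, hc, hb⟩ := exists_cross hk2
      generalize h' * pw ((fr h').ρ 2) (-e) = b at hb
      subst hb
      have hq := q_ne_zero hc
      have hφ := not_isBit_φ hq he
      have h2 := (line_dum b hc.swap (u := s) (v := D.φ e)
        ⟨iff_of_false hs hφ, fun h => absurd h hs⟩).1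
      simp only [dumFlat, if_neg hφ, swap_swap, D.ψφ] at h2
      rw [cork_swap, Frame.nxt_swap_ty, ← PD_cross b hc he, ← fr_cross hc he] at h2
      exact h2

/-- Moving along a neighbour of an active vertex. -/
theorem k1_persist {h : S D} {v w : ZMod D.m} (hvw : (cycleGraph D.m).Adj v w)
    (hv : k1 h v = none) (hw : k1 h w = none) (d : ZMod D.M) : k1 (h * pw w d) v = none := by
  by_cases ha : (fr h).Act v
  · rw [k1_congr (st_mul_of_adj hvw ha d), hv]
  · apply k1_eq_none_of_not_act
    rwa [fr_mul_of_none hw]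

/-- The neighbours of the vertex of a chord, as labels beyond the chord. -/
theorem adj_cl (b : S D) {c : Chord} {v : ZMod D.N} (hv : IsBit v) :
    (cycleGraph D.m).Adj (cl b c) (((fr b).nxt c).ρ (2 * bit v + 1)) := by
  have hm : 2 ≤ D.m := by have := D.m_eq; have := D.n_eq; omega
  rw [cl, ← Frame.nxt_ρ_two]
  rcases hv with rfl | rfl
  · have := Aff.adj_succ ((fr b).nxt c).ρ hm 1
    simpa using this.symm
  · have := Aff.adj_succ ((fr b).nxt c).ρ hm 2
    simpa using this

theorem act_cl (b : S D) {c : Chord} (hc : D.IsChord c) : (fr b).Act (cl b c) :=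
  Frame.act_of_chord _ ((Frame.chord_eq_some _).2 ⟨hc, rfl⟩)

/-- The label of the side next to a chord. -/
theorem lab_chord_zero {c : Chord} (hc : D.IsChord c) :
    (D.lab (c.1 - 1) (if c.2 then 4 else 1) : ℤ) =
      if c.2 then (D.clab c : ℤ) + 2 - 1 else (D.clab c : ℤ) + 1 - 2 := by
  obtain ⟨i, x⟩ := c
  have h1 := hc.1
  cases x
  · simp [lab, clab]; omega
  · simp [lab, clab]; omega

theorem lab_chord_one {c : Chord} (hc : D.IsChord c) :
    (D.lab c.1 (if c.2 then D.n - 2 else 1) : ℤ) =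
      if c.2 then (D.clab c : ℤ) + 2 - 3 else (D.clab c : ℤ) + 3 - 2 := by
  obtain ⟨i, x⟩ := c
  obtain ⟨h1, h2⟩ := hc
  have hn := D.n_eq
  cases x
  · simp [lab, clab]; ring
  · have := D.β_q (j := i - 1) (by simp only at h1; omega) (by simp only at h1 h2; omega)
    simp only at h1
    rw [Nat.sub_add_cancel (by omega)] at this
    simp only [lab, clab, if_true]
    rw [if_neg (by omega)]
    omega

theorem flat_cork (b : S D) {c : Chord} (hc : D.IsChord c) {v : ZMod D.N} (hv : IsBit v)
    (u : ZMod D.N) :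
    Flat (((fr b).nxt c).ty 0 1) (((fr b).nxt c).ρ (2 * bit v + 1))
      (fun b => cork b c u v) b := by
  have hn := D.n_eq
  have hq := q_ne_zero hc
  have hp := D.hp
  obtain ⟨hc1, hc2⟩ := id hc
  have hadj := adj_cl b (c := c) hv
  set w := ((fr b).nxt c).ρ (2 * bit v + 1) with hw
  have hst := fun d => st_mul_of_adj hadj (act_cl b hc) d
  have hfr := fun d => fr_congr (hst d)
  have hkb : k1 b w = none := k1_eq_none_of_not_act (Frame.not_act_of_adj _ hadj (act_cl b hc))
  by_cases hu : IsBit u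
  · by_cases huv : u = v
    · subst huv
      simp only [cork_bit_same _ c hu]
      rcases hu with rfl | rfl
      · have h2 := lab_chord_zero hc
        have h3 : w = (fr b).ρ (D.lab (c.1 - 1) (if c.2 then 4 else 1)) := by
          rw [hw, h2, Frame.nxt_ρ]; simp
        have h4 := flat_gon (h := b) (j := c.1 - 1) (l := if c.2 then 4 else 1) (by omega)
          (by split_ifs <;> omega) (by split_ifs; exacts [isLab_mid _ (by omega) (by omega), isLab_one _])
          (by rw [← h3]; exact hkb)
        rw [← h3] at h4
        have h5 : ((fr b).nxt c).ty 0 1 = (fr b).ty (c.1 - 1) ((if c.2 then 4 else 1 : ℕ) : ℤ) := by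
          rw [Frame.nxt_ty_zero]; split_ifs <;> simp
        rw [h5]
        simpa using h4
      · have h2 := lab_chord_one hc
        have h3 : w = (fr b).ρ (D.lab c.1 (if c.2 then D.n - 2 else 1)) := by
          rw [hw, h2, Frame.nxt_ρ]; simp
        have h4 := flat_gon (h := b) (j := c.1) (l := if c.2 then D.n - 2 else 1) (by omega)
          (by split_ifs <;> omega) (by split_ifs; exacts [isLab_mid _ (by omega) (by omega), isLab_one _])
          (by rw [← h3]; exact hkb)
        rw [← h3] at h4
        have h5 : ((fr b).nxt c).ty 0 1 =
            (fr b).ty c.1 ((if c.2 then D.n - 2 else 1 : ℕ) : ℤ) := by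
          rw [Frame.nxt_ty_zero, Frame.ty_pred _ (by omega)]
          split_ifs
          · exact Frame.ty_neg _ _ (by omega)
          · norm_num
        rw [h5]
        simpa [Nat.sub_add_cancel (show 1 ≤ c.1 by omega)] using h4
    · refine Flat.of_line fun d => ?_
      have h1 := (line_dum (b * pw w d) hc (u := u) (v := v)
        ⟨iff_of_true hu hv, fun _ => huv⟩).1
      rw [hfr] at h1
      rw [h1, dumFlat, if_pos hv, hfr]
  · have he := ψ_ne_zero hq hu
    set h := b * pw (cl b c) (D.ψ u) with hh
    have hfrh : fr h = (fr b).nxt c := fr_cross hc he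
    have hkh : k1 h w = none := by
      refine k1_eq_none_of_not_act (Frame.not_act_of_adj _ hadj ?_)
      exact act_mul (act_cl b hc) _
    have key : Flat (((fr b).nxt c).ty 0 1) w (fun h => gon h (bit v)) h := by
      rcases hv with rfl | rfl
      · have h3 : w = (fr h).ρ (D.lab 0 1) := by rw [hw, hfrh]; simp [lab]
        have h4 := flat_gon (h := h) (j := 0) (l := 1) (by omega) (by omega) (isLab_one _)
          (by rw [← h3]; exact hkh)
        rw [← h3, hfrh] at h4
        simpa using h4
      · have h3 : w = (fr h).ρ (D.lab 1 1) := by rw [hw, hfrh]; simp [lab]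
        have h4 := flat_gon (h := h) (j := 1) (l := 1) one_le_k (by omega) (isLab_one _)
          (by rw [← h3]; exact hkh)
        rw [← h3, hfrh, Frame.ty_one] at h4
        simpa using h4
    refine key.transfer fun d => ?_
    simp only [cork_snd_bit _ c hu hv]
    have h5 : cl (b * pw w d) c = cl b c := by rw [cl, hfr]; rfl
    rw [h5, hh, mul_assoc, mul_assoc, (pw_comm hadj _ _).eq]

end Data

end GraphProdQIE

namespace GraphProdQIE

namespace Data

variable {D : Data}

open Cell

theorem comm_PD_two (h : S D) {i : ℕ} (h1 : 1 ≤ i) (hi : i ≤ D.p)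
    (hk : k1 h ((fr h).ρ (2 * i)) = none) (s : ZMod D.N) :
    Comm ((fr h).ty (i - 1) 3) ((fr h).ty (i - 1) 2) (PD h i s) := by
  refine comm_rot_flat (c := fun a h => PD h i a) (fun d => ?_) (flat_PD_two h1 hi hk) s
  have := rot_PD (h * pw ((fr h).ρ (2 * i)) d) h1 hi
  rwa [fr_mul_of_none hk] at this

theorem comm_PD_four (h : S D) {i : ℕ} (h1 : 1 ≤ i) (hi : i ≤ D.p) (s : ZMod D.N) :
    Comm ((fr h).ty (i - 1) 3) ((fr h).ty (i - 1) 4) (PD h i s) := by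
  have hkk := p_le_k (D := D)
  have hk := k1_four h (i := i - 1) (by omega)
  refine comm_rot_flat (c := fun a h => PD h i a) (fun d => ?_) (flat_PD_four h h1 hi) s
  have := rot_PD (h * pw ((fr h).ρ (D.β (i - 1) + 4)) d) h1 hi
  rwa [fr_mul_of_none hk] at this

theorem rot_cork_swap (b : S D) {c : Chord} (hc : D.IsChord c) (u : ZMod D.N) :
    Rot (((fr b).nxt c).ty 0 3) (fun v => cork b c u v) := by
  have := rot_cork b hc.swap u
  rw [Frame.nxt_swap_ty] at this
  simp only [cork_swap] at this
  exact this

theorem comm_cork_two (b : S D) {c : Chord} (hc : D.IsChord c) (u v : ZMod D.N) :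
    Comm (((fr b).nxt c).ty 0 2) (((fr b).nxt c).ty 0 3) (cork b c u v) :=
  comm_rot_rot (c := cork b c) (rot_cork b hc) (rot_cork_swap b hc) u v

theorem comm_cork_one (b : S D) {c : Chord} (hc : D.IsChord c) (u v : ZMod D.N) :
    Comm (((fr b).nxt c).ty 0 2) (((fr b).nxt c).ty 0 1) (cork b c u v) := by
  by_cases hv : IsBit v
  · refine comm_rot_flat (c := fun u b => cork b c u v) (fun d => ?_) (flat_cork b hc hv) u
    have := rot_cork (b * pw (((fr b).nxt c).ρ (2 * bit v + 1)) d) hc v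
    rwa [fr_congr (st_mul_of_adj (adj_cl b hv) (act_cl b hc) d)] at this
  · have he := ψ_ne_zero (q_ne_zero hc) hv
    have h1 := comm_PD_four (b * pw (cl b (swap c)) (D.ψ v)) le_rfl D.hp u
    rw [← cork_eq_PD b hc hv] at h1
    have h3 := fr_cross_swap_ty (b := b) hc he 3
    have h4 := fr_cross_swap_ty (b := b) hc he 4
    simp only [Nat.sub_self] at h1
    rw [h3, h4] at h1
    exact h1

theorem comm_cork_three (b : S D) {c : Chord} (hc : D.IsChord c) (u v : ZMod D.N) :
    Comm (((fr b).nxt c).ty 0 3) (((fr b).nxt c).ty 0 4) (cork b c u v) := by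
  have := comm_cork_one b hc.swap v u
  rw [Frame.nxt_swap_ty, Frame.nxt_swap_ty, cork_swap] at this
  exact this

theorem comm_PD_two' (h : S D) {i : ℕ} (h1 : 1 ≤ i) (hi : i ≤ D.p) (s : ZMod D.N) :
    Comm ((fr h).ty (i - 1) 3) ((fr h).ty (i - 1) 2) (PD h i s) := by
  rcases hk : k1 h ((fr h).ρ (2 * i)) with _ | ⟨c, e⟩
  · exact comm_PD_two h h1 hi hk s
  · obtain rfl := k1_two h1 hi hk
    simp only [Nat.cast_one, mul_one] at hk
    obtain ⟨he, hc, hb⟩ := exists_cross hk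
    generalize h * pw ((fr h).ρ 2) (-e) = b at hb
    subst hb
    rw [PD_cross b hc he, fr_cross hc he]
    exact (comm_cork_two b hc _ s).symm

theorem triv_PD (h : S D) {i : ℕ} (h1 : 1 ≤ i) (hi : i ≤ D.p) {s : ZMod D.N} (hs : ¬ IsBit s)
    {l : ℕ} (hl : l < D.n) (hl' : l = 0 ∨ 5 ≤ l) : Triv ((fr h).ty (i - 1) l) (PD h i s) := by
  refine Triv.of_line ?_
  by_cases hx : PD h i s = pd h i s
  · rw [line_pd h1 hi hx hl, if_neg (by omega), if_neg (by omega), if_neg (by omega)]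
  · rcases hk : k1 h ((fr h).ρ (2 * i)) with _ | ⟨c, e⟩
    · exact absurd (PD_eq_pd hk hs) hx
    obtain rfl := k1_two h1 hi hk
    simp only [Nat.cast_one, mul_one] at hk
    obtain ⟨he, hc, hb⟩ := exists_cross hk
    generalize h * pw ((fr h).ρ 2) (-e) = b at hb
    subst hb
    rw [PD_cross b hc he, fr_cross hc he]
    have hφ := not_isBit_φ (q_ne_zero hc) he
    exact (line_dum b hc (u := D.φ e) (v := s)
        ⟨iff_of_false hφ hs, fun h => absurd h hφ⟩).2.2 l hl hl'

theorem comm_PD_five (h : S D) {i : ℕ} (h1 : 1 ≤ i) (hi : i ≤ D.p) {s : ZMod D.N}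
    (hs : ¬ IsBit s) : Comm ((fr h).ty (i - 1) 5) ((fr h).ty (i - 1) 4) (PD h i s) := by
  have hkk := p_le_k (D := D)
  have hn := D.n_eq
  have hk := k1_four h (i := i - 1) (by omega)
  refine comm_triv_flat (c := fun h => PD h i s) (fun d => ?_) (flat_PD_four h h1 hi s)
  have := triv_PD (h * pw ((fr h).ρ (D.β (i - 1) + 4)) d) h1 hi hs (l := 5) (by omega) (by omega)
  rwa [fr_mul_of_none hk] at this

theorem comm_PD_zero (h : S D) {i : ℕ} (h1 : 1 ≤ i) (hi : i ≤ D.p) {s : ZMod D.N}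
    (hx : PD h i s = pd h i s) (hs : ¬ IsBit s) :
    Comm ((fr h).ty (i - 1) 1) ((fr h).ty (i - 1) 2) (PD h i s) := by
  have hn := D.n_eq
  have hk := k1_none_of_pd h1 hi hx
  refine comm_triv_flat (c := fun h => PD h i s) (fun d => ?_) (flat_PD_two h1 hi hk s)
  refine Triv.of_line ?_
  have hf := fr_mul_of_none hk d
  have hk' := k1_mul_of_none hk d
  have := line_pd (h := h * pw ((fr h).ρ (2 * i)) d) h1 hi (PD_eq_pd (by rwa [hf]) hs) (l := 1) (by omega)
  rwa [hf] at this

theorem line_pd_cell {h : S D} {i : ℕ} {s : ZMod D.N} (t : ZMod D.n) :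
    line (pd h i s) t = .triv ∨ PD h i s = pd h i s ∧ 1 ≤ i ∧ i ≤ D.p ∧ ¬ IsBit s := by
  by_cases hx : PD h i s = pd h i s ∧ 1 ≤ i ∧ i ≤ D.p
  · refine Or.inr ⟨hx.1, hx.2.1, hx.2.2, ?_⟩
    rintro (rfl | rfl)
    · simpa using hx.1
    · simpa using hx.1
  · left
    simp only [line, if_neg hx]

theorem comm_pd (h : S D) {i : ℕ} (h1 : 1 ≤ i) (hi : i ≤ D.p) {s : ZMod D.N}
    (hx : PD h i s = pd h i s) (hs : ¬ IsBit s) {l : ℕ} (hl : l < D.n) :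
    Comm ((fr h).ty (i - 1) l) ((fr h).ty (i - 1) (l + 1)) (pd h i s) := by
  have hn := D.n_eq
  rw [← hx]
  have ht := fun l hl => triv_PD h h1 hi hs (l := l) hl
  rcases Nat.lt_or_ge 5 (l + 1) with h5 | h5
  · refine comm_triv_triv (ht l hl (by omega)) ?_
    rcases Nat.lt_or_ge (l + 1) D.n with h6 | h6
    · exact_mod_cast ht (l + 1) h6 (by omega)
    · have h7 : ((l : ℤ) + 1) = (0 : ℕ) + D.n := by omega
      rw [h7, Frame.ty_add_n]
      exact ht 0 (by omega) (by omega)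
  · have h6 : l = 0 ∨ l = 1 ∨ l = 2 ∨ l = 3 ∨ l = 4 := by omega
    rcases h6 with rfl | rfl | rfl | rfl | rfl
    · refine comm_triv_triv (ht 0 hl (by omega)) ?_
      refine Triv.of_line ?_
      exact_mod_cast line_pd h1 hi hx (l := 1) (by omega)
    · exact comm_PD_zero h h1 hi hx hs
    · exact (comm_PD_two' h h1 hi s).symm
    · exact comm_PD_four h h1 hi s
    · exact (comm_PD_five h h1 hi hs).symm

theorem comm_dum_zero (b : S D) {c : Chord} (hc : D.IsChord c) {u v : ZMod D.N} (hd : IsDum u v) :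
    Comm (((fr b).nxt c).ty 0 0) (((fr b).nxt c).ty 0 1) (cork b c u v) := by
  have hn := D.n_eq
  by_cases hv : IsBit v
  · refine comm_triv_flat (c := fun b => cork b c u v) (fun d => ?_) (flat_cork b hc hv u)
    have := (line_dum (b * pw (((fr b).nxt c).ρ (2 * bit v + 1)) d) hc hd).2.2 0 (by omega)
      (by omega)
    rw [fr_congr (st_mul_of_adj (adj_cl b hv) (act_cl b hc) d)] at this
    exact Triv.of_line this
  · have hu : ¬ IsBit u := fun hu => hv (hd.1.1 hu)
    have he := ψ_ne_zero (q_ne_zero hc) hv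
    have h1 := comm_PD_five (b * pw (cl b (swap c)) (D.ψ v)) le_rfl D.hp hu
    rw [← cork_eq_PD b hc hv] at h1
    have h3 := fr_cross_swap_ty (b := b) hc he 5
    have h4 := fr_cross_swap_ty (b := b) hc he 4
    simp only [Nat.sub_self] at h1
    rw [h3, h4] at h1
    exact h1

theorem comm_dum (b : S D) {c : Chord} (hc : D.IsChord c) {u v : ZMod D.N} (hd : IsDum u v)
    {l : ℕ} (hl : l < D.n) :
    Comm (((fr b).nxt c).ty 0 l) (((fr b).nxt c).ty 0 (l + 1)) (cork b c u v) := by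
  have hn := D.n_eq
  have ht := fun l hl hl' => Triv.of_line ((line_dum b hc hd).2.2 l hl hl')
  rcases Nat.lt_or_ge 5 (l + 1) with h5 | h5
  · refine comm_triv_triv (ht l hl (by omega)) ?_
    rcases Nat.lt_or_ge (l + 1) D.n with h6 | h6
    · exact_mod_cast ht (l + 1) h6 (by omega)
    · have h7 : ((l : ℤ) + 1) = (0 : ℕ) + D.n := by omega
      rw [h7, Frame.ty_add_n]
      exact ht 0 (by omega) (by omega)
  · have h6 : l = 0 ∨ l = 1 ∨ l = 2 ∨ l = 3 ∨ l = 4 := by omega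
    rcases h6 with rfl | rfl | rfl | rfl | rfl
    · exact comm_dum_zero b hc hd
    · exact (comm_cork_one b hc u v).symm
    · exact comm_cork_two b hc u v
    · exact comm_cork_three b hc u v
    · have := comm_dum_zero b hc.swap hd.symm
      rw [Frame.nxt_swap_ty, Frame.nxt_swap_ty, cork_swap] at this
      exact this.symm

/-- The position of a side of a small cycle. -/
theorem side_cases {j l : ℕ} (hj : j ≤ D.k) (hl : l < D.n) :
    (l = 3 ∧ j < D.p) ∨ (l + 1 = D.n ∧ 1 ≤ j ∧ j ≤ D.p) ∨
    (∃ c : Chord, D.IsChord c ∧ j + 1 = c.1 ∧ l = if c.2 then 3 else 2) ∨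
    (∃ c : Chord, D.IsChord c ∧ j = c.1 ∧ l = if c.2 then D.n - 1 else 0) ∨ IsLab D j l := by
  have hn := D.n_eq
  by_cases h1 : l = 3 ∧ j < D.p
  · exact Or.inl h1
  by_cases h2 : l + 1 = D.n ∧ 1 ≤ j ∧ j ≤ D.p
  · exact Or.inr (Or.inl h2)
  by_cases h3 : l = 2 ∧ D.p ≤ j ∧ j < D.k
  · exact Or.inr (Or.inr (Or.inl ⟨(j + 1, false), ⟨by simp; omega, h3.2.2⟩, rfl, h3.1⟩))
  by_cases h4 : l = 3 ∧ D.p ≤ j ∧ j < D.k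
  · exact Or.inr (Or.inr (Or.inl ⟨(j + 1, true), ⟨by simp; omega, h4.2.2⟩, rfl, h4.1⟩))
  by_cases h5 : l = 0 ∧ D.p < j
  · exact Or.inr (Or.inr (Or.inr (Or.inl ⟨(j, false), ⟨h5.2, hj⟩, rfl, h5.1⟩)))
  by_cases h6 : l + 1 = D.n ∧ D.p < j
  · exact Or.inr (Or.inr (Or.inr (Or.inl ⟨(j, true), ⟨h6.2, hj⟩, rfl, by simp; omega⟩)))
  have := p_le_k (D := D)
  exact Or.inr (Or.inr (Or.inr (Or.inr ⟨by omega, by omega, by omega, by omega⟩)))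

/-- The chambers next to a crossed chord. -/
theorem gon_cross {b : S D} {c : Chord} (hc : D.IsChord c) {e : ZMod D.M} (he : e ≠ 0)
    {v : ZMod D.N} (hv : IsBit v) :
    gon (b * pw (cl b c) e) (bit v) = cork b c (D.φ e) v := by
  rw [cork_snd_bit _ _ (not_isBit_φ (q_ne_zero hc) he) hv, D.ψφ]

/-- A lab side over a crossed chord. -/
theorem rot_lab {h : S D} {j l : ℕ} (hj : j ≤ D.k) (hl : l < D.n) (hI : IsLab D j l)
    {x : Chord × ZMod D.M} (hk : k1 h ((fr h).ρ (D.lab j l)) = some x) :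
    ∃ b c e v, D.IsChord c ∧ e ≠ 0 ∧ IsBit v ∧ h = b * pw (cl b c) e ∧ j = bit v ∧
      (fr h).ty j l = ((fr b).nxt c).ty 0 2 ∧ gon h j = cork b c (D.φ e) v ∧
      (l = 2 ∧ j = 0 ∨ l = 0 ∧ j = 1) := by
  obtain ⟨c, e⟩ := x
  have h2 := k1_lab hj hl hI hk
  have h3 := lab_eq_two h2 hI
  rw [h2] at hk
  obtain ⟨he, hc, hb⟩ := exists_cross (by exact_mod_cast hk)
  generalize h * pw ((fr h).ρ 2) (-e) = b at hb
  subst hb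
  rcases h3 with ⟨rfl, rfl⟩ | ⟨rfl, rfl⟩
  · refine ⟨b, c, e, 0, hc, he, Or.inl rfl, rfl, by simp, ?_, ?_, Or.inl ⟨rfl, rfl⟩⟩
    · rw [fr_cross hc he]; rfl
    · rw [← gon_cross hc he (Or.inl rfl), bit_zero]
  · refine ⟨b, c, e, 1, hc, he, Or.inr rfl, rfl, by simp, ?_, ?_, Or.inr ⟨rfl, rfl⟩⟩
    · rw [fr_cross hc he, Frame.ty_one]; rfl
    · rw [← gon_cross hc he (Or.inr rfl), bit_one]

/-- The families of chambers that are permuted by translation. -/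
inductive RotFam : (ZMod D.N → Cell D) → Prop
  | panel (h : S D) {i : ℕ} (h1 : 1 ≤ i) (hi : i ≤ D.p) : RotFam (PD h i)
  | block (b : S D) {c : Chord} (hc : D.IsChord c) (v : ZMod D.N) : RotFam (fun u => cork b c u v)

/-- The families of chambers on which a vertex group acts by right multiplication. -/
inductive FlatFam : ZMod D.m → (S D → Cell D) → S D → Prop
  | gon (v : ZMod D.m) (j : ℕ) (h : S D) : FlatFam v (fun h => gon h j) h
  | panel {v : ZMod D.m} {h : S D} {i : ℕ} (s : ZMod D.N) (h1 : 1 ≤ i) (hi : i ≤ D.p)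
      (hk : k1 h v = none) (hv : i = 1 → (fr h).Act v) : FlatFam v (fun h => PD h i s) h
  | block (b : S D) {c : Chord} (hc : D.IsChord c) (u : ZMod D.N) {w : ZMod D.N} (hw : IsBit w) :
      FlatFam (((fr b).nxt c).ρ (2 * bit w + 1)) (fun b => cork b c u w) b

theorem flatFam_two {h : S D} {i : ℕ} (h1 : 1 ≤ i) (hi : i ≤ D.p)
    (hk : k1 h ((fr h).ρ (2 * i)) = none) (s : ZMod D.N) :
    FlatFam ((fr h).ρ (2 * i)) (fun h => PD h i s) h :=
  .panel s h1 hi hk (by rintro rfl; exact Frame.act_two _)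

theorem flatFam_four (h : S D) {i : ℕ} (h1 : 1 ≤ i) (hi : i ≤ D.p) (s : ZMod D.N) :
    FlatFam ((fr h).ρ (D.β (i - 1) + 4)) (fun h => PD h i s) h := by
  have := p_le_k (D := D)
  refine .panel s h1 hi (k1_four h (i := i - 1) (by omega)) ?_
  rintro rfl
  exact ⟨_, Or.inr (Or.inl rfl), by push_cast; rfl⟩

/-- The orbits of the vertex groups. -/
def Lawful (t : ZMod D.n) (x : Cell D) : Prop :=
  (∃ c s, RotFam c ∧ c s = x ∧ Rot t c) ∨ (∃ v c h, FlatFam v c h ∧ c h = x ∧ Flat t v c h) ∨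
    Triv t x

theorem lawful_cork (b : S D) {c : Chord} (hc : D.IsChord c) (u v : ZMod D.N) :
    Lawful (((fr b).nxt c).ty 0 2) (cork b c u v) :=
  Or.inl ⟨fun u => cork b c u v, u, .block b hc v, rfl, rot_cork b hc v⟩

theorem lawful_cork_one (b : S D) {c : Chord} (hc : D.IsChord c) (u v : ZMod D.N) :
    Lawful (((fr b).nxt c).ty 0 1) (cork b c u v) := by
  right; left
  by_cases hv : IsBit v
  · exact ⟨_, _, _, .block b hc u hv, rfl, flat_cork b hc hv u⟩
  · have he := ψ_ne_zero (q_ne_zero hc) hv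
    have h1 := flat_PD_four (b * pw (cl b (swap c)) (D.ψ v)) le_rfl D.hp u
    have h2 := flatFam_four (b * pw (cl b (swap c)) (D.ψ v)) le_rfl D.hp u
    simp only [Nat.sub_self] at h1 h2
    rw [fr_cross_swap_ty (b := b) hc he 4] at h1
    exact ⟨_, _, _, h2, (congrFun (cork_eq_PD b hc hv) u).symm, h1⟩

theorem lawful (t : ZMod D.n) (x : Cell D) : Lawful t x := by
  have hn := D.n_eq
  cases x with
  | gon h j =>
    by_cases hj : j ≤ D.k
    swap
    · exact Or.inr (Or.inr (Triv.of_line (by simp only [line, if_neg hj])))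
    rw [← (fr h).ty_loc j t]
    have hl := (fr h).loc_lt j t
    generalize (fr h).loc j t = l at hl
    rcases side_cases hj hl with ⟨rfl, hp⟩ | ⟨h1, h2, h3⟩ | ⟨c, hc, h1, rfl⟩ |
      ⟨c, hc, rfl, rfl⟩ | hI
    · have := rot_PD h (i := j + 1) (by omega) (by omega)
      rw [Nat.add_sub_cancel] at this
      exact Or.inl ⟨PD h (j + 1), 0, .panel h (by omega) (by omega), by rw [PD_zero, Nat.add_sub_cancel], this⟩
    · refine Or.inl ⟨PD h j, 1, .panel h h2 h3, PD_one h j, ?_⟩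
      have := rot_PD h h2 h3
      rwa [Frame.ty_pred _ h2, Frame.ty_neg (l' := l) _ _ (by omega)] at this
    · obtain rfl : j = c.1 - 1 := by omega
      have := lawful_cork h hc 0 0
      rwa [cork_bit_same _ _ (Or.inl rfl), bit_zero, add_zero, Frame.nxt_ty_block_zero] at this
    · have := lawful_cork h hc 1 1
      rwa [cork_bit_same _ _ (Or.inr rfl), bit_one, Nat.sub_add_cancel (by have := hc.1; omega),
        Frame.nxt_ty_block_one _ hc] at this
    · rcases hk : k1 h ((fr h).ρ (D.lab j l)) with _ | y
      · exact Or.inr (Or.inl ⟨_, _, _, .gon _ j h, rfl, flat_gon hj hl hI hk⟩)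
      · obtain ⟨b, c, e, v, hc, he, hv, hh, hj', ht, hg, -⟩ := rot_lab hj hl hI hk
        rw [ht, hg]
        exact lawful_cork b hc _ _
  | pd h i s =>
    rcases line_pd_cell t (h := h) (i := i) (s := s) with h0 | ⟨hx, h1, hi, hs⟩
    · exact Or.inr (Or.inr (Triv.of_line h0))
    rw [← (fr h).ty_loc (i - 1) t]
    have hl := (fr h).loc_lt (i - 1) t
    generalize (fr h).loc (i - 1) t = l at hl
    by_cases h3 : l = 3
    · subst h3; exact Or.inl ⟨PD h i, s, .panel h h1 hi, hx, rot_PD h h1 hi⟩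
    by_cases h2 : l = 2
    · subst h2
      have hk := k1_none_of_pd h1 hi hx
      exact Or.inr (Or.inl ⟨_, _, _, flatFam_two h1 hi hk s, hx, flat_PD_two h1 hi hk s⟩)
    by_cases h4 : l = 4
    · subst h4; exact Or.inr (Or.inl ⟨_, _, _, flatFam_four h h1 hi s, hx, flat_PD_four h h1 hi s⟩)
    refine Or.inr (Or.inr (Triv.of_line ?_))
    have := line_pd h1 hi hx hl
    rwa [hx, if_neg h3, if_neg h2, if_neg h4] at this
  | dum b i u v =>
    by_cases hx : cork b (i, false) u v = dum b i u v ∧ D.IsChord (i, false)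
    swap
    · exact Or.inr (Or.inr (Triv.of_line (by simp only [line, if_neg hx])))
    obtain ⟨hx, hc⟩ := hx
    rw [← (fr b).ty_loc (i - 1) t, ← hx]
    have hl := (fr b).loc_lt (i - 1) t
    generalize (fr b).loc (i - 1) t = l at hl
    have ht : ∀ l : ℤ, (fr b).ty (i - 1) l = ((fr b).nxt (i, false)).ty 0 l := fun l => by
      rw [Frame.nxt_ty_zero]; simp
    rw [ht]
    have h34 := fun l => (fr b).nxt_swap_ty (i, false) l
    by_cases h1 : l = 1
    · subst h1; exact lawful_cork_one b hc u v
    by_cases h2 : l = 2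
    · subst h2; exact lawful_cork b hc u v
    by_cases h3 : l = 3
    · subst h3
      have := lawful_cork b hc.swap v u
      rw [h34, cork_swap] at this
      exact this
    by_cases h4 : l = 4
    · subst h4
      have := lawful_cork_one b hc.swap v u
      rw [h34, cork_swap] at this
      exact this
    exact Or.inr (Or.inr (Triv.of_line
      ((line_dum b hc (cork_false_eq_dum_iff.1 hx)).2.2 l hl (by omega))))

end Data

end GraphProdQIE

namespace GraphProdQIE

namespace Data

variable {D : Data}

open Cell

theorem comm_lab {h : S D} {j l l' : ℕ} (hj : j ≤ D.k) (hl : l < D.n) (hl' : l' < D.n)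
    (hI : IsLab D j l) (hI' : IsLab D j l') (ht : (fr h).ty j l ≠ (fr h).ty j l')
    (hadj : (cycleGraph D.m).Adj ((fr h).ρ (D.lab j l)) ((fr h).ρ (D.lab j l')))
    (hk : k1 h ((fr h).ρ (D.lab j l)) = none) (hk' : k1 h ((fr h).ρ (D.lab j l')) = none) :
    Comm ((fr h).ty j l) ((fr h).ty j l') (gon h j) := by
  refine comm_flat_flat ht (c := fun h => gon h j) hadj (fun d => ?_) (fun d => ?_)
  · have h1 := k1_persist hadj hk hk' d
    have h2 := fr_mul_of_none hk' d
    have h3 := flat_gon (h := h * pw ((fr h).ρ (D.lab j l')) d) hj hl hI (by rwa [h2])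
    rwa [h2] at h3
  · have h1 := k1_persist hadj.symm hk' hk d
    have h2 := fr_mul_of_none hk d
    have h3 := flat_gon (h := h * pw ((fr h).ρ (D.lab j l)) d) hj hl' hI' (by rwa [h2])
    rwa [h2] at h3

/-- Consecutive sides on the boundary of the large polygon. -/
theorem adj_lab (F : Frame D) {j l l' : ℕ} (hj : j ≤ D.k) (hl : l < D.n)
    (hI : IsLab D j l) (hI' : IsLab D j l') (hll : l' = l + 1 ∨ l + 1 = D.n ∧ l' = 0) :
    (cycleGraph D.m).Adj (F.ρ (D.lab j l)) (F.ρ (D.lab j l')) := by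
  have hn := D.n_eq
  have hm := D.m_eq
  have h1 := Aff.adj_succ F.ρ (show 2 ≤ D.m by omega) (D.lab j l)
  have h2 : ((D.lab j l : ℤ) + 1) = D.lab j l' ∨ ((D.lab j l : ℤ) + 1) = D.lab j l' + D.m := by
    rcases hll with rfl | ⟨h3, rfl⟩
    · left
      by_cases h2 : l = 2
      · subst h2
        have h4 := hI'.1 rfl
        obtain rfl : j = D.k := by omega
        have := D.β_k
        simp only [lab]
        rw [if_pos le_rfl, if_neg (by omega)]
        omega
      · simp only [lab]
        split_ifs <;> omega
    · right
      have h4 := hI.2.1 h3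
      subst h4
      simp only [lab]
      rw [if_neg (by omega), if_pos (by omega)]
      omega
  rcases h2 with h2 | h2
  · rwa [h2] at h1
  · rwa [h2, Aff.apply_add] at h1

theorem comm_gon (h : S D) {j l l' : ℕ} (hj : j ≤ D.k) (hl : l < D.n)
    (hll : l' = l + 1 ∧ l' < D.n ∨ l + 1 = D.n ∧ l' = 0) :
    Comm ((fr h).ty j l) ((fr h).ty j l') (gon h j) := by
  have hn := D.n_eq
  have hl' : l' < D.n := by omega
  have hpk := p_le_k (D := D)
  by_cases hA : (l = 3 ∨ l = 2) ∧ j < D.p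
  · obtain ⟨h2, h1⟩ := hA
    have hx := comm_PD_two' h (i := j + 1) (by omega) (by omega) 0
    have hy := comm_PD_four h (i := j + 1) (by omega) (by omega) 0
    rw [PD_zero, Nat.add_sub_cancel] at hx hy
    rcases h2 with rfl | rfl
    · obtain rfl : l' = 4 := by omega
      exact hy
    · obtain rfl : l' = 3 := by omega
      exact hx.symm
  by_cases hB : (l + 1 = D.n ∨ l + 2 = D.n) ∧ 1 ≤ j ∧ j ≤ D.p
  · obtain ⟨h3, h1, h2⟩ := hB
    have hx := comm_PD_two' h h1 h2 1
    have hy := comm_PD_four h h1 h2 1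
    rw [PD_one, Frame.ty_pred _ h1, Frame.ty_pred _ h1] at hx hy
    rw [Frame.ty_neg (l := 2 - 3) (l' := D.n - 1) _ _ (by omega)] at hx
    rw [Frame.ty_neg (l := 2 - 3) (l' := D.n - 1) _ _ (by omega),
      Frame.ty_neg (l := 2 - 4) (l' := D.n - 2) _ _ (by omega)] at hy
    rcases h3 with h3 | h3
    · obtain rfl : l = D.n - 1 := by omega
      obtain rfl : l' = 0 := by omega
      exact hx
    · obtain rfl : l = D.n - 2 := by omega
      obtain rfl : l' = D.n - 1 := by omega
      exact hy.symm
  by_cases hC : (l = 1 ∨ l = 2 ∨ l = 3) ∧ D.p ≤ j ∧ j < D.k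
  · obtain ⟨h3, h1, h2⟩ := hC
    have hc : D.IsChord (j + 1, false) := ⟨by simp only; omega, h2⟩
    have hx := (comm_cork_one h hc 0 0).symm
    have hy := comm_cork_two h hc 0 0
    have hz := comm_cork_three h hc 0 0
    rw [cork_bit_same _ _ (Or.inl rfl)] at hx hy hz
    simp only [Frame.nxt_ty_zero, Bool.false_eq_true, if_false, bit_zero, Nat.add_sub_cancel,
      add_zero] at hx hy hz
    rcases h3 with rfl | rfl | rfl
    · obtain rfl : l' = 2 := by omega
      exact hx
    · obtain rfl : l' = 3 := by omega
      exact hy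
    · obtain rfl : l' = 4 := by omega
      exact hz
  by_cases hE : (l = 0 ∨ l + 1 = D.n ∨ l + 2 = D.n) ∧ D.p < j
  · obtain ⟨h3, h1⟩ := hE
    have hc : D.IsChord (j, false) := ⟨h1, hj⟩
    have hx := (comm_cork_one h hc 1 1).symm
    have hy := comm_cork_two h hc 1 1
    have hz := comm_cork_three h hc 1 1
    rw [cork_bit_same _ _ (Or.inr rfl)] at hx hy hz
    have hj1 : 1 ≤ j := by omega
    simp only [Frame.nxt_ty_zero, Bool.false_eq_true, if_false, bit_one, Nat.sub_add_cancel hj1,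
      Frame.ty_pred _ hj1] at hx hy hz
    rw [Frame.ty_neg (l := 2 - 3) (l' := D.n - 1) _ _ (by omega)] at hy
    rw [Frame.ty_neg (l := 2 - 3) (l' := D.n - 1) _ _ (by omega),
      Frame.ty_neg (l := 2 - 4) (l' := D.n - 2) _ _ (by omega)] at hz
    rcases h3 with rfl | h3 | h3
    · obtain rfl : l' = 1 := by omega
      exact hx.symm
    · obtain rfl : l = D.n - 1 := by omega
      obtain rfl : l' = 0 := by omega
      exact hy.symm
    · obtain rfl : l = D.n - 2 := by omega
      obtain rfl : l' = D.n - 1 := by omega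
      exact hz.symm
  have hI : IsLab D j l := ⟨by omega, by omega, by omega, by omega⟩
  have hI' : IsLab D j l' := ⟨by omega, by omega, by omega, by omega⟩
  have hadj := adj_lab (fr h) hj hl hI hI' (by omega)
  have ht : (fr h).ty j l ≠ (fr h).ty j l' := by
    intro he
    have := (((fr h).tyA j).apply_inj hl hl').1 he
    omega
  rcases hk : k1 h ((fr h).ρ (D.lab j l)) with _ | y
  · rcases hk' : k1 h ((fr h).ρ (D.lab j l')) with _ | y
    · exact comm_lab hj hl hl' hI hI' ht hadj hk hk'
    · obtain ⟨b, c, e, v, hc, he, hv, hh, hj', ht, hg, h3⟩ := rot_lab hj hl' hI' hk'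
      have := comm_cork_one b hc (D.φ e) v
      rw [← hg, ← ht, ← fr_cross hc he, ← hh] at this
      have hD := D.hp
      obtain ⟨rfl, hj0⟩ : l = 1 ∧ j = 0 := by omega
      rw [hj0] at this ⊢
      exact this.symm
  · obtain ⟨b, c, e, v, hc, he, hv, hh, hj', ht, hg, h3⟩ := rot_lab hj hl hI hk
    have := comm_cork_one b hc (D.φ e) v
    rw [← hg, ← ht, ← fr_cross hc he, ← hh] at this
    have hD := D.hp
    obtain ⟨rfl, hj0⟩ : l = 0 ∧ j = 1 := by omega
    obtain rfl : l' = 1 := by omega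
    rw [hj0] at this ⊢
    rw [show (fr h).ty 1 ((1 : ℕ) : ℤ) = (fr h).ty 0 1 from Frame.ty_one _ _]
    exact this

/-- Commutation of all consecutive sides implies commutation of all adjacent types. -/
theorem comm_of_side (F : Frame D) (j : ℕ) {x : Cell D}
    (H : ∀ l l' : ℕ, l < D.n → (l' = l + 1 ∧ l' < D.n ∨ l + 1 = D.n ∧ l' = 0) →
      Comm (F.ty j l) (F.ty j l') x) {t t' : ZMod D.n} (ht : (cycleGraph D.n).Adj t t') :
    Comm t t' x := by
  have hn := D.n_eq
  rw [← F.ty_loc j t, ← F.ty_loc j t'] at ht ⊢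
  have ha := F.loc_lt j t
  have hb := F.loc_lt j t'
  generalize F.loc j t = a at *
  generalize F.loc j t' = b at *
  have := Aff.adj_apply (F.tyA j) (by omega) ha hb ht
  by_cases h1 : b = a + 1 ∧ b < D.n ∨ a + 1 = D.n ∧ b = 0
  · exact H a b ha h1
  · exact (H b a hb (by omega)).symm

theorem side_cast (F : Frame D) (j : ℕ) {l l' : ℕ}
    (hll : l' = l + 1 ∧ l' < D.n ∨ l + 1 = D.n ∧ l' = 0) :
    F.ty j l' = F.ty j ((l : ℤ) + 1) := by
  rcases hll with ⟨rfl, -⟩ | ⟨h, rfl⟩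
  · push_cast; rfl
  · have h7 : ((l : ℤ) + 1) = (0 : ℕ) + D.n := by omega
    rw [h7, Frame.ty_add_n]

theorem comm_act {t t' : ZMod D.n} (ht : (cycleGraph D.n).Adj t t') (x : Cell D) :
    Comm t t' x := by
  cases x with
  | gon h j =>
    by_cases hj : j ≤ D.k
    · exact comm_of_side (fr h) j (fun l l' hl hll => comm_gon h hj hl hll) ht
    · have h0 : ∀ t, Triv t (gon h j) := fun t => Triv.of_line (by simp only [line, if_neg hj])
      exact comm_triv_triv (h0 t) (h0 t')
  | pd h i s =>
    by_cases hx : PD h i s = pd h i s ∧ 1 ≤ i ∧ i ≤ D.p ∧ ¬ IsBit s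
    · obtain ⟨hx, h1, hi, hs⟩ := hx
      refine comm_of_side (fr h) (i - 1) (fun l l' hl hll => ?_) ht
      rw [side_cast _ _ hll]
      exact comm_pd h h1 hi hx hs hl
    · have h0 : ∀ t, Triv t (pd h i s) := fun t => Triv.of_line ((line_pd_cell t).resolve_right hx)
      exact comm_triv_triv (h0 t) (h0 t')
  | dum b i u v =>
    by_cases hx : cork b (i, false) u v = dum b i u v ∧ D.IsChord (i, false)
    · obtain ⟨hx, hc⟩ := hx
      rw [← hx]
      refine comm_of_side ((fr b).nxt (i, false)) 0 (fun l l' hl hll => ?_) ht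
      rw [side_cast _ _ hll]
      exact comm_dum b hc (cork_false_eq_dum_iff.1 hx) hl
    · have h0 : ∀ t, Triv t (dum b i u v) := fun t =>
        Triv.of_line (by simp only [line, if_neg hx])
      exact comm_triv_triv (h0 t) (h0 t')

/-- The action of the small group on the chambers. -/
noncomputable def ptAct (D : Data) : RightAct (cycleGraph D.n) (fun _ => D.N) (Pt D) where
  a := act
  a_zero t := by
    rintro ⟨x, τ⟩
    rcases lawful t x with ⟨c, s, -, rfl, h⟩ | ⟨v, c, h, -, rfl, hf⟩ | h
    · rw [h, add_zero]
    · have := hf 0 0 τ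
      simpa using this
    · exact h _ _
  a_add t y z := by
    rintro ⟨x, τ⟩
    rcases lawful t x with ⟨c, s, -, rfl, h⟩ | ⟨v, c, h, -, rfl, hf⟩ | h
    · rw [h, h, h, add_assoc]
    · have h1 := fun z => hf 0 z τ
      simp only [pw_zero, mul_one] at h1
      rw [h1, h1, hf]
      simp only [Function.update_self, Function.update_idem, add_assoc]
      rw [mul_assoc, ← pw_add]
      congr 4
      abel
    · rw [h, h, h]
  a_comm t t' ht y z := by
    rintro ⟨x, τ⟩
    exact comm_act ht x y z τ

end Data

end GraphProdQIE

namespace GraphProdQIE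

namespace Data

variable {D : Data}

open Cell

theorem nrm_mul_left_cancel (g a b : S D) : nrm ((g * a)⁻¹ * (g * b)) = nrm (a⁻¹ * b) := by
  rw [mul_inv_rev, mul_assoc, inv_mul_cancel_left]

theorem nrm_inv_mul_mul (g a : S D) : nrm (g⁻¹ * (g * a)) = nrm a := by
  rw [inv_mul_cancel_left]

theorem nrm_act_one (f : Cell D → S D) (C : ℕ)
    (hr : ∀ c, RotFam c → ∀ s, nrm ((f (c s))⁻¹ * f (c (s + 1))) ≤ C)
    (hf : ∀ v c h, FlatFam v c h → ∀ s,
      nrm ((f (c h))⁻¹ * f (c (h * pw v (D.ψ (s + 1) - D.ψ s)))) ≤ C)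
    (x : Pt D) (t : ZMod D.n) : nrm ((f x.1)⁻¹ * f (act t 1 x).1) ≤ C := by
  obtain ⟨x, τ⟩ := x
  rcases lawful t x with ⟨c, s, hc, rfl, h⟩ | ⟨v, c, h, hc, rfl, hF⟩ | h
  · rw [h]; exact hr c hc s
  · have := hF 0 1 τ
    simp only [pw_zero, mul_one] at this
    rw [this]
    exact hf v c h hc (τ t)
  · rw [h]; simp

/-- The group element of a chamber. -/
def root : Cell D → S D
  | gon h _ => h
  | pd h _ _ => h
  | dum b _ _ _ => b

theorem nrm_pw_le' (hM : D.M ≠ 0) (v : ZMod D.m) (z : ZMod D.M) :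
    nrm (pw v z : S D) ≤ D.M :=
  nrm_pw_le (K := fun _ => D.M) v hM z

theorem nrm_root_cork (hM : D.M ≠ 0) (b : S D) (c : Chord) (u v : ZMod D.N) :
    nrm (b⁻¹ * root (cork b c u v)) ≤ D.M := by
  unfold cork
  split_ifs <;> simp only [root, inv_mul_cancel, nrm_one, inv_mul_cancel_left, zero_le] <;>
    exact nrm_pw_le' hM _ _

theorem nrm_root_PD (hM : D.M ≠ 0) (h : S D) (i : ℕ) (s : ZMod D.N) :
    nrm (h⁻¹ * root (PD h i s)) ≤ 2 * D.M := by
  unfold PD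
  split_ifs
  · simp [root]
  · simp [root]
  swap
  · simp [root]
  rcases k1 h ((fr h).ρ 2) with _ | ⟨c, e⟩
  · simp [root]
  · simp only
    refine (nrm_triangle h (h * pw ((fr h).ρ 2) (-e)) _).trans ?_
    rw [nrm_inv_mul_mul]
    have h1 := nrm_pw_le' hM ((fr h).ρ 2) (-e)
    have h2 := nrm_root_cork hM (h * pw ((fr h).ρ 2) (-e)) c (D.φ e) s
    omega

theorem nrm_root_act (hM : D.M ≠ 0) (x : Pt D) (t : ZMod D.n) :
    nrm ((root x.1)⁻¹ * root (act t 1 x).1) ≤ 5 * D.M := by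
  have aux : ∀ (h h' : S D) (x y : Cell D) (A B C : ℕ), nrm (h⁻¹ * h') ≤ A →
      nrm (h⁻¹ * root x) ≤ B → nrm (h'⁻¹ * root y) ≤ C →
      nrm ((root x)⁻¹ * root y) ≤ A + B + C := by
    intro h h' x y A B C h1 h2 h3
    have h4 := nrm_triangle (root x) h (root y)
    have h5 := nrm_triangle h h' (root y)
    rw [nrm_comm] at h2
    omega
  refine nrm_act_one root _ ?_ ?_ x t
  · rintro c (⟨h, h1, hi⟩ | ⟨b, hc, v⟩) s
    · refine (aux h h _ _ 0 _ _ (by simp) (nrm_root_PD hM _ _ _) (nrm_root_PD hM _ _ _)).trans ?_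
      omega
    · refine (aux b b _ _ 0 _ _ (by simp) (nrm_root_cork hM _ _ _ _)
        (nrm_root_cork hM _ _ _ _)).trans ?_
      omega
  · rintro v c h (⟨_, j, _⟩ | ⟨s, h1, hi, hk, hv⟩ | ⟨_, hc, u, hw⟩) s'
    · simp only [root, nrm_inv_mul_mul]
      exact (nrm_pw_le' hM _ _).trans (by omega)
    · refine (aux _ _ _ _ D.M _ _ ?_ (nrm_root_PD hM _ _ _) (nrm_root_PD hM _ _ _)).trans ?_
      · rw [nrm_inv_mul_mul]; exact nrm_pw_le' hM _ _
      · omega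
    · refine (aux _ _ _ _ D.M _ _ ?_ (nrm_root_cork hM _ _ _ _)
        (nrm_root_cork hM _ _ _ _)).trans ?_
      · rw [nrm_inv_mul_mul]; exact nrm_pw_le' hM _ _
      · omega

section Infinite

/-- The integer representing an exponent. -/
def iz (z : ZMod D.M) : ℤ := z.cast

/-- An integral power of a generator. -/
noncomputable def X (v : ZMod D.m) (k : ℤ) : S D := gen _ _ v ^ k

theorem pw_eq_X (v : ZMod D.m) (z : ZMod D.M) : (pw v z : S D) = X v (iz z) := rfl

theorem X_add (v : ZMod D.m) (a b : ℤ) : (X v (a + b) : S D) = X v a * X v b := zpow_add _ _ _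

@[simp] theorem X_zero (v : ZMod D.m) : (X v 0 : S D) = 1 := zpow_zero _

theorem nrm_X_le (v : ZMod D.m) (a : ℤ) : nrm (X v a : S D) ≤ a.natAbs := by
  rw [X, ← pw_intCast]
  exact nrm_pw_intCast_le v a

theorem nrm_X_X_le (v : ZMod D.m) (a b : ℤ) : nrm ((X v a)⁻¹ * X v b : S D) ≤ (b - a).natAbs := by
  rw [X, X, ← zpow_neg, ← zpow_add, neg_add_eq_sub]
  exact nrm_X_le v _

theorem iz_add (hM : D.M = 0) (a b : ZMod D.M) : iz (a + b) = iz a + iz b := by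
  have : CharP ℤ D.M := hM ▸ (inferInstance : CharP ℤ 0)
  exact ZMod.cast_add' a b

theorem iz_sub (hM : D.M = 0) (a b : ZMod D.M) : iz (a - b) = iz a - iz b := by
  have := iz_add hM (a - b) b
  rw [sub_add_cancel] at this
  omega

theorem iz_zero : iz (0 : ZMod D.M) = 0 := ZMod.cast_zero

/-- The integer `z` moved towards `0` by `r`. -/
def tr (z : ℤ) (r : ℕ) : ℤ := if 0 ≤ z then z - r else z + r

/-- One integer is obtained from another by a unit move away from `0`. -/
def Grow (w w' : ℤ) : Prop := 0 ≤ w ∧ w' = w + 1 ∨ w ≤ 0 ∧ w' = w - 1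

/-- The element obtained by backtracking along a stack. -/
noncomputable def bk : Stk D → ℤ → ℕ → S D
  | [], _, _ => 1
  | (v, z) :: l, w, t =>
    if w.natAbs - t ≤ (iz z).natAbs then X v (tr (iz z) (w.natAbs - t) - iz z)
    else X v (-iz z) * match (frame l).chord v with
      | some c => X ((frame l).ρ (D.clab (swap c))) (tr w (t + (iz z).natAbs))
      | none => bk l w (t + (iz z).natAbs)

theorem bk_le {v : ZMod D.m} {z : ZMod D.M} {l : Stk D} {w : ℤ} {t : ℕ}
    (h : w.natAbs - t ≤ (iz z).natAbs) :
    bk ((v, z) :: l) w t = X v (tr (iz z) (w.natAbs - t) - iz z) := by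
  rw [bk, if_pos h]

theorem bk_lt_some {v : ZMod D.m} {z : ZMod D.M} {l : Stk D} {w : ℤ} {t : ℕ} {c : Chord}
    (h : (iz z).natAbs < w.natAbs - t) (hc : (frame l).chord v = some c) :
    bk ((v, z) :: l) w t =
      X v (-iz z) * X ((frame l).ρ (D.clab (swap c))) (tr w (t + (iz z).natAbs)) := by
  rw [bk, if_neg h.not_ge, hc]

theorem bk_lt_none {v : ZMod D.m} {z : ZMod D.M} {l : Stk D} {w : ℤ} {t : ℕ}
    (h : (iz z).natAbs < w.natAbs - t) (hc : (frame l).chord v = none) :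
    bk ((v, z) :: l) w t = X v (-iz z) * bk l w (t + (iz z).natAbs) := by
  rw [bk, if_neg h.not_ge, hc]

theorem nrm_bk_le (L : Stk D) (w : ℤ) (t : ℕ) (ht : t ≤ w.natAbs) :
    nrm (bk L w t) ≤ w.natAbs - t := by
  induction L generalizing t with
  | nil => simp [bk]
  | cons x l ih =>
    obtain ⟨v, z⟩ := x
    by_cases h : w.natAbs - t ≤ (iz z).natAbs
    · rw [bk_le h]
      refine (nrm_X_le _ _).trans ?_
      unfold tr
      split_ifs <;> omega
    · have h1 := nrm_X_le v (-iz z)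
      rcases hc : (frame l).chord v with _ | c
      · rw [bk_lt_none (by omega) hc]
        refine (nrm_mul_le _ _).trans ?_
        have := ih (t + (iz z).natAbs) (by omega)
        omega
      · rw [bk_lt_some (by omega) hc]
        refine (nrm_mul_le _ _).trans ?_
        have := nrm_X_le ((frame l).ρ (D.clab (swap c))) (tr w (t + (iz z).natAbs))
        have h2 : (tr w (t + (iz z).natAbs)).natAbs = w.natAbs - (t + (iz z).natAbs) := by
          unfold tr
          split_ifs <;> omega
        omega

theorem bk_eq_one {L : Stk D} {w : ℤ} {t : ℕ} (ht : w.natAbs = t) : bk L w t = 1 := by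
  cases L with
  | nil => rfl
  | cons x l =>
    obtain ⟨v, z⟩ := x
    rw [bk_le (by omega), ht]
    simp [tr]

theorem nrm_bk_grow (L : Stk D) {w w' : ℤ} (hw : Grow w w') (t : ℕ) (ht : t ≤ w.natAbs) :
    nrm ((bk L w t)⁻¹ * bk L w' t) ≤ 1 := by
  have hg : w'.natAbs = w.natAbs + 1 := by unfold Grow at hw; omega
  induction L generalizing t with
  | nil => simp [bk]
  | cons x l ih =>
    obtain ⟨v, z⟩ := x
    by_cases h : w'.natAbs - t ≤ (iz z).natAbs
    · rw [bk_le h, bk_le (by omega)]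
      refine (nrm_X_X_le _ _ _).trans ?_
      unfold tr
      split_ifs <;> omega
    · by_cases h' : w.natAbs - t ≤ (iz z).natAbs
      · have h1 : X v (tr (iz z) (w.natAbs - t) - iz z) = (X v (-iz z) * 1 : S D) := by
          rw [mul_one]
          congr 1
          unfold tr
          split_ifs <;> omega
        rw [bk_le h', h1]
        rcases hc : (frame l).chord v with _ | c
        · rw [bk_lt_none (by omega) hc, nrm_mul_left_cancel, inv_one, one_mul]
          refine (nrm_bk_le _ _ _ (by omega)).trans (by omega)
        · rw [bk_lt_some (by omega) hc, nrm_mul_left_cancel, inv_one, one_mul]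
          refine (nrm_X_le _ _).trans ?_
          unfold tr
          split_ifs <;> omega
      · rcases hc : (frame l).chord v with _ | c
        · rw [bk_lt_none (by omega) hc, bk_lt_none (by omega) hc, nrm_mul_left_cancel]
          exact ih _ (by omega)
        · rw [bk_lt_some (by omega) hc, bk_lt_some (by omega) hc, nrm_mul_left_cancel]
          refine (nrm_X_X_le _ _ _).trans ?_
          unfold tr
          unfold Grow at hw
          split_ifs <;> omega

theorem nrm_bk_succ (L : Stk D) (w : ℤ) (t : ℕ) (ht : t + 1 ≤ w.natAbs) :
    nrm ((bk L w t)⁻¹ * bk L w (t + 1)) ≤ 1 := by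
  induction L generalizing t with
  | nil => simp [bk]
  | cons x l ih =>
    obtain ⟨v, z⟩ := x
    by_cases h : w.natAbs - t ≤ (iz z).natAbs
    · rw [bk_le h, bk_le (by omega)]
      refine (nrm_X_X_le _ _ _).trans ?_
      unfold tr
      split_ifs <;> omega
    · by_cases h' : w.natAbs - (t + 1) ≤ (iz z).natAbs
      · have h1 : X v (tr (iz z) (w.natAbs - (t + 1)) - iz z) = (X v (-iz z) * 1 : S D) := by
          rw [mul_one]
          congr 1
          unfold tr
          split_ifs <;> omega
        rw [bk_le h', h1]
        rcases hc : (frame l).chord v with _ | c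
        · rw [bk_lt_none (by omega) hc, nrm_mul_left_cancel, mul_one, nrm_inv]
          refine (nrm_bk_le _ _ _ (by omega)).trans (by omega)
        · rw [bk_lt_some (by omega) hc, nrm_mul_left_cancel, mul_one, nrm_inv]
          refine (nrm_X_le _ _).trans ?_
          unfold tr
          split_ifs <;> omega
      · rcases hc : (frame l).chord v with _ | c
        · rw [bk_lt_none (by omega) hc, bk_lt_none (by omega) hc, nrm_mul_left_cancel,
            add_right_comm]
          exact ih _ (by omega)
        · rw [bk_lt_some (by omega) hc, bk_lt_some (by omega) hc, nrm_mul_left_cancel]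
          refine (nrm_X_X_le _ _ _).trans ?_
          unfold tr
          split_ifs <;> omega

theorem X_mul_bk_push {v : ZMod D.m} {l : Stk D} (hc : (frame l).chord v = none)
    (e : ZMod D.M) (w : ℤ) : X v (iz e) * bk (push v e l) w 0 =
      if w.natAbs ≤ (iz e).natAbs then X v (tr (iz e) w.natAbs) else bk l w (iz e).natAbs := by
  unfold push
  by_cases he : e = 0
  · subst he
    rw [if_pos rfl, iz_zero, X_zero, one_mul]
    split_ifs with h
    · rw [bk_eq_one (by simpa using h)]
      have : w = 0 := by simpa using h
      simp [this, tr]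
    · rfl
  · rw [if_neg he]
    split_ifs with h
    · rw [bk_le (by omega), ← X_add]
      simp
    · rw [bk_lt_none (by omega) hc, ← mul_assoc, ← X_add]
      simp

theorem nrm_bk_push {v : ZMod D.m} {l : Stk D} (hc : (frame l).chord v = none)
    {e e' : ZMod D.M} (he : Grow (iz e) (iz e')) (w : ℤ) :
    nrm ((X v (iz e) * bk (push v e l) w 0)⁻¹ * (X v (iz e') * bk (push v e' l) w 0)) ≤ 1 := by
  have hg : (iz e').natAbs = (iz e).natAbs + 1 := by unfold Grow at he; omega
  rw [X_mul_bk_push hc, X_mul_bk_push hc]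
  split_ifs with h1 h2
  · refine (nrm_X_X_le _ _ _).trans ?_
    unfold Grow at he
    unfold tr
    split_ifs <;> omega
  · omega
  · have : tr (iz e') w.natAbs = 0 := by
      unfold tr
      split_ifs <;> omega
    rw [this, X_zero, mul_one, nrm_inv]
    exact (nrm_bk_le _ _ _ (by omega)).trans (by omega)
  · rw [hg]
    exact nrm_bk_succ _ _ _ (by omega)

/-- The element opposite to a block. -/
noncomputable def Q (b : S D) (c : Chord) (u v : ℤ) : S D :=
  if v.natAbs ≤ u.natAbs then X (cl b c) (tr u v.natAbs) else X (cl b (swap c)) (tr v u.natAbs)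

theorem Q_swap (b : S D) (c : Chord) (u v : ℤ) : Q b (swap c) u v = Q b c v u := by
  unfold Q
  rcases lt_trichotomy u.natAbs v.natAbs with h | h | h
  · rw [if_neg (by omega), if_pos (by omega), swap_swap]
  · have h1 : tr u v.natAbs = 0 := by unfold tr; split_ifs <;> omega
    have h2 : tr v u.natAbs = 0 := by unfold tr; split_ifs <;> omega
    rw [if_pos (by omega), if_pos (by omega), h1, h2, X_zero, X_zero]
  · rw [if_pos (by omega), if_neg (by omega)]

theorem nrm_Q_grow (b : S D) (c : Chord) {u u' : ℤ} (hu : Grow u u') (v : ℤ) :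
    nrm ((Q b c u v)⁻¹ * Q b c u' v) ≤ 1 := by
  have hg : u'.natAbs = u.natAbs + 1 := by unfold Grow at hu; omega
  unfold Q
  split_ifs with h1 h2 h2
  · refine (nrm_X_X_le _ _ _).trans ?_
    unfold Grow at hu
    unfold tr
    split_ifs <;> omega
  · omega
  · have : tr u' v.natAbs = 0 := by unfold tr; split_ifs <;> omega
    rw [this, X_zero, mul_one, nrm_inv]
    refine (nrm_X_le _ _).trans ?_
    unfold tr
    split_ifs <;> omega
  · refine (nrm_X_X_le _ _ _).trans ?_
    unfold tr
    split_ifs <;> omega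

/-- The retraction on chambers. -/
noncomputable def val : Cell D → S D
  | gon h _ => h
  | pd h i s => if i = 1 then h * bk (st h) (iz (D.ψ s)) 0 else h
  | dum b i u v => b * Q b (i, false) (iz (D.ψ u)) (iz (D.ψ v))

theorem ψ_of_isBit (hq : D.q ≠ 0) {u : ZMod D.N} (hu : IsBit u) : D.ψ u = 0 := by
  rcases hu with rfl | rfl
  exacts [ψ_zero, D.ψ_one hq]

theorem val_cork (b : S D) {c : Chord} (hc : D.IsChord c) (u v : ZMod D.N) :
    val (cork b c u v) = b * Q b c (iz (D.ψ u)) (iz (D.ψ v)) := by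
  have hq := q_ne_zero hc
  have hdum : val (if c.2 then dum b c.1 v u else dum b c.1 u v) =
      b * Q b c (iz (D.ψ u)) (iz (D.ψ v)) := by
    obtain ⟨i, x⟩ := c
    cases x
    · rfl
    · simp only [if_true, val]
      rw [← Q_swap]
      rfl
  unfold cork
  by_cases hu : IsBit u <;> by_cases hv : IsBit v
  · simp only [if_pos hu, if_pos hv]
    split_ifs with h <;> rw [ψ_of_isBit hq hu, ψ_of_isBit hq hv, iz_zero] <;>
      simp [val, Q, tr, ψ_of_isBit hq hu, ψ_of_isBit hq hv, iz_zero]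
  · rw [if_pos hu, if_neg hv, ψ_of_isBit hq hu, iz_zero]
    simp only [val, pw_eq_X, Q]
    split_ifs with h
    · have h1 : iz (D.ψ v) = 0 := by simpa using h
      simp [h1, tr]
    · simp [tr]
  · rw [if_neg hu, if_pos hv, ψ_of_isBit hq hv, iz_zero]
    simp [val, pw_eq_X, Q, tr]
  · rw [if_neg hu, if_neg hv, hdum]

theorem st_cross (b : S D) {c : Chord} (hc : D.IsChord c) {e : ZMod D.M} (he : e ≠ 0) :
    st (b * pw (cl b c) e) = (cl b c, e) :: st b := by
  have h1 : (fr b).chord (cl b c) = some c := (Frame.chord_eq_some _).2 ⟨hc, rfl⟩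
  have h2 := k1_eq_some.1 (k1_of_chord h1)
  rw [st_mul_pw, step, if_pos (by exact Frame.act_of_chord _ h1), base_eq_of_expo (good_st b) h2.2, h2.2,
    zero_add, push, if_neg he]

theorem val_PD_one (hψ : D.ψ 1 = 0) (h : S D) (s : ZMod D.N) :
    val (PD h 1 s) = h * bk (st h) (iz (D.ψ s)) 0 := by
  rcases hk : k1 h ((fr h).ρ 2) with _ | ⟨c, e⟩
  · unfold PD
    split_ifs with h0 h1
    · rw [h0, ψ_zero, iz_zero, bk_eq_one (by simp), mul_one, val]
    · rw [h1, hψ, iz_zero, bk_eq_one (by simp), mul_one, val]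
    · simp only [if_true, hk, val]
    · contradiction
  · obtain ⟨he, hc, hb⟩ := exists_cross hk
    generalize h * pw ((fr h).ρ 2) (-e) = b at hb
    subst hb
    have h1 : (frame (st b)).chord (cl b c) = some c := (Frame.chord_eq_some _).2 ⟨hc, rfl⟩
    rw [PD_cross b hc he, val_cork b hc, D.ψφ, st_cross b hc he, mul_assoc, pw_eq_X, Q]
    congr 1
    split_ifs with h2
    · rw [bk_le h2, ← X_add]
      simp
    · rw [bk_lt_some (not_le.1 h2) h1, ← mul_assoc, ← X_add]
      simp [cl, fr]

theorem val_PD (h : S D) {i : ℕ} (hi : i ≠ 1) (s : ZMod D.N) : val (PD h i s) = h := by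
  unfold PD
  split_ifs <;> simp [val, hi]

theorem nrm_val_PD_mul (hM : D.M = 0) (hψ : D.ψ 1 = 0) {h : S D} {v : ZMod D.m}
    (hk : k1 h v = none) (ha : (fr h).Act v) {d : ZMod D.M} (hd : iz d = 1) (s : ZMod D.N) :
    nrm ((val (PD h 1 s))⁻¹ * val (PD (h * pw v d) 1 s)) ≤ 1 := by
  have hb := base_base (good_st h) v
  have hc : (frame (base v (st h))).chord v = none := by
    simpa only [k1, Option.map_eq_none_iff] using hk
  obtain ⟨e, l, hl, hs⟩ : ∃ e l, (frame l).chord v = none ∧ ∀ d, st (h * pw v d) = push v (e + d) l :=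
    ⟨_, _, hc, fun d => by rw [st_mul_pw, step, if_pos (by exact ha)]⟩
  have h0 := hs 0
  rw [pw_zero, mul_one, add_zero] at h0
  have he : h = h * X v (-iz e) * X v (iz e) := by rw [mul_assoc, ← X_add]; simp
  have he' : h * pw v d = h * X v (-iz e) * X v (iz (e + d)) := by
    rw [mul_assoc, ← X_add, iz_add hM, neg_add_cancel_left, pw_eq_X]
  have hi := iz_add hM e d
  rw [val_PD_one hψ, val_PD_one hψ, hs, h0, he']
  nth_rewrite 1 [he]
  rw [mul_assoc (h * X v (-iz e)), mul_assoc (h * X v (-iz e)), nrm_mul_left_cancel]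
  rcases le_or_gt 0 (iz e) with h1 | h1
  · exact nrm_bk_push hl (Or.inl ⟨h1, by omega⟩) _
  · rw [nrm_comm]
    exact nrm_bk_push hl (Or.inr ⟨by omega, by omega⟩) _

theorem val_cork_mul (b : S D) {c : Chord} (hc : D.IsChord c) {u w : ZMod D.N} (hw : IsBit w)
    (d : ZMod D.M) : val (cork (b * pw (((fr b).nxt c).ρ (2 * bit w + 1)) d) c u w) =
      val (cork b c u w) * pw (((fr b).nxt c).ρ (2 * bit w + 1)) d := by
  have ha := adj_cl b (c := c) hw
  have hst := st_mul_of_adj ha (act_cl b hc) d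
  generalize ((fr b).nxt c).ρ (2 * bit w + 1) = v at *
  have hcl : cl (b * pw v d) c = cl b c := by rw [cl, cl, fr_congr hst]
  have hQ : ∀ b' : S D, Q b' c (iz (D.ψ u)) 0 = X (cl b' c) (iz (D.ψ u)) := by simp [Q, tr]
  rw [val_cork _ hc, val_cork _ hc, ψ_of_isBit (q_ne_zero hc) hw, iz_zero, hQ, hQ, hcl,
    mul_assoc, mul_assoc, ← pw_eq_X, (pw_comm ha _ _).eq]

theorem nrm_val_act (hM : D.M = 0) (hψ : D.ψ 1 = 0)
    (hψ' : ∀ s, iz (D.ψ (s + 1) - D.ψ s) = 0 ∨ iz (D.ψ (s + 1) - D.ψ s) = 1) (x : Pt D)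
    (t : ZMod D.n) : nrm ((val x.1)⁻¹ * val (act t 1 x).1) ≤ 1 := by
  have hgrow : ∀ s, D.ψ (s + 1) = D.ψ s ∨ Grow (iz (D.ψ s)) (iz (D.ψ (s + 1))) ∨
      Grow (iz (D.ψ (s + 1))) (iz (D.ψ s)) := by
    intro s
    rcases hψ' s with h | h
    · left
      have := ZMod.intCast_zmod_cast (D.ψ (s + 1) - D.ψ s)
      rw [iz] at h
      rw [h, Int.cast_zero] at this
      exact (sub_eq_zero.1 this.symm)
    · right
      rw [iz_sub hM] at h
      unfold Grow
      omega
  refine nrm_act_one val _ ?_ ?_ x t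
  · rintro c (⟨h, h1, hi⟩ | ⟨b, hc, v⟩) s
    · by_cases h2 : ‹ℕ› = 1
      · subst h2
        rw [val_PD_one hψ, val_PD_one hψ, nrm_mul_left_cancel]
        rcases hgrow s with h | h | h
        · simp [h]
        · exact nrm_bk_grow _ h _ (by simp)
        · rw [nrm_comm]; exact nrm_bk_grow _ h _ (by simp)
      · simp [val_PD _ h2]
    · simp only [val_cork _ hc, nrm_mul_left_cancel]
      rcases hgrow s with h | h | h
      · simp [h]
      · exact nrm_Q_grow _ _ h _
      · rw [nrm_comm]; exact nrm_Q_grow _ _ h _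
  · rintro v c h (⟨_, j, _⟩ | ⟨s, h1, hi, hk, hv⟩ | ⟨_, hc, u, hw⟩) s'
    · simp only [val, nrm_inv_mul_mul]
      rw [pw_eq_X]
      refine (nrm_X_le _ _).trans ?_
      rcases hψ' s' with h | h <;> simp [h]
    · by_cases h2 : ‹ℕ› = 1
      · subst h2
        rcases hψ' s' with h3 | h3
        · rw [pw_eq_X, h3, X_zero, mul_one]; simp
        · exact nrm_val_PD_mul hM hψ hk (hv rfl) h3 s
      · simp only [val_PD _ h2, nrm_inv_mul_mul]
        rw [pw_eq_X]
        refine (nrm_X_le _ _).trans ?_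
        rcases hψ' s' with h | h <;> simp [h]
    · simp only [val_cork_mul h hc hw, nrm_inv_mul_mul]
      rw [pw_eq_X]
      refine (nrm_X_le _ _).trans ?_
      rcases hψ' s' with h | h <;> simp [h]

end Infinite

end Data

end GraphProdQIE

namespace GraphProdQIE

namespace Data

variable {D : Data}

open Cell

theorem lab_inj {i j l l' : ℕ} (hij : i ≤ j) (hj : j ≤ D.k) (hl : l < D.n) (hl' : l' < D.n)
    (hI : IsLab D i l) (hI' : IsLab D j l') (h : D.lab i l = D.lab j l') :
    i = j ∧ l = l' ∨ j = i + 1 ∧ j ≤ D.p ∧ (l = 2 ∧ l' = 0 ∨ l = 4 ∧ l' + 2 = D.n) := by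
  have hn := D.n_eq
  have hpk := p_le_k (D := D)
  have hβ := D.β_le hj le_rfl
  have hβi := D.β_le (hij.trans hj) le_rfl
  rw [D.β_k] at hβ hβi
  obtain ⟨a3, an, a2, a0⟩ := hI
  obtain ⟨b3, bn, b2, b0⟩ := hI'
  rcases hij.eq_or_lt with rfl | hlt
  · left
    unfold lab at h
    split_ifs at h <;> omega
  · right
    have h1 := D.β_lt hlt hj
    unfold lab at h
    rcases Nat.lt_or_ge i D.p with hip | hip
    · have h2 := D.β_p hip
      have h3 : i + 1 ≤ j := hlt
      rcases h3.eq_or_lt with h3 | h3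
      · subst h3
        split_ifs at h <;> omega
      · have h4 := D.β_lt h3 hj
        split_ifs at h <;> omega
    · have h2 := D.β_lt_q hip hlt hj
      split_ifs at h <;> omega

/-- Every label that is not a chord is the label of a side, and the next side has the next label
unless that one is a chord. -/
theorem exists_lab {x : ℕ} (hx : x < D.m) (hc : ∀ c, D.IsChord c → x ≠ D.clab c) :
    ∃ j l, j ≤ D.k ∧ l < D.n ∧ IsLab D j l ∧ D.lab j l = x ∧
      (x + 1 < D.m → (∀ c, D.IsChord c → x + 1 ≠ D.clab c) →
        l + 1 < D.n ∧ IsLab D j (l + 1) ∧ D.lab j (l + 1) = x + 1) := by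
  have hn := D.n_eq
  have hm := D.m_eq
  have hpk := p_le_k (D := D)
  have hβ := D.β_k
  have hclab : ∀ i, D.p < i → i ≤ D.k → x ≠ 2 * i ∧ x ≠ D.β (i - 1) + 3 := fun i h1 h2 =>
    ⟨by simpa [clab] using hc (i, false) ⟨h1, h2⟩, by simpa [clab] using hc (i, true) ⟨h1, h2⟩⟩
  rcases Nat.lt_or_ge x (2 * D.k + 2) with h1 | h1
  · obtain ⟨j, hj | hj⟩ := x.even_or_odd'
    · have hjp : j ≤ D.p := by
        by_contra h
        exact (hclab j (by omega) (by omega)).1 hj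
      refine ⟨j, 0, by omega, by omega, isLab_zero hjp, by simp [lab, hj], fun _ _ => ?_⟩
      exact ⟨by omega, isLab_one j, by simp [lab, hj]⟩
    · refine ⟨j, 1, by omega, by omega, isLab_one j, by simp [lab, hj], fun _ h2 => ?_⟩
      refine ⟨by omega, ⟨by omega, by omega, fun _ => ?_, by omega⟩, by simp [lab, hj]⟩
      by_contra h
      refine h2 (j + 1, false) ⟨by simp only; omega, by simp only; omega⟩ ?_
      simp only [clab, Bool.false_eq_true, if_false]; omega
  rcases Nat.lt_or_ge x (2 * D.k + 3) with h2 | h2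
  · refine ⟨D.k, 2, le_rfl, by omega, ⟨by omega, by omega, by omega, by omega⟩,
      by simp [lab]; omega, fun _ _ => ?_⟩
    exact ⟨by omega, ⟨by omega, by omega, by omega, by omega⟩, by simp [lab]; omega⟩
  rcases Nat.lt_or_ge x (2 * D.k + 4) with h3 | h3
  · refine ⟨D.k, 3, le_rfl, by omega, ⟨by omega, by omega, by omega, by omega⟩,
      by simp [lab]; omega, fun _ _ => ?_⟩
    exact ⟨by omega, isLab_mid _ (by omega) (by omega), by simp [lab]; omega⟩
  have hex : ∃ j, D.β j + 4 ≤ x := ⟨D.k, by omega⟩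
  classical
  set j := Nat.find hex with hjdef
  have hjx : D.β j + 4 ≤ x := Nat.find_spec hex
  have hjk : j ≤ D.k := Nat.find_min' hex (by omega)
  have hlab : ∀ l, 3 ≤ l → D.lab j l = D.β j + l := fun l hl => by
    rw [lab, if_neg (by omega)]
  rcases Nat.eq_zero_or_pos j with h0 | h0
  · rw [h0] at hjx hlab hjk
    refine ⟨0, x - D.β 0, hjk, by omega, ⟨by omega, by omega, by omega, by omega⟩, ?_, fun h4 _ => ?_⟩
    · rw [hlab _ (by omega)]; omega
    · exact ⟨by omega, ⟨by omega, by omega, by omega, by omega⟩, by rw [hlab _ (by omega)]; omega⟩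
  · have hmin : ¬ D.β (j - 1) + 4 ≤ x := Nat.find_min hex (by omega)
    rcases Nat.lt_or_ge D.p j with hjp | hjp
    · have h4 := D.β_q (j := j - 1) (by omega) (by omega)
      rw [Nat.sub_add_cancel h0] at h4
      have h5 := (hclab j hjp hjk).2
      refine ⟨j, x - D.β j, hjk, by omega, isLab_mid _ (by omega) (by omega), ?_, fun _ h6 => ?_⟩
      · rw [hlab _ (by omega)]; omega
      · have h7 := h6 (j, true) ⟨hjp, hjk⟩
        simp only [clab, if_true] at h7
        exact ⟨by omega, isLab_mid _ (by omega) (by omega), by rw [hlab _ (by omega)]; omega⟩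
    · have h4 := D.β_p (j := j - 1) (by omega)
      rw [Nat.sub_add_cancel h0] at h4
      refine ⟨j, x - D.β j, hjk, by omega, isLab_mid _ (by omega) (by omega), ?_, fun _ h6 => ?_⟩
      · rw [hlab _ (by omega)]; omega
      · exact ⟨by omega, isLab_mid _ (by omega) (by omega), by rw [hlab _ (by omega)]; omega⟩

/-- A power of a generator of the small group. -/
noncomputable abbrev gp (t : ZMod D.n) (s : ZMod D.N) : G D := pw t s

theorem adj_ty (F : Frame D) (j : ℕ) (l : ℤ) :
    (cycleGraph D.n).Adj (F.ty j l) (F.ty j (l + 1)) :=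
  Aff.adj_succ _ (by have := D.n_eq; omega) l

/-- The element of the small group that leads to the `j`-th small cycle. -/
noncomputable def dF (F : Frame D) : ℕ → G D
  | 0 => 1
  | j + 1 => dF F j * (if j < D.p then gp (F.ty j 3) 1 else gp (F.ty j 2) 1 * gp (F.ty j 3) 1)

/-- The conjugate of a power of a generator by which a side of a small cycle acts. -/
noncomputable def sideElt (F : Frame D) (j l : ℕ) (s : ZMod D.N) : G D :=
  dF F j * gp (F.ty j l) s * (dF F j)⁻¹

theorem sideElt_succ (F : Frame D) {j l l' : ℕ} (hj : j < D.p) (hl : l = 2 ∨ l = 4)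
    (ht : F.ty (j + 1) l' = F.ty j l) (s : ZMod D.N) :
    sideElt F (j + 1) l' s = sideElt F j l s := by
  have hc : Commute (gp (F.ty j 3) 1) (gp (F.ty j l) s) := by
    rcases hl with rfl | rfl
    · exact pw_comm (adj_ty F j 2).symm _ _
    · exact pw_comm (adj_ty F j 3) _ _
  simp only [sideElt, dF, if_pos hj, ht, mul_inv_rev]
  rw [mul_assoc (dF F j), hc.eq]
  group

/-- A side at a vertex. -/
def IsSite (F : Frame D) (v : ZMod D.m) (x : ℕ × ℕ) : Prop :=
  x.1 ≤ D.k ∧ x.2 < D.n ∧ IsLab D x.1 x.2 ∧ F.ρ (D.lab x.1 x.2) = v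

theorem site_unique {F : Frame D} {v : ZMod D.m} {x y : ℕ × ℕ} (hx : IsSite F v x)
    (hy : IsSite F v y) : F.ty x.1 x.2 = F.ty y.1 y.2 ∧
      ∀ s, sideElt F x.1 x.2 s = sideElt F y.1 y.2 s := by
  have hn := D.n_eq
  wlog hij : x.1 ≤ y.1 generalizing x y
  · have := this hy hx (by omega)
    exact ⟨this.1.symm, fun s => (this.2 s).symm⟩
  obtain ⟨i, l⟩ := x
  obtain ⟨j, l'⟩ := y
  obtain ⟨h1, h2, h3, h4⟩ := hx
  obtain ⟨g1, g2, g3, g4⟩ := hy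
  simp only at *
  have hlab := (Aff.apply_inj F.ρ (D.lab_lt h1 h2) (D.lab_lt g1 g2)).1 (h4.trans g4.symm)
  rcases lab_inj hij g1 h2 g2 h3 g3 hlab with ⟨rfl, rfl⟩ | ⟨rfl, hp, h⟩
  · exact ⟨rfl, fun _ => rfl⟩
  · have ht : F.ty (i + 1) l' = F.ty i l := by
      rw [Frame.ty_succ]
      rcases h with ⟨rfl, rfl⟩ | ⟨rfl, h⟩
      · simp
      · rw [← F.ty_add_n i (2 - l')]
        congr 1
        omega
    exact ⟨ht.symm, fun s => (sideElt_succ F (by omega) (by omega) ht s).symm⟩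

theorem exists_site {F : Frame D} {v : ZMod D.m} (hv : F.chord v = none) :
    ∃ x, IsSite F v x := by
  have hx := F.ρ.apply_inv v
  obtain ⟨j, l, h1, h2, h3, h4, -⟩ := exists_lab (F.ρ.inv_lt v) (fun c hc h => by
    have : F.chord v = some c := F.chord_eq_some.2 ⟨hc, by rw [← h, hx]⟩
    rw [hv] at this
    cases this)
  exact ⟨(j, l), h1, h2, h3, by rw [h4, hx]⟩

open Classical in
/-- A chosen side at a vertex. -/
noncomputable def site (F : Frame D) (v : ZMod D.m) : ℕ × ℕ :=
  if h : ∃ x, IsSite F v x then h.choose else (0, 0)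

theorem site_spec {F : Frame D} {v : ZMod D.m} (h : ∃ x, IsSite F v x) :
    IsSite F v (site F v) := by
  rw [site, dif_pos h]
  exact h.choose_spec

/-- The type of a vertex. -/
noncomputable def vty (F : Frame D) (v : ZMod D.m) : ZMod D.n := F.ty (site F v).1 (site F v).2

/-- The element of the small group by which a vertex acts. -/
noncomputable def vElt (F : Frame D) (v : ZMod D.m) (s : ZMod D.N) : G D :=
  sideElt F (site F v).1 (site F v).2 s

theorem vty_eq {F : Frame D} {v : ZMod D.m} {x : ℕ × ℕ} (h : IsSite F v x) :
    vty F v = F.ty x.1 x.2 := (site_unique (site_spec ⟨x, h⟩) h).1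

theorem vElt_eq {F : Frame D} {v : ZMod D.m} {x : ℕ × ℕ} (h : IsSite F v x) (s : ZMod D.N) :
    vElt F v s = sideElt F x.1 x.2 s := (site_unique (site_spec ⟨x, h⟩) h).2 s

@[simp] theorem vElt_zero (F : Frame D) (v : ZMod D.m) : vElt F v 0 = 1 := by
  simp [vElt, sideElt]

theorem sideElt_add (F : Frame D) (j l : ℕ) (s s' : ZMod D.N) :
    sideElt F j l (s + s') = sideElt F j l s * sideElt F j l s' := by
  simp only [sideElt, gp, pw_add]; group

theorem vElt_add (F : Frame D) (v : ZMod D.m) (s s' : ZMod D.N) :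
    vElt F v (s + s') = vElt F v s * vElt F v s' := sideElt_add _ _ _ _ _

theorem sideElt_comm (F : Frame D) (j : ℕ) {l l' : ℕ}
    (h : (cycleGraph D.n).Adj (F.ty j l) (F.ty j l')) (s s' : ZMod D.N) :
    Commute (sideElt F j l s) (sideElt F j l' s') :=
  (Commute.conj_iff (dF F j)).2 (pw_comm (K := fun _ => D.N) h s s')

theorem corner_aux {F : Frame D} {x : ℕ} (hx : x < D.m) {v w : ZMod D.m} (hxv : F.ρ x = v)
    (hxw : F.ρ (x + 1) = w) (hv : F.chord v = none) (hw : F.chord w = none) :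
    vty F v ≠ vty F w ∧ ∀ s s', Commute (vElt F v s) (vElt F w s') := by
  have hn := D.n_eq
  have hm := D.m_eq
  obtain ⟨j, l, l', h1, h2, h3, had⟩ : ∃ j l l', IsSite F v (j, l) ∧ IsSite F w (j, l') ∧
      F.ty j (l + 1) = F.ty j l' ∧ True := by
    have hnc : ∀ c, D.IsChord c → x ≠ D.clab c := fun c hc h => by
      have : F.chord v = some c := F.chord_eq_some.2 ⟨hc, by rw [← h, hxv]⟩
      rw [hv] at this
      cases this
    rcases Nat.lt_or_ge (x + 1) D.m with h1 | h1
    · obtain ⟨j, l, g1, g2, g3, g4, g5⟩ := exists_lab hx hnc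
      obtain ⟨g6, g7, g8⟩ := g5 h1 (fun c hc h => by
        have : F.chord w = some c := F.chord_eq_some.2 ⟨hc, by rw [← h, ← hxw]; push_cast; rfl⟩
        rw [hw] at this
        cases this)
      exact ⟨j, l, l + 1, ⟨g1, g2, g3, by simp only [g4, hxv]⟩,
        ⟨g1, g6, g7, by simp only [g8, ← hxw]; push_cast; rfl⟩, by push_cast; rfl, trivial⟩
    · obtain ⟨l, hl⟩ : ∃ l, l + 1 = D.n := ⟨D.a + 6, rfl⟩
      have hlx : D.β 0 + l = x := by omega
      refine ⟨0, l, 0, ⟨Nat.zero_le _, by simp only; omega, ?_, ?_⟩,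
        ⟨Nat.zero_le _, by simp only; omega, isLab_zero (Nat.zero_le _), ?_⟩, ?_, trivial⟩
      · exact ⟨fun h => by simp only at h; omega, fun _ => rfl, fun h => by simp only at h; omega,
          fun _ => Nat.zero_le _⟩
      · have : D.lab 0 l = x := by rw [lab, if_neg (by omega), hlx]
        simp only [this, hxv]
      · have hx1 : (x : ℤ) + 1 = ((0 : ℕ) : ℤ) + D.m := by omega
        rw [← hxw, hx1, F.ρ.apply_add]
        rfl
      · have hl1 : (l : ℤ) + 1 = ((0 : ℕ) : ℤ) + D.n := by omega
        rw [hl1, F.ty_add_n]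
  have hadj := adj_ty F j l
  rw [h3] at hadj
  rw [vty_eq h1, vty_eq h2]
  refine ⟨hadj.ne, fun s s' => ?_⟩
  rw [vElt_eq h1, vElt_eq h2]
  exact sideElt_comm F j hadj s s'

theorem adj_ρ {F : Frame D} {v w : ZMod D.m} {x : ℤ} (h : (cycleGraph D.m).Adj v w)
    (hx : F.ρ x = v) : w = F.ρ (x + 1) ∨ w = F.ρ (x - 1) := by
  have hn := D.n_eq
  have hm := D.m_eq
  subst hx
  rw [adj_iff (by omega)] at h
  rcases Int.units_eq_one_or F.ρ.s with hs | hs <;> rcases h with h | h <;>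
    simp only [Aff.pt, hs, Units.val_one, Units.val_neg, one_mul, neg_mul] at h ⊢
  · left; push_cast at *; linear_combination h
  · right; push_cast at *; linear_combination -h
  · right; push_cast at *; linear_combination h
  · left; push_cast at *; linear_combination -h

theorem corner {F : Frame D} {v w : ZMod D.m} (h : (cycleGraph D.m).Adj v w)
    (hv : F.chord v = none) (hw : F.chord w = none) :
    vty F v ≠ vty F w ∧ ∀ s s', Commute (vElt F v s) (vElt F w s') := by
  rcases adj_ρ h (F.ρ.apply_inv v) with h1 | h1
  · exact corner_aux (F.ρ.inv_lt v) (F.ρ.apply_inv v) h1.symm hv hw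
  · rcases adj_ρ h.symm (F.ρ.apply_inv w) with h2 | h2
    · have := corner_aux (F.ρ.inv_lt w) (F.ρ.apply_inv w) h2.symm hw hv
      exact ⟨this.1.symm, fun s s' => (this.2 s' s).symm⟩
    · exfalso
      have h3 : F.ρ ((F.ρ.inv v : ℤ)) = F.ρ (((F.ρ.inv v : ℤ)) - 2) := by
        have h4 := F.ρ.apply_inv v
        have h5 : F.ρ (F.ρ.inv w : ℤ) = F.ρ ((F.ρ.inv v : ℤ) - 1) := by
          rw [F.ρ.apply_inv w, h1]
        rw [Aff.apply_eq_iff] at h5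
        have h6 : F.ρ ((F.ρ.inv w : ℤ) - 1) = F.ρ ((F.ρ.inv v : ℤ) - 2) := by
          rw [Aff.apply_eq_iff]
          convert h5 using 1
          ring
        rw [← h6, ← h2, h4]
      rw [Aff.apply_eq_iff] at h3
      have hm := D.m_eq
      have hn := D.n_eq
      have := Int.le_of_dvd (by norm_num) ((dvd_neg.2 h3).trans (by simp : _ ∣ (2 : ℤ)))
      omega

end Data

end GraphProdQIE

namespace GraphProdQIE

namespace Data

variable {D : Data}

open Cell

/-- The element of the small group that crosses a chord. -/
noncomputable def pos (F : Frame D) (c : Chord) (e : ZMod D.M) : G D :=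
  open Classical in
  if e = 0 then 1 else dF F (c.1 - 1) * gp ((F.nxt c).ty 0 2) (D.φ e)

/-- The frame at a point of a line that crosses a chord. -/
noncomputable def nxtAt (F : Frame D) (c : Chord) (e : ZMod D.M) : Frame D :=
  open Classical in
  if e = 0 then F else F.nxt c

theorem fr_eq_nxtAt {h : S D} {v : ZMod D.m} {c : Chord} {e : ZMod D.M}
    (hk : k1 h v = some (c, e)) : fr h = nxtAt (fr (h * pw v (-e))) c e := by
  unfold nxtAt
  split_ifs with he
  · subst he; simp
  · exact fr_of_k1 hk he

theorem dF_chord (F : Frame D) {c : Chord} (hc : D.IsChord c) :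
    dF F c.1 = dF F (c.1 - 1) * (gp ((F.nxt c).ty 0 2) 1 * gp ((F.nxt c).ty 0 3) 1) := by
  obtain ⟨i, x⟩ := c
  obtain ⟨h1, h2⟩ := hc
  simp only at h1 h2 ⊢
  obtain ⟨j, rfl⟩ := Nat.exists_eq_add_of_le' (show 1 ≤ i by omega)
  rw [dF, if_neg (by omega), Nat.add_sub_cancel]
  congr 1
  cases x
  · simp [Frame.nxt_ty_zero]
  · simp only [Frame.nxt_ty_zero, if_true, Nat.add_sub_cancel]
    rw [show (5 - 2 : ℤ) = 3 by norm_num, show (5 - 3 : ℤ) = 2 by norm_num]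
    exact (pw_comm (K := fun _ => D.N) (adj_ty F j 2) 1 1).eq

theorem sites_chord (F : Frame D) {c : Chord} (hc : D.IsChord c) (b : Bool) :
    ∃ l : ℕ, IsSite F ((F.nxt c).ρ (if b then 3 else 1)) (if b then c.1 else c.1 - 1, l) ∧
      F.ty (if b then c.1 else c.1 - 1) l = (F.nxt c).ty 0 1 ∧
      IsSite (F.nxt c) ((F.nxt c).ρ (if b then 3 else 1)) (if b then 1 else 0, 1) := by
  have hn := D.n_eq
  have hk := one_le_k (D := D)
  obtain ⟨h1, h2⟩ := id hc
  cases b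
  · refine ⟨if c.2 then 4 else 1, ⟨?_, ?_, ?_, ?_⟩, ?_, Nat.zero_le _, ?_, isLab_one _, ?_⟩
    · simp only [Bool.false_eq_true, if_false]; omega
    · simp only; split_ifs <;> omega
    · simp only
      cases c.2
      · exact isLab_one _
      · exact isLab_mid _ (by simp) (by simp)
    · simp only [Bool.false_eq_true, if_false]
      rw [lab_chord_zero hc, Frame.nxt_ρ]
    · rw [Frame.nxt_ty_zero]
      simp only [Bool.false_eq_true, if_false]
      cases c.2 <;> simp
    · simp only; omega
    · simp [lab]
  · refine ⟨if c.2 then D.n - 2 else 1, ⟨?_, ?_, ?_, ?_⟩, ?_, ?_, ?_, isLab_one _, ?_⟩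
    · simpa using h2
    · simp only; split_ifs <;> omega
    · simp only
      cases c.2
      · exact isLab_one _
      · exact isLab_mid _ (by simp only [if_true]; omega) (by simp only [if_true]; omega)
    · simp only [if_true]
      rw [lab_chord_one hc, Frame.nxt_ρ]
    · rw [Frame.nxt_ty_zero, Frame.ty_pred _ (by omega)]
      simp only [if_true]
      cases c.2
      · simp
      · simp only [if_true]
        exact (Frame.ty_neg _ _ (by omega)).symm
    · simpa using hk
    · simp only; omega
    · simp [lab]

theorem vElt_nxtAt (F : Frame D) {c : Chord} (hc : D.IsChord c) {w : ZMod D.m}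
    (hw : (cycleGraph D.m).Adj (F.ρ (D.clab c)) w) (e : ZMod D.M) :
    vty (nxtAt F c e) w = vty F w ∧
      ∀ s, pos F c e * vElt (nxtAt F c e) w s = vElt F w s * pos F c e := by
  by_cases he : e = 0
  · simp [nxtAt, pos, he]
  obtain ⟨b, rfl⟩ : ∃ b : Bool, w = (F.nxt c).ρ (if b then 3 else 1) := by
    rw [← Frame.nxt_ρ_two] at hw
    rcases adj_ρ hw rfl with h | h
    · exact ⟨true, h⟩
    · exact ⟨false, h⟩
  obtain ⟨l, h1, ht, h2⟩ := sites_chord F hc b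
  simp only [nxtAt, pos, if_neg he]
  have hone : (F.nxt c).ty 1 1 = (F.nxt c).ty 0 1 := by rw [Frame.ty_one]; norm_num
  have h32 := pw_comm (K := fun _ => D.N) (adj_ty (F.nxt c) 0 2)
  have h21 := pw_comm (K := fun _ => D.N) (adj_ty (F.nxt c) 0 1)
  norm_num at h32 h21
  rw [vty_eq h1, vty_eq h2]
  refine ⟨?_, fun s => ?_⟩
  · simp only [ht]
    cases b
    · rfl
    · exact hone
  · rw [vElt_eq h1, vElt_eq h2]
    simp only [sideElt, ht, Nat.cast_one]
    cases b
    · simp only [Bool.false_eq_true, if_false, dF, one_mul, inv_one, mul_one]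
      rw [mul_assoc, ← (h21 s (D.φ e)).eq]
      group
    · simp only [if_true, hone]
      rw [dF_chord F hc]
      have hd : dF (F.nxt c) 1 = gp ((F.nxt c).ty 0 3) 1 := by
        simp [dF, Nat.lt_of_lt_of_le Nat.zero_lt_one D.hp]
      rw [hd]
      set y := gp ((F.nxt c).ty 0 3) 1 * gp ((F.nxt c).ty 0 1) s *
        (gp ((F.nxt c).ty 0 3) 1)⁻¹ with hy
      have hcom : ∀ z, Commute (gp ((F.nxt c).ty 0 2) z) y := fun z =>
        ((h32 z 1).mul_right (h21 s z).symm).mul_right (h32 z 1).inv_right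
      have h3 : dF F (c.1 - 1) * (gp ((F.nxt c).ty 0 2) 1 * gp ((F.nxt c).ty 0 3) 1) *
          gp ((F.nxt c).ty 0 1) s *
          (dF F (c.1 - 1) * (gp ((F.nxt c).ty 0 2) 1 * gp ((F.nxt c).ty 0 3) 1))⁻¹ =
          dF F (c.1 - 1) * (gp ((F.nxt c).ty 0 2) 1 * y * (gp ((F.nxt c).ty 0 2) 1)⁻¹) *
            (dF F (c.1 - 1))⁻¹ := by
        rw [hy]; group
      rw [h3, (hcom 1).eq, mul_inv_cancel_right, mul_assoc, (hcom _).eq]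
      group

/-- The triples on which the large group acts. -/
abbrev Tr (D : Data) : Type := G D × S D × (ZMod D.n → ZMod D.M)

/-- The action of the vertex groups of the large group. -/
noncomputable def trAct (v : ZMod D.m) (z : ZMod D.M) (x : Tr D) : Tr D :=
  match k1 x.2.1 v with
  | some (c, e) =>
    (x.1 * ((pos (fr (x.2.1 * pw v (-e))) c e)⁻¹ * pos (fr (x.2.1 * pw v (-e))) c (e + z)),
      x.2.1 * pw v z, x.2.2)
  | none =>
    (x.1 * vElt (fr x.2.1) v
      (D.φ (x.2.2 (vty (fr x.2.1) v) + z) - D.φ (x.2.2 (vty (fr x.2.1) v))),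
      x.2.1 * pw v z,
      Function.update x.2.2 (vty (fr x.2.1) v) (x.2.2 (vty (fr x.2.1) v) + z))

theorem trAct_some {v : ZMod D.m} {h : S D} {c : Chord} {e : ZMod D.M}
    (hk : k1 h v = some (c, e)) (z : ZMod D.M) (γ : G D) (ε : ZMod D.n → ZMod D.M) :
    trAct v z (γ, h, ε) = (γ * ((pos (fr (h * pw v (-e))) c e)⁻¹ *
      pos (fr (h * pw v (-e))) c (e + z)), h * pw v z, ε) := by
  simp only [trAct, hk]

theorem trAct_none {v : ZMod D.m} {h : S D} (hk : k1 h v = none) (z : ZMod D.M) (γ : G D)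
    (ε : ZMod D.n → ZMod D.M) :
    trAct v z (γ, h, ε) = (γ * vElt (fr h) v (D.φ (ε (vty (fr h) v) + z) - D.φ (ε (vty (fr h) v))),
      h * pw v z, Function.update ε (vty (fr h) v) (ε (vty (fr h) v) + z)) := by
  simp only [trAct, hk]

theorem chord_of_k1_none {h : S D} {v : ZMod D.m} (hk : k1 h v = none) : (fr h).chord v = none := by
  rcases hc : (fr h).chord v with _ | c
  · rfl
  · rw [k1_of_chord hc] at hk; cases hk

theorem trAct_comm_none {v w : ZMod D.m} (hvw : (cycleGraph D.m).Adj v w) {h : S D}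
    (hv : k1 h v = none) (hw : k1 h w = none) (y z : ZMod D.M) (γ : G D)
    (ε : ZMod D.n → ZMod D.M) :
    trAct v y (trAct w z (γ, h, ε)) = trAct w z (trAct v y (γ, h, ε)) := by
  rw [trAct_none hv, trAct_none hw, trAct_none (k1_persist hvw hv hw z),
    trAct_none (k1_persist hvw.symm hw hv y), fr_mul_of_none hv, fr_mul_of_none hw]
  obtain ⟨hne, hcom⟩ := corner hvw (chord_of_k1_none hv) (chord_of_k1_none hw)
  simp only [Function.update_of_ne hne, Function.update_of_ne hne.symm]
  rw [Function.update_comm hne]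
  ext1
  · simp only [mul_assoc]
    rw [(hcom _ _).eq]
  · ext1
    · simp only [mul_assoc]
      rw [(pw_comm hvw _ _).eq]
    · rfl

theorem trAct_comm_some {v w : ZMod D.m} (hvw : (cycleGraph D.m).Adj v w) {h : S D} {c : Chord}
    {e : ZMod D.M} (hv : k1 h v = some (c, e)) (y z : ZMod D.M) (γ : G D)
    (ε : ZMod D.n → ZMod D.M) :
    trAct v y (trAct w z (γ, h, ε)) = trAct w z (trAct v y (γ, h, ε)) := by
  have ha := act_of_k1 hv
  have hw := k1_eq_none_of_not_act (Frame.not_act_of_adj _ hvw ha)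
  have hw' := k1_eq_none_of_not_act (Frame.not_act_of_adj _ hvw (act_mul ha y))
  have hv' : k1 (h * pw w z) v = some (c, e) := by rw [k1_congr (st_mul_of_adj hvw ha z), hv]
  have hb : fr (h * pw w z * pw v (-e)) = fr (h * pw v (-e)) := by
    rw [mul_assoc, ← (pw_comm hvw _ _).eq, ← mul_assoc]
    exact fr_congr (st_mul_of_adj hvw (act_mul ha _) z)
  have hf := fr_eq_nxtAt hv
  have hf' := fr_eq_nxtAt (k1_mul hv y)
  have hb' : h * pw v y * pw v (-(e + y)) = h * pw v (-e) := by
    rw [mul_assoc, ← pw_add]; congr 2; ring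
  rw [hb'] at hf'
  have hc := (Frame.chord_eq_some _).1
    (chord_of_k1 (by have := k1_mul hv (-e); rwa [add_neg_cancel] at this))
  rw [trAct_some hv, trAct_none hw, trAct_some hv', trAct_none hw', hb]
  set F := fr (h * pw v (-e)) with hF
  have hadj : (cycleGraph D.m).Adj (F.ρ (D.clab c)) w := by rwa [hc.2]
  obtain ⟨ht, hx⟩ := vElt_nxtAt F hc.1 hadj e
  obtain ⟨ht', hx'⟩ := vElt_nxtAt F hc.1 hadj (e + y)
  rw [hf, hf', ht, ht']
  ext1
  · simp only [mul_assoc]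
    rw [hx', ← mul_assoc (pos F c e)⁻¹]
    have := hx (D.φ (ε (vty F w) + z) - D.φ (ε (vty F w)))
    rw [← mul_assoc (vElt _ _ _) (pos F c e)⁻¹, mul_inv_eq_iff_eq_mul.2 (by rw [mul_assoc, ← this, inv_mul_cancel_left])]
  · ext1
    · simp only [mul_assoc]
      rw [(pw_comm hvw _ _).eq]
    · rfl

/-- The action of the large group on triples. -/
noncomputable def largeAct (D : Data) : RightAct (cycleGraph D.m) (fun _ => D.M) (Tr D) where
  a := trAct
  a_zero v := by
    rintro ⟨γ, h, ε⟩
    rcases hk : k1 h v with _ | ⟨c, e⟩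
    · rw [trAct_none hk]; simp
    · rw [trAct_some hk]; simp
  a_add v y z := by
    rintro ⟨γ, h, ε⟩
    rcases hk : k1 h v with _ | ⟨c, e⟩
    · rw [trAct_none hk, trAct_none hk, trAct_none (k1_mul_of_none hk y), fr_mul_of_none hk]
      simp only [Function.update_self, Function.update_idem, pw_add, mul_assoc, ← vElt_add,
        add_assoc]
      congr 3
      ring
    · have hb' : h * pw v y * pw v (-(e + y)) = h * pw v (-e) := by
        rw [mul_assoc, ← pw_add]; congr 2; ring
      rw [trAct_some hk, trAct_some hk, trAct_some (k1_mul hk y), hb']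
      simp only [pw_add, mul_assoc, add_assoc, mul_inv_cancel_left]
  a_comm v w hvw y z := by
    rintro ⟨γ, h, ε⟩
    rcases hv : k1 h v with _ | ⟨c, e⟩
    · rcases hw : k1 h w with _ | ⟨c, e⟩
      · exact trAct_comm_none hvw hv hw y z γ ε
      · exact (trAct_comm_some hvw.symm hw z y γ ε).symm
    · exact trAct_comm_some hvw hv y z γ ε

end Data

end GraphProdQIE

namespace GraphProdQIE

namespace Data

variable {D : Data}

open Cell

theorem run_gp_rot {t : ZMod D.n} {c : ZMod D.N → Cell D} (h : Rot t c) (s z : ZMod D.N)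
    (τ : ZMod D.n → ZMod D.N) : (ptAct D).run (gp t z) (c s, τ) = (c (s + z), τ) :=
  (RightAct.run_pw _ _ _ _).trans (h s z τ)

theorem run_dF (h : S D) {j : ℕ} (hj : j ≤ D.k) (τ : ZMod D.n → ZMod D.N) :
    (ptAct D).run (dF (fr h) j) (gon h 0, τ) = (gon h j, τ) := by
  induction j with
  | zero => simp [dF]
  | succ j ih =>
    rw [dF, RightAct.run_mul, ih (by omega)]
    split_ifs with hp
    · have := run_gp_rot (rot_PD h (i := j + 1) (by omega) (by omega)) 0 1 τ
      simpa using this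
    · have hc : D.IsChord (j + 1, false) := ⟨by simp only; omega, hj⟩
      have h2 := run_gp_rot (rot_cork h hc 0) 0 1 τ
      have h3 := run_gp_rot (rot_cork_swap h hc 1) 0 1 τ
      rw [zero_add] at h2 h3
      rw [cork_bit_same _ _ (Or.inl rfl)] at h2
      rw [cork_bit_same _ _ (Or.inr rfl)] at h3
      simp only [Frame.nxt_ty_zero, Bool.false_eq_true, if_false, Nat.add_sub_cancel, bit_zero,
        bit_one, add_zero] at h2 h3
      rw [RightAct.run_mul, h2, h3]

theorem run_pos (b : S D) {c : Chord} (hc : D.IsChord c) (e : ZMod D.M)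
    (τ : ZMod D.n → ZMod D.N) :
    (ptAct D).run (pos (fr b) c e) (gon b 0, τ) = (gon (b * pw (cl b c) e) 0, τ) := by
  unfold pos
  split_ifs with he
  · simp [he]
  · have h2 := run_gp_rot (rot_cork b hc 0) 0 (D.φ e) τ
    have h3 := gon_cross (b := b) hc he (v := 0) (Or.inl rfl)
    rw [cork_bit_same _ _ (Or.inl rfl), zero_add, ← h3, bit_zero, add_zero] at h2
    rw [RightAct.run_mul, run_dF b (by have := hc.2; omega), h2]

theorem run_vElt {h : S D} {v : ZMod D.m} (hk : k1 h v = none) (z : ZMod D.M)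
    (ε : ZMod D.n → ZMod D.M) :
    (ptAct D).run (vElt (fr h) v
      (D.φ (ε (vty (fr h) v) + z) - D.φ (ε (vty (fr h) v)))) (gon h 0, D.φ ∘ ε) =
    (gon (h * pw v z) 0, D.φ ∘ Function.update ε (vty (fr h) v) (ε (vty (fr h) v) + z)) := by
  obtain ⟨⟨j, l⟩, hs⟩ := exists_site (chord_of_k1_none hk)
  rw [vElt_eq hs, vty_eq hs]
  obtain ⟨hj, hl, hI, rfl⟩ := hs
  simp only at hj hl hI hk ⊢
  have hf := flat_gon hj hl hI hk 0 (D.φ (ε ((fr h).ty j l) + z) - D.φ (ε ((fr h).ty j l)))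
    (D.φ ∘ ε)
  simp only [Function.comp_apply, add_sub_cancel, D.ψφ, pw_zero, mul_one,
    add_sub_cancel_left, ← Function.comp_update] at hf
  rw [sideElt, RightAct.run_mul, RightAct.run_mul, run_dF _ hj]
  refine RightAct.run_inv_eq (ptAct D) ?_
  have h2 := run_dF (h * pw ((fr h).ρ (D.lab j l)) z) hj
    (D.φ ∘ Function.update ε ((fr h).ty j l) (ε ((fr h).ty j l) + z))
  rw [fr_mul_of_none hk] at h2
  rw [h2, ← hf]
  exact (RightAct.run_pw (ptAct D) _ _ _).symm

/-- The embedding of the large group into the small group. -/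
noncomputable def emb (g : S D) : G D := ((largeAct D).run g (1, 1, 0)).1

/-- The point to which an element of the small group moves the base point. -/
noncomputable def orbit (g : G D) : Pt D := (ptAct D).run g (gon 1 0, 0)

theorem orbit_emb (g : S D) : ((largeAct D).run g (1, 1, 0)).2.1 = g ∧
    orbit (emb g) = (gon g 0, D.φ ∘ ((largeAct D).run g (1, 1, 0)).2.2) := by
  induction g using gp_induction with
  | one =>
    have : (D.φ ∘ (0 : ZMod D.n → ZMod D.M)) = 0 := by ext; simp [D.φ0]
    simp [orbit, emb, this]
  | mul g v z ih =>
    simp only [emb, orbit, RightAct.run_mul_pw] at ih ⊢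
    obtain ⟨ih1, ih2⟩ := ih
    generalize (largeAct D).run g (1, 1, 0) = x at ih1 ih2 ⊢
    obtain ⟨γ, h, ε⟩ := x
    dsimp only at ih1 ih2
    subst ih1
    change (trAct v z (γ, h, ε)).2.1 = _ ∧ (ptAct D).run (trAct v z (γ, h, ε)).1 _ =
      (_, D.φ ∘ (trAct v z (γ, h, ε)).2.2)
    rcases hk : k1 h v with _ | ⟨c, e⟩
    · rw [trAct_none hk]
      refine ⟨rfl, ?_⟩
      simp only
      rw [RightAct.run_mul, ih2, run_vElt hk]
    · rw [trAct_some hk]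
      refine ⟨rfl, ?_⟩
      simp only
      have hc := (Frame.chord_eq_some _).1
        (chord_of_k1 (by have := k1_mul hk (-e); rwa [add_neg_cancel] at this))
      have hcl : cl (h * pw v (-e)) c = v := hc.2
      have hb : h * pw v (-e) * pw v e = h := by rw [mul_assoc, ← pw_add]; simp
      have h1 := run_pos (h * pw v (-e)) hc.1 e (D.φ ∘ ε)
      have h2 := run_pos (h * pw v (-e)) hc.1 (e + z) (D.φ ∘ ε)
      rw [hcl] at h1 h2
      rw [hb] at h1
      rw [pw_add, ← mul_assoc, hb] at h2
      rw [RightAct.run_mul, RightAct.run_mul, ih2, RightAct.run_inv_eq (ptAct D) h1, h2]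

theorem nrm_dF_le (F : Frame D) (j : ℕ) : nrm (dF F j) ≤ 2 * j := by
  have h1 : ∀ t : ZMod D.n, nrm (gp t (1 : ZMod D.N) : G D) ≤ 1 := fun t => by
    rw [gp, pw_one]; exact nrm_gen_le t
  induction j with
  | zero => simp [dF]
  | succ j ih =>
    rw [dF]
    refine (nrm_mul_le _ _).trans ?_
    split_ifs
    · have := h1 (F.ty j 3)
      omega
    · have h2 := nrm_mul_le (gp (F.ty j 2) (1 : ZMod D.N) : G D) (gp (F.ty j 3) 1)
      have := h1 (F.ty j 2)
      have := h1 (F.ty j 3)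
      omega

theorem nrm_vElt_le {C : ℕ} (F : Frame D) {v : ZMod D.m} (hv : F.chord v = none) {s : ZMod D.N}
    (hs : ∀ t, nrm (gp t s : G D) ≤ C) : nrm (vElt F v s) ≤ 4 * D.k + C := by
  obtain ⟨x, hx⟩ := exists_site hv
  rw [vElt_eq hx, sideElt]
  have h1 := nrm_dF_le F x.1
  have h2 := nrm_mul_le (dF F x.1 * gp (F.ty x.1 x.2) s) (dF F x.1)⁻¹
  have h3 := nrm_mul_le (dF F x.1) (gp (F.ty x.1 x.2) s)
  rw [nrm_inv] at h2
  have h4 := hs (F.ty x.1 x.2)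
  have := hx.1
  omega

theorem nrm_pos_le {C : ℕ} (hC : ∀ t e, nrm (gp t (D.φ (e + 1) - D.φ e) : G D) ≤ C)
    (F : Frame D) {c : Chord} (hc : c.1 ≤ D.k) (e : ZMod D.M) :
    nrm ((pos F c e)⁻¹ * pos F c (e + 1)) ≤ 4 * D.k + C := by
  have h1 := nrm_dF_le F (c.1 - 1)
  have h2 := hC ((F.nxt c).ty 0 2) e
  unfold pos
  by_cases he : e = 0
  · by_cases he' : e + 1 = 0
    · rw [if_pos he, if_pos he']
      simp
    · rw [if_pos he, if_neg he', inv_one, one_mul]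
      subst he
      rw [D.φ0, sub_zero] at h2
      have h3 := nrm_mul_le (dF F (c.1 - 1)) (gp ((F.nxt c).ty 0 2) (D.φ (0 + 1)))
      omega
  · by_cases he' : e + 1 = 0
    · rw [if_neg he, if_pos he', mul_one, nrm_inv]
      have h3 : nrm (gp ((F.nxt c).ty 0 2) (D.φ e)) ≤ C := by
        rwa [he', D.φ0, zero_sub, gp, pw_neg, nrm_inv] at h2
      have h4 := nrm_mul_le (dF F (c.1 - 1)) (gp ((F.nxt c).ty 0 2) (D.φ e))
      omega
    · rw [if_neg he, if_neg he', mul_inv_rev, mul_assoc, inv_mul_cancel_left, gp, ← pw_neg,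
        ← pw_add, neg_add_eq_sub]
      exact h2.trans (by omega)

theorem emb_lipschitz {C : ℕ} (hC : ∀ t e, nrm (gp t (D.φ (e + 1) - D.φ e) : G D) ≤ C)
    (g h : S D) : nrm ((emb g)⁻¹ * emb h) ≤ (4 * D.k + C) * nrm (g⁻¹ * h) := by
  refine (largeAct D).lipschitz (fun x => x.1) _ (fun x v => ?_) _ g h
  obtain ⟨γ, h, ε⟩ := x
  change nrm (γ⁻¹ * (trAct v 1 (γ, h, ε)).1) ≤ _
  rcases hk : k1 h v with _ | ⟨c, e⟩
  · rw [trAct_none hk]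
    simp only [inv_mul_cancel_left]
    exact nrm_vElt_le _ (chord_of_k1_none hk) fun t => hC t _
  · rw [trAct_some hk]
    simp only [inv_mul_cancel_left]
    have hc := (Frame.chord_eq_some _).1
      (chord_of_k1 (by have := k1_mul hk (-e); rwa [add_neg_cancel] at this))
    exact nrm_pos_le hC _ hc.1.2 e

theorem emb_isQIEWith {C C' : ℕ} (hC : ∀ t e, nrm (gp t (D.φ (e + 1) - D.φ e) : G D) ≤ C)
    (f : Cell D → S D) (hf : ∀ h, f (gon h 0) = h)
    (hC' : ∀ (x : Pt D) t, nrm ((f x.1)⁻¹ * f (act t 1 x).1) ≤ C') :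
    IsQIEWith (wordDist (graphProdGen _ _)) (wordDist (graphProdGen _ _))
      (emb : S D → G D) :=
  isQIEWith_of_nrm (R := fun g => f (orbit g).1) (emb_lipschitz hC)
    (fun g h => (ptAct D).lipschitz (fun x => f x.1) C' hC' _ g h)
    (fun g => by rw [(orbit_emb g).2]; exact hf g)

theorem emb_injective : Function.Injective (emb : S D → G D) := fun g h hgh => by
  have h1 := (orbit_emb g).2
  rw [hgh, (orbit_emb h).2] at h1
  have := congrArg Prod.fst h1
  simp only [gon.injEq, and_true] at this
  exact this.symm

/-- The embedding is a homomorphism when there are no chords and the vertex groups are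
preserved. -/
theorem emb_mul (hq : D.q = 0) (hφ : ∀ e z, D.φ (e + z) - D.φ e = D.φ z) (g h : S D) :
    emb (g * h) = emb g * emb h := by
  have hk : ∀ (h : S D) v, k1 h v = none := fun h v => by
    rcases hk : k1 h v with _ | ⟨c, e⟩
    · rfl
    · exact absurd hq (q_ne_zero ((Frame.chord_eq_some _).1
        (chord_of_k1 (by have := k1_mul hk (-e); rwa [add_neg_cancel] at this))).1)
  have hfr : ∀ h : S D, fr h = fr 1 := fun h => by
    induction h using gp_induction with
    | one => rfl
    | mul h v z ih => rw [fr_mul_of_none (hk h v), ih]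
  have key : ∀ (γ : G D) (g : S D) ε, ((largeAct D).run h (γ, g, ε)).1 = γ * emb h := by
    intro γ g ε
    unfold emb
    induction h using gp_induction with
    | one => simp
    | mul h v z ih =>
      simp only [RightAct.run_mul_pw]
      generalize (largeAct D).run h (γ, g, ε) = x at ih ⊢
      generalize (largeAct D).run h (1, 1, 0) = y at ih ⊢
      obtain ⟨γ₁, h₁, ε₁⟩ := x
      obtain ⟨γ₂, h₂, ε₂⟩ := y
      dsimp only at ih
      change (trAct v z (γ₁, h₁, ε₁)).1 = γ * (trAct v z (γ₂, h₂, ε₂)).1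
      rw [trAct_none (hk _ _), trAct_none (hk _ _), hfr h₁, hfr h₂, ih]
      simp only [hφ, mul_assoc]
  rw [emb, RightAct.run_mul]
  exact key _ _ _

end Data

end GraphProdQIE

namespace GraphProdQIE

/-- The data for infinite vertex groups. -/
abbrev intData (a p q : ℕ) (hp : 1 ≤ p) : Data where
  a := a
  p := p
  q := q
  M := 0
  N := 0
  hp := hp
  hN := by norm_num
  φ := fun e : ℤ => (if e ≤ 0 then e else e + 1 : ℤ)
  ψ := fun s : ℤ => (if s ≤ 0 then s else s - 1 : ℤ)
  ψφ := fun e : ℤ => by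
    change (if (if e ≤ 0 then e else e + 1) ≤ 0 then (if e ≤ 0 then e else e + 1)
      else (if e ≤ 0 then e else e + 1) - 1 : ℤ) = e
    split_ifs <;> omega
  φ0 := rfl
  φ_ne_one _ := fun e : ℤ => by
    change (if e ≤ 0 then e else e + 1 : ℤ) ≠ (1 : ℤ)
    split_ifs <;> omega
  ψ_one _ := rfl
  φψ _ := fun (s : ℤ) (hs : s ≠ 1) => by
    change (if (if s ≤ 0 then s else s - 1) ≤ 0 then (if s ≤ 0 then s else s - 1)
      else (if s ≤ 0 then s else s - 1) + 1 : ℤ) = s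
    split_ifs <;> omega

/-- The data for finite vertex groups whose order increases by one. -/
abbrev succData (a p q M : ℕ) (hp : 1 ≤ p) (hM : M ≠ 0) : Data where
  a := a
  p := p
  q := q
  M := M
  N := M + 1
  hp := hp
  hN := by omega
  φ e := if e = 0 then 0 else ((e.val + 1 : ℕ) : ZMod (M + 1))
  ψ s := ((s.val - 1 : ℕ) : ZMod M)
  ψφ e := by
    have : NeZero M := ⟨hM⟩
    split_ifs with he
    · simp [he]
    · rw [ZMod.val_natCast_of_lt (by have := e.val_lt; omega)]
      simp
  φ0 := by simp
  φ_ne_one _ e h := by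
    have : NeZero M := ⟨hM⟩
    split_ifs at h with he
    · have : Fact (1 < M + 1) := ⟨by omega⟩
      exact zero_ne_one h
    · have h1 := congrArg ZMod.val h
      have h2 := (ZMod.val_ne_zero e).2 he
      have h3 := e.val_lt
      have : Fact (1 < M + 1) := ⟨by omega⟩
      rw [ZMod.val_natCast_of_lt (by omega), ZMod.val_one] at h1
      omega
  ψ_one _ := by
    have : Fact (1 < M + 1) := ⟨by omega⟩
    rw [ZMod.val_one]
    simp
  φψ _ s hs := by
    have : NeZero M := ⟨hM⟩
    have : Fact (1 < M + 1) := ⟨by omega⟩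
    have h1 := s.val_lt
    by_cases h0 : s = 0
    · simp [h0]
    have h2 := (ZMod.val_ne_zero s).2 h0
    have h3 : s.val ≠ 1 := fun h => hs (ZMod.val_injective _ (h.trans (ZMod.val_one _).symm))
    have h4 : ((s.val - 1 : ℕ) : ZMod M).val = s.val - 1 := ZMod.val_natCast_of_lt (by omega)
    rw [if_neg (by rw [← ne_eq, ← ZMod.val_ne_zero, h4]; omega), h4,
      show s.val - 1 + 1 = s.val by omega, ZMod.natCast_zmod_val]

/-- The data for equal vertex groups. -/
abbrev idData (a p M : ℕ) (hp : 1 ≤ p) (hM : M ≠ 1) : Data where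
  a := a
  p := p
  q := 0
  M := M
  N := M
  hp := hp
  hN := hM
  φ := id
  ψ := id
  ψφ _ := rfl
  φ0 := rfl
  φ_ne_one h := absurd rfl h
  ψ_one h := absurd rfl h
  φψ h := absurd rfl h

namespace Data

theorem emb_isQIEWith_of_ne_zero (D : Data) (hM : D.M ≠ 0) (hN : D.N ≠ 0) :
    IsQIEWith (wordDist (graphProdGen _ _)) (wordDist (graphProdGen _ _))
      (emb : S D → G D) :=
  emb_isQIEWith (fun t _ => nrm_pw_le t hN _) root (fun _ => rfl) (nrm_root_act hM)

theorem emb_intData_isQIEWith (a p q : ℕ) (hp : 1 ≤ p) :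
    IsQIEWith (wordDist (graphProdGen _ _)) (wordDist (graphProdGen _ _))
      (emb : S (intData a p q hp) → G (intData a p q hp)) := by
  refine emb_isQIEWith (C := 2) (fun t e => ?_) val (fun _ => rfl)
    (nrm_val_act rfl rfl fun s => ?_)
  · refine (nrm_pw_intCast_le (K := fun _ => (intData a p q hp).N) t _).trans ?_
    change ℤ at e
    change ((if e + 1 ≤ 0 then e + 1 else e + 1 + 1) - (if e ≤ 0 then e else e + 1) : ℤ).natAbs ≤ 2
    split_ifs <;> omega
  · change ℤ at s
    change ((if s + 1 ≤ 0 then s + 1 else s + 1 - 1) - (if s ≤ 0 then s else s - 1) : ℤ) = 0 ∨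
      ((if s + 1 ≤ 0 then s + 1 else s + 1 - 1) - (if s ≤ 0 then s else s - 1) : ℤ) = 1
    split_ifs <;> omega

/-- The orders of the vertex groups may be decreased on the source and increased on the target. -/
theorem exists_isQIEWith (D : Data)
    (hD : IsQIEWith (wordDist (graphProdGen _ _)) (wordDist (graphProdGen _ _))
      (emb : S D → G D)) {K : ZMod D.m → ℕ} {L : ZMod D.n → ℕ}
    (hK : ∀ v, K v = 0 → D.M = 0) (hK' : D.M ≠ 0 → ∀ v, K v ≤ D.M)
    (hL : D.N = 0 → ∀ w, L w = 0) (hL' : ∀ w, L w ≠ 0 → D.N ≤ L w) :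
    ∃ F : GP (cycleGraph D.m) K → GP (cycleGraph D.n) L,
      IsQIEWith (wordDist (graphProdGen _ _)) (wordDist (graphProdGen _ _)) F := by
  obtain ⟨F₁, h₁⟩ := exists_isQIEWith_of_le (K := K) (K' := fun _ => D.M) (cycleGraph D.m) hK
    (fun v h => hK' h v)
  obtain ⟨F₂, h₂⟩ := exists_isQIEWith_of_le (K := fun _ => D.N) (K' := L) (cycleGraph D.n)
    (fun w h => hL h w) hL'
  exact ⟨_, IsQIEWith.comp h₂ (IsQIEWith.comp hD h₁)⟩

end Data

theorem exists_cycOrd {V : Type*} {M : V → ℕ∞} (hM : ∀ v, 2 ≤ M v) :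
    ∃ K : V → ℕ, (∀ v, K v ≠ 1) ∧ M = fun v => cycOrd (K v) := by
  have h : ∀ x : ℕ∞, 2 ≤ x → ∃ k, k ≠ 1 ∧ x = cycOrd k := by
    intro x hx
    induction x using ENat.recTopCoe with
    | top => exact ⟨0, by norm_num, rfl⟩
    | coe k =>
      have h2 : 2 ≤ k := by exact_mod_cast hx
      exact ⟨k, by omega, (if_neg (by omega)).symm⟩
  choose K hK1 hK using fun v => h (M v) (hM v)
  exact ⟨K, hK1, funext hK⟩

theorem cycOrd_le_iff {k B : ℕ} : cycOrd k ≤ B ↔ k ≠ 0 ∧ k ≤ B := by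
  unfold cycOrd
  split_ifs with h <;> simp [h]

theorem le_cycOrd_iff {k B : ℕ} : (B : ℕ∞) ≤ cycOrd k ↔ (k ≠ 0 → B ≤ k) := by
  unfold cycOrd
  split_ifs with h <;> simp [h]

theorem twist_mul {V : Type*} [DecidableEq V] {Γ : SimpleGraph V} {K K' : V → ℕ}
    {φ : ∀ v, ZMod (K v) → ZMod (K' v)} (hφ : ∀ v e z, φ v (e + z) - φ v e = φ v z)
    (g h : GP Γ K) : ((twist Γ φ).run (g * h) (1, 0)).1 =
      ((twist Γ φ).run g (1, 0)).1 * ((twist Γ φ).run h (1, 0)).1 := by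
  have key : ∀ x, ((twist Γ φ).run h x).1 = x.1 * ((twist Γ φ).run h (1, 0)).1 := by
    intro x
    induction h using gp_induction with
    | one => simp
    | mul h v z ih =>
      simp only [RightAct.run_mul_pw]
      simp only [twist, hφ] at ih ⊢
      rw [ih, mul_assoc]
  rw [RightAct.run_mul]
  exact key _

/-- The vertex group embeddings of index `k` induce an embedding of graph products. -/
theorem exists_hom_of_mul {V : Type*} [DecidableEq V] (Γ : SimpleGraph V) {M k : ℕ} (hM : M ≠ 0)
    (hk : 0 < k) : ∃ F : GP Γ (fun _ => M) →* GP Γ (fun _ => k * M), Function.Injective F ∧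
      IsQIEWith (wordDist (graphProdGen _ _)) (wordDist (graphProdGen _ _)) (fun g => F g) := by
  have : NeZero M := ⟨hM⟩
  have hkM : k * M ≠ 0 := by positivity
  set φ : V → ZMod M → ZMod (k * M) := fun _ e => ((k * e.val : ℕ) : ZMod (k * M)) with hφdef
  set ψ : V → ZMod (k * M) → ZMod M := fun _ s => ((s.val / k : ℕ) : ZMod M) with hψdef
  have h0 : ∀ v, φ v 0 = 0 := fun v => by simp [hφdef]
  have hψφ : ∀ v e, ψ v (φ v e) = e := fun v e => by
    simp only [hφdef, hψdef]
    rw [ZMod.val_natCast_of_lt (Nat.mul_lt_mul_of_pos_left e.val_lt hk),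
      Nat.mul_div_cancel_left _ hk, ZMod.natCast_zmod_val]
  have hadd : ∀ v e z, φ v (e + z) - φ v e = φ v z := fun v e z => by
    rw [sub_eq_iff_eq_add]
    simp only [hφdef]
    rw [← Nat.cast_add, ← mul_add, ZMod.natCast_eq_natCast_iff', Nat.mul_mod_mul_left,
      Nat.mul_mod_mul_left, ZMod.val_add, Nat.mod_mod, add_comm]
  refine ⟨MonoidHom.mk' (fun g => ((twist Γ φ).run g (1, 0)).1) (twist_mul hadd), fun g h hgh => ?_,
    twist_isQIEWith h0 hψφ (k * M) M (fun v _ => nrm_pw_le v hkM _) fun v _ => nrm_pw_le v hM _⟩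
  have h1 := twist_retract h0 hψφ g
  have h2 := twist_retract h0 hψφ h
  simp only [MonoidHom.mk'_apply] at hgh
  rw [hgh, h2] at h1
  exact (congrArg Prod.fst h1).symm

end GraphProdQIE

open GraphProdQIE GraphProdQIE.Data in
/-- Quasiisometric embeddings between graph products of cyclic groups
over cycles (Theorem `thm:cyclic_product_cyclic`). -/
theorem graph_products_qie (m n p q : ℕ) (hm : 6 < m) (hn : 6 < n) (hp : 1 ≤ p)
    (heq : m = n + p * (n - 4) + q * (n - 2))
    (M : ZMod m → ℕ∞) (N : ZMod n → ℕ∞)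
    (hM : ∀ v, 2 ≤ M v) (hN : ∀ w, 2 ≤ N w) :
    (((⨅ w, N w) = ⊤ ∨ (⨆ v, M v) < (⨅ w, N w) ∨
        ((⨆ v, M v) = (⨅ w, N w) ∧ (⨅ w, N w) < ⊤ ∧ q = 0)) →
      ∃ F : GraphProd (cycleGraph m) M → GraphProd (cycleGraph n) N,
        IsQIEWith (wordDist (graphProdGen (cycleGraph m) M))
          (wordDist (graphProdGen (cycleGraph n) N)) F) ∧
    ((q = 0 ∧ ∃ (M₀ N₀ k : ℕ), 0 < k ∧ (∀ v, M v = (M₀ : ℕ∞)) ∧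
        (∀ w, N w = (N₀ : ℕ∞)) ∧ N₀ = k * M₀) →
      ∃ F : GraphProd (cycleGraph m) M →* GraphProd (cycleGraph n) N,
        Function.Injective F ∧
        IsQIEWith (wordDist (graphProdGen (cycleGraph m) M))
          (wordDist (graphProdGen (cycleGraph n) N)) (fun g => F g)) := by
  obtain ⟨a, rfl⟩ : ∃ a, n = a + 7 := ⟨n - 7, by omega⟩
  obtain rfl : m = a + 7 + p * (a + 3) + q * (a + 5) := heq
  obtain ⟨K, hK1, rfl⟩ := exists_cycOrd hM
  obtain ⟨L, hL1, rfl⟩ := exists_cycOrd hN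
  refine ⟨fun h => ?_, ?_⟩
  · by_cases htop : (⨅ w, cycOrd (L w)) = ⊤
    · have hL : ∀ w, L w = 0 := fun w => by
        by_contra h0
        have h1 := iInf_eq_top.1 htop w
        rw [cycOrd, if_neg h0] at h1
        exact ENat.natCast_ne_top _ h1
      exact exists_isQIEWith (intData a p q hp) (emb_intData_isQIEWith a p q hp)
        (fun _ _ => rfl) (fun h => absurd rfl h) (fun _ => hL) fun w h => absurd (hL w) h
    have hlt : (⨆ v, cycOrd (K v)) < ⊤ := by
      rcases h with h | h | ⟨h, h', -⟩
      · exact absurd h htop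
      · exact h.trans_le le_top
      · rwa [h]
    obtain ⟨B, hB⟩ := ENat.ne_top_iff_exists.1 hlt.ne
    have hKB : ∀ v, K v ≠ 0 ∧ K v ≤ B := fun v =>
      cycOrd_le_iff.1 (hB ▸ le_iSup (fun v => cycOrd (K v)) v)
    have hB2 : 2 ≤ B := by
      have h1 := hKB 0
      have h2 := hK1 0
      omega
    rcases h with h | h | ⟨h, -, rfl⟩
    · exact absurd h htop
    · refine exists_isQIEWith (succData a p q B hp (by omega))
        (emb_isQIEWith_of_ne_zero _ (show B ≠ 0 by omega) (show B + 1 ≠ 0 by omega))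
        (fun v h0 => absurd h0 (hKB v).1) (fun _ v => (hKB v).2)
        (fun h0 => absurd h0 (show B + 1 ≠ 0 by omega)) fun w hw => ?_
      have h1 : (B : ℕ∞) + 1 ≤ cycOrd (L w) := by
        refine Order.add_one_le_of_lt ?_
        rw [hB]
        exact h.trans_le (iInf_le _ w)
      exact le_cycOrd_iff.1 (by exact_mod_cast h1) hw
    · refine exists_isQIEWith (idData a p B hp (by omega))
        (emb_isQIEWith_of_ne_zero _ (show B ≠ 0 by omega) (show B ≠ 0 by omega))
        (fun v h0 => absurd h0 (hKB v).1) (fun _ v => (hKB v).2)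
        (fun h0 => absurd h0 (show B ≠ 0 by omega)) fun w hw => ?_
      refine le_cycOrd_iff.1 ?_ hw
      rw [hB, h]
      exact iInf_le _ w
  · rintro ⟨rfl, M₀, N₀, k, hk, hM₀, hN₀, rfl⟩
    have hconst : ∀ {x B : ℕ}, cycOrd x = B → x = B ∧ x ≠ 0 := fun {x B} h => by
      rw [cycOrd] at h
      split_ifs at h with h0
      · exact absurd h.symm (ENat.natCast_ne_top _)
      · exact ⟨by exact_mod_cast h, h0⟩
    obtain rfl : K = fun _ => M₀ := funext fun v => (hconst (hM₀ v)).1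
    obtain rfl : L = fun _ => k * M₀ := funext fun w => (hconst (hN₀ w)).1
    have hM0 : M₀ ≠ 0 := (hconst (hM₀ 0)).2
    have hN0 : k * M₀ ≠ 0 := (hconst (hN₀ 0)).2
    obtain ⟨F, hF, hF'⟩ := exists_hom_of_mul (cycleGraph (a + 7 + p * (a + 3) + 0 * (a + 5))) hM0 hk
    let D := idData a p (k * M₀) hp (hL1 0)
    let E : S D →* G D := MonoidHom.mk' emb
      (emb_mul rfl fun e z => by simp [D])
    exact ⟨E.comp F, emb_injective.comp hF,
      IsQIEWith.comp (f := fun g => F g) (emb_isQIEWith_of_ne_zero D hN0 hN0) hF'⟩
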